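/- arXiv:2303.01953 — 3 statements merged into one kernel-verified Lean document; each statement's English description precedes it below -/
import Mathlib

section
/- Let q be an odd prime power. Under the action of the group K ≅ PSL(2,q²) on the points of PG(3,q²) (induced by the matrices A^q ⊗ A with A ∈ SL(2,𝔽_{q²})): K acts transitively on O; the K-orbits of the points S₁ = (1,0,0,1) and S₂ = (1,0,0,ξ^{q+1}) are disjoint, have equal size (q³+q)/2, and their union is Σ \ O; and the K-orbits of the points (ξ^{(q+1)/2},0,0,1) and (0,ξ^{(q−1)/2},1,0) are disjoint, have sizes q²(q²+1)(q−1)/2 and q²(q²+1)(q+1)/2 respectively, and their union is H(3,q²) \ O. -/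
noncomputable section

open Matrix

/-- The points of `PG(3,q²)`: the projectivization of `F⁴` where `F = 𝔽_{q²}`. -/
abbrev PGPoint (F : Type*) [Field F] := Projectivization F (Fin 4 → F)

/-- The form `F_γ(X₁,X₂,X₃,X₄) = X₁^q X₄ + X₁ X₄^q − X₂^{q+1} − X₃^{q+1}
    − γ (X₁X₄ − X₂X₃)^{(q+1)/2}`. -/
def Fgam {F : Type*} [Field F] (q : ℕ) (γ : F) (x : Fin 4 → F) : F :=
  x 0 ^ q * x 3 + x 0 * x 3 ^ q - x 1 ^ (q + 1) - x 2 ^ (q + 1)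
    - γ * (x 0 * x 3 - x 1 * x 2) ^ ((q + 1) / 2)

/-- The point set `C_γ` of `PG(3,q²)`, the zero locus of `F_γ`. -/
def Cgam {F : Type*} [Field F] (q : ℕ) (γ : F) : Set (PGPoint F) :=
  {P | ∀ (v : Fin 4 → F) (hv : v ≠ 0), P = Projectivization.mk F v hv → Fgam q γ v = 0}

/-- Kronecker product of two 2×2 matrices, as a 4×4 matrix. -/
def kron {F : Type*} [Field F] (A B : Matrix (Fin 2) (Fin 2) F) :
    Matrix (Fin 4) (Fin 4) F :=
  Matrix.of fun i j =>
    A ⟨i.val / 2, by have := i.isLt; omega⟩ ⟨j.val / 2, by have := j.isLt; omega⟩ *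
    B ⟨i.val % 2, by have := i.isLt; omega⟩ ⟨j.val % 2, by have := j.isLt; omega⟩

/-- Entrywise `q`-th power (the matrix `A^q`). -/
def matq {F : Type*} [Field F] (q : ℕ) (A : Matrix (Fin 2) (Fin 2) F) :
    Matrix (Fin 2) (Fin 2) F :=
  A.map (· ^ q)

/-- The orbit of a point of `PG(3,q²)` under the group `K ≅ PSL(2,q²)` of projectivities
    induced by the matrices `A^q ⊗ A` with `A ∈ SL(2,𝔽_{q²})`. -/
def Korb {F : Type*} [Field F] (q : ℕ) (P : PGPoint F) : Set (PGPoint F) :=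
  {P' | ∃ A : Matrix (Fin 2) (Fin 2) F, A.det = 1 ∧
    ∃ (v : Fin 4 → F) (hv : v ≠ 0) (hw : Matrix.vecMul v (kron (matq q A) A) ≠ 0),
      P = Projectivization.mk F v hv ∧ P' = Projectivization.mk F _ hw}

/-- The orbit of a point of `PG(3,q²)` under the group `G ≅ PGL(2,q²)` of projectivities
    induced by the matrices `A^q ⊗ A` with `A ∈ GL(2,𝔽_{q²})`. -/
def Gorb {F : Type*} [Field F] (q : ℕ) (P : PGPoint F) : Set (PGPoint F) :=
  {P' | ∃ A : Matrix (Fin 2) (Fin 2) F, A.det ≠ 0 ∧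
    ∃ (v : Fin 4 → F) (hv : v ≠ 0) (hw : Matrix.vecMul v (kron (matq q A) A) ≠ 0),
      P = Projectivization.mk F v hv ∧ P' = Projectivization.mk F _ hw}

/-- The Hermitian Veronese curve `O = {(1,t,t^q,t^{q+1})} ∪ {(0,0,0,1)}`. -/
def Oset (F : Type*) [Field F] (q : ℕ) : Set (PGPoint F) :=
  {P | (∃ (t : F) (hv : ![1, t, t ^ q, t ^ (q + 1)] ≠ 0),
        P = Projectivization.mk F _ hv) ∨
    ∃ (hv : (![0, 0, 0, 1] : Fin 4 → F) ≠ 0), P = Projectivization.mk F _ hv}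

/-- The Baer subgeometry `Σ = {(a,b,b^q,c) : a,c ∈ 𝔽_q, b ∈ 𝔽_{q²}}`. -/
def SigmaSet (F : Type*) [Field F] (q : ℕ) : Set (PGPoint F) :=
  {P | ∃ (a b c : F) (hv : ![a, b, b ^ q, c] ≠ 0),
    a ^ q = a ∧ c ^ q = c ∧ P = Projectivization.mk F _ hv}

/-- The hyperbolic quadric `Q⁺(3,q²) : X₁X₄ − X₂X₃ = 0`. -/
def Qplus (F : Type*) [Field F] : Set (PGPoint F) :=
  {P | ∀ (v : Fin 4 → F) (hv : v ≠ 0), P = Projectivization.mk F v hv →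
    v 0 * v 3 - v 1 * v 2 = 0}

/-- A line of `PG(3,q²)`: the set of points lying in a 2-dimensional subspace. -/
def IsLine {F : Type*} [Field F] (ℓ : Set (PGPoint F)) : Prop :=
  ∃ W : Submodule F (Fin 4 → F), Module.finrank F W = 2 ∧ ℓ = {P | P.rep ∈ W}

/-- A plane of `PG(3,q²)`: the set of points lying in a 3-dimensional subspace. -/
def IsPlane {F : Type*} [Field F] (π : Set (PGPoint F)) : Prop :=
  ∃ W : Submodule F (Fin 4 → F), Module.finrank F W = 3 ∧ π = {P | P.rep ∈ W}

/-- `x ↦ x ^ q` is additive and squares to the identity, as on a field with `q ^ 2` elements. -/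
structure IsInvolutivePower (F : Type*) [Field F] (q : ℕ) : Prop where
  add : ∀ x y : F, (x + y) ^ q = x ^ q + y ^ q
  invol : ∀ x : F, (x ^ q) ^ q = x

namespace IsInvolutivePower

variable {F : Type*} [Field F] {q : ℕ}

lemma ne_zero (h : IsInvolutivePower F q) : q ≠ 0 := by
  rintro rfl
  simpa using h.add 0 0

lemma neg (h : IsInvolutivePower F q) (x : F) : (-x) ^ q = -x ^ q := by
  have := h.add x (-x)
  rw [add_neg_cancel, zero_pow h.ne_zero] at this
  linear_combination -this

lemma sub (h : IsInvolutivePower F q) (x y : F) : (x - y) ^ q = x ^ q - y ^ q := by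
  rw [sub_eq_add_neg, h.add, h.neg, sub_eq_add_neg]

lemma norm_fixed (h : IsInvolutivePower F q) (x : F) : (x ^ (q + 1)) ^ q = x ^ (q + 1) := by
  rw [pow_succ, mul_pow, h.invol, mul_comm]

lemma kron_matq_mul (h : IsInvolutivePower F q) (A B : Matrix (Fin 2) (Fin 2) F) :
    kron (matq q (A * B)) (A * B) = kron (matq q A) A * kron (matq q B) B := by
  ext i j
  fin_cases i <;> fin_cases j <;>
    simp [kron, matq, mul_apply, Fin.sum_univ_succ, h.add, mul_pow] <;> ring

lemma kron_matq_one (h : IsInvolutivePower F q) :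
    kron (matq q (1 : Matrix (Fin 2) (Fin 2) F)) 1 = 1 := by
  ext i j
  fin_cases i <;> fin_cases j <;> simp [kron, matq, h.ne_zero]

/-- The monoid homomorphism `A ↦ A^q ⊗ A`. -/
def tensorHom (h : IsInvolutivePower F q) :
    Matrix (Fin 2) (Fin 2) F →* Matrix (Fin 4) (Fin 4) F where
  toFun A := kron (matq q A) A
  map_one' := h.kron_matq_one
  map_mul' := h.kron_matq_mul

/-- The action of `SL(2,F)` on the points of `PG(3,F)` through `A ↦ A^q ⊗ A`. -/
abbrev pointAction (h : IsInvolutivePower F q) :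
    MulAction (SpecialLinearGroup (Fin 2) F) (PGPoint F) :=
  MulAction.compHom _ ((Units.map h.tensorHom).comp SpecialLinearGroup.toGL)

end IsInvolutivePower

section Action

variable {F : Type*} [Field F] {q : ℕ}

/-- The vector `(A^q ⊗ A) v`. -/
def tensorAct (q : ℕ) (A : Matrix (Fin 2) (Fin 2) F) (v : Fin 4 → F) : Fin 4 → F :=
  kron (matq q A) A *ᵥ v

lemma tensorAct_eq (A : Matrix (Fin 2) (Fin 2) F) (v : Fin 4 → F) :
    tensorAct q A v =
      ![A 0 0 ^ q * A 0 0 * v 0 + A 0 0 ^ q * A 0 1 * v 1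
          + A 0 1 ^ q * A 0 0 * v 2 + A 0 1 ^ q * A 0 1 * v 3,
        A 0 0 ^ q * A 1 0 * v 0 + A 0 0 ^ q * A 1 1 * v 1
          + A 0 1 ^ q * A 1 0 * v 2 + A 0 1 ^ q * A 1 1 * v 3,
        A 1 0 ^ q * A 0 0 * v 0 + A 1 0 ^ q * A 0 1 * v 1
          + A 1 1 ^ q * A 0 0 * v 2 + A 1 1 ^ q * A 0 1 * v 3,
        A 1 0 ^ q * A 1 0 * v 0 + A 1 0 ^ q * A 1 1 * v 1
          + A 1 1 ^ q * A 1 0 * v 2 + A 1 1 ^ q * A 1 1 * v 3] := by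
  ext i
  fin_cases i <;> simp [tensorAct, kron, matq, mulVec, dotProduct, Fin.sum_univ_succ] <;> ring

lemma tensorAct_smul (A : Matrix (Fin 2) (Fin 2) F) (c : F) (v : Fin 4 → F) :
    tensorAct q A (c • v) = c • tensorAct q A v :=
  mulVec_smul _ _ _

lemma tensorAct_mul (h : IsInvolutivePower F q) (A B : Matrix (Fin 2) (Fin 2) F)
    (v : Fin 4 → F) : tensorAct q (A * B) v = tensorAct q A (tensorAct q B v) := by
  simp [tensorAct, h.kron_matq_mul]

lemma tensorAct_inv_left (h : IsInvolutivePower F q) {A : Matrix (Fin 2) (Fin 2) F}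
    (hA : A.det ≠ 0) (v : Fin 4 → F) : tensorAct q A⁻¹ (tensorAct q A v) = v := by
  rw [← tensorAct_mul h, nonsing_inv_mul _ (isUnit_iff_ne_zero.2 hA)]
  simp [tensorAct, h.kron_matq_one]

lemma tensorAct_ne_zero (h : IsInvolutivePower F q) {A : Matrix (Fin 2) (Fin 2) F}
    (hA : A.det ≠ 0) {v : Fin 4 → F} (hv : v ≠ 0) : tensorAct q A v ≠ 0 := by
  intro h0
  apply hv
  rw [← tensorAct_inv_left h hA v, h0]
  simp [tensorAct]

lemma kron_matq_transpose (A : Matrix (Fin 2) (Fin 2) F) :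
    kron (matq q Aᵀ) Aᵀ = (kron (matq q A) A)ᵀ := by
  ext i j
  simp [kron, matq]

lemma mem_Korb_mk {v : Fin 4 → F} (hv : v ≠ 0) {P : PGPoint F} :
    P ∈ Korb q (Projectivization.mk F v hv) ↔ ∃ A : Matrix (Fin 2) (Fin 2) F, A.det = 1 ∧
      ∃ hw : tensorAct q A v ≠ 0, P = Projectivization.mk F _ hw := by
  constructor
  · rintro ⟨A, hA, w, hw, hAw, hvw, rfl⟩
    obtain ⟨c, rfl⟩ := (Projectivization.mk_eq_mk_iff' F v w hv hw).1 hvw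
    have hc : c ≠ 0 := by rintro rfl; simp at hv
    have key : w ᵥ* kron (matq q A) A = tensorAct q Aᵀ w := by
      rw [tensorAct, kron_matq_transpose, mulVec_transpose]
    refine ⟨Aᵀ, by simpa using hA, ?_, ?_⟩
    · rw [tensorAct_smul, ← key]
      exact smul_ne_zero hc hAw
    · rw [Projectivization.mk_eq_mk_iff']
      refine ⟨c⁻¹, ?_⟩
      rw [tensorAct_smul, key, inv_smul_smul₀ hc]
  · rintro ⟨A, hA, hw, rfl⟩
    have key : v ᵥ* kron (matq q Aᵀ) Aᵀ = tensorAct q A v := by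
      rw [tensorAct, kron_matq_transpose, vecMul_transpose]
    refine ⟨Aᵀ, by simpa using hA, v, hv, by rwa [key], rfl, ?_⟩
    simp_rw [key]

lemma Korb_eq_orbit (h : IsInvolutivePower F q) (P : PGPoint F) :
    let := h.pointAction
    Korb q P = MulAction.orbit (SpecialLinearGroup (Fin 2) F) P := by
  let := h.pointAction
  induction P using Projectivization.ind with | h v hv
  ext P'
  rw [mem_Korb_mk, MulAction.mem_orbit_iff]
  constructor
  · rintro ⟨A, hA, hw, rfl⟩
    exact ⟨⟨A, hA⟩, rfl⟩
  · rintro ⟨A, rfl⟩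
    exact ⟨A.1, A.2, tensorAct_ne_zero h (by rw [A.2]; exact one_ne_zero) hv, rfl⟩

lemma card_SL_two [Fintype F] :
    Nat.card (SpecialLinearGroup (Fin 2) F) =
      Fintype.card F * (Fintype.card F ^ 2 - 1) := by
  classical
  have e : GL (Fin 2) F ≃ SpecialLinearGroup (Fin 2) F × Fˣ :=
    { toFun := fun g => (⟨of ![![g 0 0, g 0 1],
          ![(g.det⁻¹ : Fˣ) * g 1 0, (g.det⁻¹ : Fˣ) * g 1 1]], by
          have := g.det.inv_mul
          rw [GeneralLinearGroup.val_det_apply, det_fin_two] at this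
          rw [det_fin_two_of]
          linear_combination this⟩, g.det)
      invFun := fun x => GeneralLinearGroup.mkOfDetNeZero
        (of ![![x.1 0 0, x.1 0 1], ![x.2 * x.1 1 0, x.2 * x.1 1 1]]) (by
          have := x.1.2
          rw [det_fin_two] at this
          rw [det_fin_two_of]
          have h2 : x.1 0 0 * (↑x.2 * x.1 1 1) - x.1 0 1 * (↑x.2 * x.1 1 0) = (x.2 : F) := by
            linear_combination (x.2 : F) * this
          rw [h2]
          exact x.2.ne_zero)
      left_inv := fun g => by
        have hg : (g : Matrix (Fin 2) (Fin 2) F).det ≠ 0 := g.det.ne_zero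
        ext i j
        fin_cases i <;> fin_cases j <;>
          simp [GeneralLinearGroup.mkOfDetNeZero, mul_inv_cancel_left₀ hg]
      right_inv := fun x => by
        have h1 : x.1 0 0 * (x.2 * x.1 1 1) - x.1 0 1 * (x.2 * x.1 1 0) = (x.2 : F) := by
          have := x.1.2
          rw [det_fin_two] at this
          linear_combination (x.2 : F) * this
        refine Prod.ext ?_ ?_
        · ext i j
          fin_cases i <;> fin_cases j <;> simp [h1, GeneralLinearGroup.mkOfDetNeZero]
        · ext
          simpa [GeneralLinearGroup.mkOfDetNeZero] using h1 }
  have hc := Nat.card_congr e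
  rw [Nat.card_prod, card_GL_field, Nat.card_units, Nat.card_eq_fintype_card (α := F)] at hc
  simp only [Fin.prod_univ_two, Fin.val_zero, Fin.val_one, pow_zero, pow_one] at hc
  have h1 : 1 < Fintype.card F := Fintype.one_lt_card
  have h2 : Fintype.card F ^ 2 - Fintype.card F = Fintype.card F * (Fintype.card F - 1) := by
    rw [Nat.mul_sub, mul_one, pow_two]
  rw [h2] at hc
  apply Nat.eq_of_mul_eq_mul_right (Nat.sub_pos_of_lt h1)
  rw [← hc]
  ring

lemma ncard_Korb_mul_card_stabilizer [Fintype F] (h : IsInvolutivePower F q) {v : Fin 4 → F}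
    (hv : v ≠ 0) :
    (Korb q (Projectivization.mk F v hv)).ncard *
      Nat.card {A : SpecialLinearGroup (Fin 2) F // ∃ c : F, c • v = tensorAct q A.1 v} =
      Fintype.card F * (Fintype.card F ^ 2 - 1) := by
  classical
  let := h.pointAction
  rw [Korb_eq_orbit h, ← card_SL_two,
    ← Nat.card_congr (MulAction.orbitProdStabilizerEquivGroup (SpecialLinearGroup (Fin 2) F)
      (Projectivization.mk F v hv)), Nat.card_prod, Nat.card_coe_set_eq]
  congr 1
  refine Nat.card_congr (Equiv.subtypeEquivRight fun A => ?_)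
  rw [MulAction.mem_stabilizer_iff]
  exact (Projectivization.mk_eq_mk_iff' F _ v
    (tensorAct_ne_zero h (by rw [A.2]; exact one_ne_zero) hv) hv).symm

end Action

section FiniteField

variable {F : Type*} [Field F] {q : ℕ}

lemma isInvolutivePower_of_card [Fintype F] {p n : ℕ} (hp : p.Prime) (hq : q = p ^ n)
    (hF : Fintype.card F = q ^ 2) : IsInvolutivePower F q := by
  have : Fact p.Prime := ⟨hp⟩
  have : CharP F p := charP_of_card_eq_prime_pow (f := n * 2) (by rw [hF, hq, pow_mul])
  refine ⟨fun x y => ?_, fun x => ?_⟩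
  · rw [hq, add_pow_char_pow]
  · rw [← pow_mul, ← pow_two, ← hF, FiniteField.pow_card]

lemma two_ne_zero_of_card [Fintype F] {p n : ℕ} (hp : p.Prime) (hodd : Odd p) (hq : q = p ^ n)
    (hF : Fintype.card F = q ^ 2) : (2 : F) ≠ 0 := by
  have : Fact p.Prime := ⟨hp⟩
  have : CharP F p := charP_of_card_eq_prime_pow (f := n * 2) (by rw [hF, hq, pow_mul])
  exact Ring.two_ne_zero (by rw [ringChar.eq F p]; rintro rfl; simp [Nat.odd_iff] at hodd)

lemma isPrimitiveRoot_of_forall_exists_pow [Fintype F] {ξ : F} (hξ0 : ξ ≠ 0)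
    (hξ : ∀ x : F, x ≠ 0 → ∃ m : ℕ, x = ξ ^ m) : IsPrimitiveRoot ξ (Fintype.card F - 1) := by
  have h1 : orderOf (Units.mk0 ξ hξ0) = Fintype.card F - 1 := by
    rw [orderOf_eq_card_of_forall_mem_powers, Nat.card_units, Nat.card_eq_fintype_card]
    intro x
    obtain ⟨m, hm⟩ := hξ x x.ne_zero
    exact ⟨m, by ext; simp [hm]⟩
  rw [← h1]
  exact IsPrimitiveRoot.coe_units_iff.2 (IsPrimitiveRoot.orderOf (Units.mk0 ξ hξ0))

lemma ncard_pow_eq_one {ξ : F} {N d : ℕ} (hξ : IsPrimitiveRoot ξ N) (hN : 0 < N) (hd : d ∣ N) :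
    {x : F | x ^ d = 1}.ncard = d := by
  classical
  have hd0 : 0 < d := Nat.pos_of_dvd_of_pos hd hN
  obtain ⟨e, rfl⟩ := hd
  have h := (hξ.pow hN (mul_comm d e)).card_nthRootsFinset
  have heq : {x : F | x ^ d = 1} = (Polynomial.nthRootsFinset d (1 : F) : Set F) := by
    ext x
    simp [Polynomial.mem_nthRootsFinset hd0]
  rw [heq, Set.ncard_coe_finset, h]

lemma ncard_pow_eq_le (s : F) {d : ℕ} (hd : 0 < d) : {x : F | x ^ d = s}.ncard ≤ d := by
  classical
  have : {x : F | x ^ d = s} = ((Polynomial.nthRoots d s).toFinset : Set F) := by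
    ext x
    simp [Polynomial.mem_nthRoots hd]
  rw [this, Set.ncard_coe_finset]
  exact (Multiset.toFinset_card_le _).trans (Polynomial.card_nthRoots d s)

lemma ncard_pow_add_eq_le (s : F) (hq : 1 < q) : {x : F | x ^ q + x = s}.ncard ≤ q := by
  classical
  open Polynomial in
  have hdeg : (X ^ q + (X - C s) : F[X]).natDegree = q := by
    rw [natDegree_add_eq_left_of_natDegree_lt] <;> simp [hq]
  have hne : (Polynomial.X ^ q + (Polynomial.X - Polynomial.C s) : Polynomial F) ≠ 0 := by
    rintro h0
    rw [h0, Polynomial.natDegree_zero] at hdeg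
    omega
  have : {x : F | x ^ q + x = s} ⊆
      ((Polynomial.X ^ q + (Polynomial.X - Polynomial.C s)).roots.toFinset : Set F) := by
    intro x hx
    change x ^ q + x = s at hx
    rw [Finset.mem_coe, Multiset.mem_toFinset, Polynomial.mem_roots hne, Polynomial.IsRoot]
    simp
    linear_combination hx
  refine (Set.ncard_le_ncard this).trans ?_
  rw [Set.ncard_coe_finset]
  exact ((Multiset.toFinset_card_le _).trans (Polynomial.card_roots' _)).trans hdeg.le

lemma ncard_pow_eq_self [Finite F] {ξ : F} (hξ : IsPrimitiveRoot ξ (q ^ 2 - 1)) (hq : 1 < q) :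
    {x : F | x ^ q = x}.ncard = q := by
  have hd : q - 1 ∣ q ^ 2 - 1 := by simpa using Nat.sub_dvd_pow_sub_pow q 1 2
  have hN : 0 < q ^ 2 - 1 := Nat.sub_pos_of_lt (Nat.one_lt_pow two_ne_zero hq)
  have h : {x : F | x ^ q = x} = insert 0 {x : F | x ^ (q - 1) = 1} := by
    ext x
    obtain ⟨m, rfl⟩ : ∃ m, q = m + 1 := ⟨q - 1, by omega⟩
    by_cases hx : x = 0
    · simp [hx]
    · simp [hx, pow_succ]
  rw [h, Set.ncard_insert_of_notMem, ncard_pow_eq_one hξ hN hd]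
  · omega
  · simp [zero_pow (show q - 1 ≠ 0 by omega)]

end FiniteField

section Invariants

variable {F : Type*} [Field F] {q : ℕ}

/-- The determinant of the `2 × 2` matrix with entries `v 0, v 1, v 2, v 3`. -/
def vecDet (v : Fin 4 → F) : F := v 0 * v 3 - v 1 * v 2

lemma vecDet_tensorAct (h : IsInvolutivePower F q) {A : Matrix (Fin 2) (Fin 2) F}
    (hA : A.det = 1) (v : Fin 4 → F) : vecDet (tensorAct q A v) = vecDet v := by
  have hAq : A 0 0 ^ q * A 1 1 ^ q - A 0 1 ^ q * A 1 0 ^ q = 1 := by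
    rw [← mul_pow, ← mul_pow, ← h.sub, ← det_fin_two, hA, one_pow]
  rw [det_fin_two] at hA
  simp only [vecDet, tensorAct_eq, cons_val]
  linear_combination (v 0 * v 3 - v 1 * v 2) *
    ((A 0 0 ^ q * A 1 1 ^ q - A 0 1 ^ q * A 1 0 ^ q) * hA + hAq)

lemma vecDet_smul (c : F) (v : Fin 4 → F) : vecDet (c • v) = c ^ 2 * vecDet v := by
  simp [vecDet]
  ring

/-- The Hermitian form, with the exponent `q + 1` expanded. -/
lemma Fgam_zero (v : Fin 4 → F) :
    Fgam q 0 v = v 0 ^ q * v 3 + v 0 * v 3 ^ q - v 1 ^ q * v 1 - v 2 ^ q * v 2 := by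
  simp [Fgam, pow_succ]

lemma Fgam_zero_tensorAct (h : IsInvolutivePower F q) {A : Matrix (Fin 2) (Fin 2) F}
    (hA : A.det = 1) (v : Fin 4 → F) : Fgam q 0 (tensorAct q A v) = Fgam q 0 v := by
  have hAq : A 0 0 ^ q * A 1 1 ^ q - A 0 1 ^ q * A 1 0 ^ q = 1 := by
    rw [← mul_pow, ← mul_pow, ← h.sub, ← det_fin_two, hA, one_pow]
  rw [det_fin_two] at hA
  simp only [Fgam_zero, tensorAct_eq, cons_val, h.add, mul_pow, h.invol]
  linear_combination (v 0 ^ q * v 3 + v 0 * v 3 ^ q - v 1 ^ q * v 1 - v 2 ^ q * v 2) *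
    ((A 0 0 ^ q * A 1 1 ^ q - A 0 1 ^ q * A 1 0 ^ q) * hA + hAq)

lemma Fgam_zero_smul (c : F) (v : Fin 4 → F) :
    Fgam q 0 (c • v) = c ^ q * c * Fgam q 0 v := by
  simp [Fgam_zero, mul_pow]
  ring

lemma mk_mem_Cgam_zero {v : Fin 4 → F} (hv : v ≠ 0) :
    Projectivization.mk F v hv ∈ Cgam q (0 : F) ↔ Fgam q 0 v = 0 := by
  constructor
  · exact fun h => h v hv rfl
  · intro h w hw hvw
    obtain ⟨c, rfl⟩ := (Projectivization.mk_eq_mk_iff' F v w hv hw).1 hvw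
    have hc : c ≠ 0 := by rintro rfl; simp at hv
    rw [Fgam_zero_smul] at h
    simpa [hc] using h

/-- The Hermitian Veronesean map `u ↦ u^q ⊗ u`. -/
def veronese (q : ℕ) (u : Fin 2 → F) : Fin 4 → F :=
  ![u 0 ^ q * u 0, u 0 ^ q * u 1, u 1 ^ q * u 0, u 1 ^ q * u 1]

lemma tensorAct_veronese (h : IsInvolutivePower F q) (A : Matrix (Fin 2) (Fin 2) F)
    (u : Fin 2 → F) : tensorAct q A (veronese q u) = veronese q (A *ᵥ u) := by
  rw [tensorAct_eq]
  ext i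
  fin_cases i <;>
    simp [veronese, mulVec, dotProduct, Fin.sum_univ_two, h.add, mul_pow] <;> ring

lemma veronese_ne_zero {u : Fin 2 → F} (hu : u ≠ 0) : veronese q u ≠ 0 := by
  intro h0
  apply hu
  have h1 := congrFun h0 0
  have h2 := congrFun h0 3
  simp only [veronese, cons_val, Pi.zero_apply, ← pow_succ] at h1 h2
  ext i
  fin_cases i
  · exact eq_zero_of_pow_eq_zero h1
  · exact eq_zero_of_pow_eq_zero h2

lemma mem_Oset_iff (h : IsInvolutivePower F q) {P : PGPoint F} :
    P ∈ Oset F q ↔ ∃ (u : Fin 2 → F) (hu : u ≠ 0),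
      P = Projectivization.mk F (veronese q u) (veronese_ne_zero hu) := by
  have e1 : ∀ t : F, veronese q ![1, t] = ![1, t, t ^ q, t ^ (q + 1)] := by
    intro t
    simp [veronese, pow_succ]
  have e2 : veronese q ![(0 : F), 1] = ![0, 0, 0, 1] := by
    simp [veronese, h.ne_zero]
  constructor
  · rintro (⟨t, hv, rfl⟩ | ⟨hv, rfl⟩)
    · exact ⟨![1, t], by simp, by simp_rw [e1]⟩
    · exact ⟨![0, 1], by simp, by simp_rw [e2]⟩
  · rintro ⟨u, hu, rfl⟩
    by_cases h0 : u 0 = 0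
    · right
      refine ⟨by simp, ?_⟩
      rw [Projectivization.mk_eq_mk_iff']
      exact ⟨u 1 ^ q * u 1, by simp [veronese, h0, h.ne_zero]⟩
    · left
      refine ⟨u 1 / u 0, by simp, ?_⟩
      rw [Projectivization.mk_eq_mk_iff']
      refine ⟨u 0 ^ q * u 0, ?_⟩
      have h0q : u 0 ^ q ≠ 0 := pow_ne_zero _ h0
      ext i
      fin_cases i <;> simp [veronese, pow_succ, div_pow] <;> field_simp

lemma mk_mem_Oset (h : IsInvolutivePower F q) {v : Fin 4 → F} (hv : v ≠ 0) :
    Projectivization.mk F v hv ∈ Oset F q ↔ vecDet v = 0 ∧ Fgam q 0 v = 0 := by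
  rw [mem_Oset_iff h]
  constructor
  · rintro ⟨u, hu, huv⟩
    obtain ⟨c, rfl⟩ := (Projectivization.mk_eq_mk_iff' F _ _ hv (veronese_ne_zero hu)).1 huv
    rw [vecDet_smul, Fgam_zero_smul]
    constructor
    · simp [vecDet, veronese]
      right
      ring
    · simp [Fgam_zero, veronese, mul_pow, h.invol]
      right
      ring
  · rintro ⟨hd, hf⟩
    rw [Fgam_zero] at hf
    rw [vecDet] at hd
    by_cases h0 : v 0 = 0
    · have h12 : v 1 = 0 ∧ v 2 = 0 := by
        rw [h0, zero_pow h.ne_zero] at hf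
        rw [h0, zero_mul, zero_sub, neg_eq_zero, mul_eq_zero] at hd
        rcases hd with hd | hd
        · simp only [hd, ← pow_succ] at hf
          exact ⟨hd, by simpa using hf⟩
        · simp only [hd, ← pow_succ] at hf
          exact ⟨by simpa using hf, hd⟩
      refine ⟨![0, 1], by simp, ?_⟩
      rw [Projectivization.mk_eq_mk_iff']
      refine ⟨v 3, ?_⟩
      ext i
      fin_cases i <;> simp [veronese, h0, h12, h.ne_zero]
    · have h0q : v 0 ^ q ≠ 0 := pow_ne_zero _ h0
      have h3 : v 3 = v 1 * v 2 / v 0 := by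
        field_simp
        linear_combination hd
      have key : v 1 * v 0 ^ q = v 0 * v 2 ^ q := by
        rw [h3] at hf
        have h4 : (v 1 * v 0 ^ q - v 0 * v 2 ^ q) * (v 1 * v 0 ^ q - v 0 * v 2 ^ q) ^ q = 0 := by
          simp only [h.sub, mul_pow, h.invol]
          simp only [div_pow, mul_pow] at hf
          field_simp at hf
          linear_combination -hf
        rw [← pow_succ'] at h4
        exact sub_eq_zero.1 (eq_zero_of_pow_eq_zero h4)
      have key' : v 1 ^ q * v 0 = v 0 ^ q * v 2 := by
        have := congrArg (· ^ q) key
        simpa only [mul_pow, h.invol] using this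
      refine ⟨![1, v 1 / v 0], by simp, ?_⟩
      rw [Projectivization.mk_eq_mk_iff']
      refine ⟨v 0, ?_⟩
      ext i
      fin_cases i
      · simp [veronese]
      · simp [veronese]
        field_simp
      · simp [veronese, div_pow]
        field_simp
        linear_combination key'
      · simp [veronese, div_pow, h3]
        field_simp
        linear_combination v 1 * key'

lemma exists_det_eq_one_mulVec {u w : Fin 2 → F} (hu : u ≠ 0) (hw : w ≠ 0) :
    ∃ A : Matrix (Fin 2) (Fin 2) F, A.det = 1 ∧ A *ᵥ u = w := by
  have complete : ∀ x : Fin 2 → F, x ≠ 0 →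
      ∃ M : Matrix (Fin 2) (Fin 2) F, M.det = 1 ∧ M *ᵥ ![1, 0] = x := by
    intro x hx
    by_cases h0 : x 0 = 0
    · have h1 : x 1 ≠ 0 := by
        intro h1
        apply hx
        ext i
        fin_cases i <;> assumption
      refine ⟨!![0, -(x 1)⁻¹; x 1, 0], by simp [det_fin_two, h1], ?_⟩
      ext i
      fin_cases i <;> simp [mulVec, dotProduct, h0]
    · refine ⟨!![x 0, 0; x 1, (x 0)⁻¹], by simp [det_fin_two, h0], ?_⟩
      ext i
      fin_cases i <;> simp [mulVec, dotProduct]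
  obtain ⟨M, hM, rfl⟩ := complete u hu
  obtain ⟨N, hN, rfl⟩ := complete w hw
  refine ⟨N * M⁻¹, by simp [det_nonsing_inv, hM, hN], ?_⟩
  rw [mulVec_mulVec, Matrix.mul_assoc, nonsing_inv_mul _ (by simp [hM]), Matrix.mul_one]

/-- The group `K` is transitive on the Hermitian Veronese curve. -/
lemma Korb_eq_Oset (h : IsInvolutivePower F q) {P : PGPoint F} (hP : P ∈ Oset F q) :
    Korb q P = Oset F q := by
  obtain ⟨u, hu, rfl⟩ := (mem_Oset_iff h).1 hP
  ext P'
  rw [mem_Korb_mk, mem_Oset_iff h]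
  constructor
  · rintro ⟨A, hA, hw, rfl⟩
    have hAu : A *ᵥ u ≠ 0 := by
      intro h0
      apply hw
      rw [tensorAct_veronese h, h0]
      simp [veronese, h.ne_zero]
    refine ⟨A *ᵥ u, hAu, ?_⟩
    simp_rw [tensorAct_veronese h]
  · rintro ⟨w, hw, rfl⟩
    obtain ⟨A, hA, rfl⟩ := exists_det_eq_one_mulVec hu hw
    refine ⟨A, hA, ?_, ?_⟩
    · rw [tensorAct_veronese h]
      exact veronese_ne_zero hw
    · simp_rw [tensorAct_veronese h]

lemma mem_Korb_of_mk_tensorAct_mem (h : IsInvolutivePower F q) {A : Matrix (Fin 2) (Fin 2) F}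
    (hA : A.det = 1) {v : Fin 4 → F} (hv : v ≠ 0) (hw : tensorAct q A v ≠ 0) {P : PGPoint F}
    (hP : Projectivization.mk F _ hw ∈ Korb q P) : Projectivization.mk F v hv ∈ Korb q P := by
  rw [Korb_eq_orbit h] at hP ⊢
  let := h.pointAction
  rw [← MulAction.orbit_eq_iff.2 hP, MulAction.mem_orbit_symm]
  exact ⟨⟨A, hA⟩, rfl⟩

end Invariants

section Stabilizers

variable {F : Type*} [Field F] {q : ℕ}

lemma card_stabilizer_of_diagonal {v : Fin 4 → F} {d : ℕ} (hd : d ≠ 0)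
    (hv : ∀ A : SpecialLinearGroup (Fin 2) F, (∃ c : F, c • v = tensorAct q A.1 v) ↔
      A.1 0 1 = 0 ∧ A.1 1 0 = 0 ∧ A.1 0 0 ^ d = 1) :
    Nat.card {A : SpecialLinearGroup (Fin 2) F // ∃ c : F, c • v = tensorAct q A.1 v} =
      {x : F | x ^ d = 1}.ncard := by
  rw [← Nat.card_coe_set_eq]
  refine Nat.card_congr
    { toFun := fun A => ⟨A.1.1 0 0, ((hv A.1).1 A.2).2.2⟩
      invFun := fun x => ⟨⟨!![x.1, 0; 0, x.1⁻¹], ?_⟩, (hv _).2 ⟨by simp, by simp, x.2⟩⟩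
      left_inv := fun A => ?_
      right_inv := fun x => by simp }
  · have hx : x.1 ≠ 0 := by
      intro h0
      have := x.2
      rw [h0, Set.mem_ofPred_eq, zero_pow hd] at this
      exact zero_ne_one this
    simp [det_fin_two, hx]
  · obtain ⟨h1, h2, -⟩ := (hv A.1).1 A.2
    have hA := A.1.2
    rw [det_fin_two, h1, h2, mul_zero, sub_zero] at hA
    ext i j
    fin_cases i <;> fin_cases j
    · simp
    · simp [h1]
    · simp [h2]
    · simpa using inv_eq_of_mul_eq_one_right hA

lemma smul_vec_eq_tensorAct_iff {v : Fin 4 → F} {A : Matrix (Fin 2) (Fin 2) F} {c : F} :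
    c • v = tensorAct q A v ↔
      c * v 0 = A 0 0 ^ q * A 0 0 * v 0 + A 0 0 ^ q * A 0 1 * v 1
          + A 0 1 ^ q * A 0 0 * v 2 + A 0 1 ^ q * A 0 1 * v 3 ∧
      c * v 1 = A 0 0 ^ q * A 1 0 * v 0 + A 0 0 ^ q * A 1 1 * v 1
          + A 0 1 ^ q * A 1 0 * v 2 + A 0 1 ^ q * A 1 1 * v 3 ∧
      c * v 2 = A 1 0 ^ q * A 0 0 * v 0 + A 1 0 ^ q * A 0 1 * v 1
          + A 1 1 ^ q * A 0 0 * v 2 + A 1 1 ^ q * A 0 1 * v 3 ∧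
      c * v 3 = A 1 0 ^ q * A 1 0 * v 0 + A 1 0 ^ q * A 1 1 * v 1
          + A 1 1 ^ q * A 1 0 * v 2 + A 1 1 ^ q * A 1 1 * v 3 := by
  rw [tensorAct_eq, funext_iff]
  simp [Fin.forall_fin_succ]

lemma stabilizer_diagonal (h : IsInvolutivePower F q) (h2 : (2 : F) ≠ 0) (hq : Odd q) {a : F}
    (ha0 : a ≠ 0) (ha : a ^ q = -a) (ha2 : ∀ x : F, x ^ (2 * (q + 1)) ≠ a ^ 2)
    (A : SpecialLinearGroup (Fin 2) F) :
    (∃ c : F, c • ![a, 0, 0, 1] = tensorAct q A.1 ![a, 0, 0, 1]) ↔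
      A.1 0 1 = 0 ∧ A.1 1 0 = 0 ∧ A.1 0 0 ^ (2 * (q + 1)) = 1 := by
  have hdet := A.2
  rw [det_fin_two] at hdet
  simp only [smul_vec_eq_tensorAct_iff, cons_val, mul_zero, mul_one, add_zero]
  generalize A.1 0 0 = α at *
  generalize A.1 0 1 = β at *
  generalize A.1 1 0 = γ at *
  generalize A.1 1 1 = δ at *
  constructor
  · rintro ⟨c, e0, e1, e2, e3⟩
    have e2' : γ * α ^ q * -a + δ * β ^ q = 0 := by
      have := congrArg (· ^ q) e2
      simp only [h.add, mul_pow, h.invol, ha, zero_pow h.ne_zero] at this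
      exact this.symm
    have hδβ : δ = 0 ∨ β = 0 := by
      have : 2 * (δ * β ^ q) = 0 := by linear_combination e2' - e1
      simpa [h2, h.ne_zero] using this
    rcases hδβ with rfl | rfl
    · exfalso
      have hβγ : β * γ = -1 := by linear_combination -hdet
      have hγ : γ ≠ 0 := by rintro rfl; simp at hβγ
      apply ha2 β
      have hN : (β * γ) ^ (q + 1) = 1 := by rw [hβγ, (hq.add_one).neg_one_pow]
      have hα : α = 0 := by
        simp only [mul_zero, add_zero] at e1
        simpa [ha0, hγ, h.ne_zero] using e1
      subst hα
      simp only [zero_mul, mul_zero, add_zero, zero_add] at e0 e3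
      simp only [mul_pow, pow_succ] at hN ⊢
      rw [show β ^ (2 * (q + 1)) = (β ^ q * β) ^ 2 by ring]
      have e4 : β ^ q * β = γ ^ q * γ * a ^ 2 := by linear_combination a * e3 - e0
      linear_combination β ^ q * β * e4 + a ^ 2 * hN
    · have hγ : γ = 0 := by
        simp only [zero_mul, zero_pow h.ne_zero, add_zero, sub_zero] at e1 hdet
        have hα : α ≠ 0 := by rintro rfl; simp at hdet
        simpa [ha0, hα, h.ne_zero] using e1
      subst hγ
      simp only [zero_mul, mul_zero, zero_pow h.ne_zero, add_zero, sub_zero, zero_add] at e0 e3 hdet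
      refine ⟨rfl, rfl, ?_⟩
      have hc : c = α ^ q * α := mul_right_cancel₀ ha0 e0
      have hN : (α * δ) ^ (q + 1) = 1 := by rw [hdet, one_pow]
      simp only [mul_pow, pow_succ] at hN
      rw [show α ^ (2 * (q + 1)) = (α ^ q * α) ^ 2 by ring]
      linear_combination hN + α ^ q * α * (e3 - hc)
  · rintro ⟨rfl, rfl, hα⟩
    simp only [mul_zero, sub_zero] at hdet
    refine ⟨α ^ q * α, ?_⟩
    simp only [zero_mul, mul_zero, zero_pow h.ne_zero, add_zero, zero_add, true_and]
    have hN : (α * δ) ^ (q + 1) = 1 := by rw [hdet, one_pow]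
    simp only [mul_pow, pow_succ] at hN
    rw [show α ^ (2 * (q + 1)) = (α ^ q * α) ^ 2 by ring] at hα
    linear_combination δ ^ q * δ * hα - α ^ q * α * hN

lemma stabilizer_antidiagonal (h : IsInvolutivePower F q) (h2 : (2 : F) ≠ 0) (hq : Odd q) {b : F}
    (hb : b ^ (q + 1) = -1) (hb2 : ∀ x : F, x ^ (2 * (q - 1)) ≠ b ^ 2)
    (A : SpecialLinearGroup (Fin 2) F) :
    (∃ c : F, c • ![0, b, 1, 0] = tensorAct q A.1 ![0, b, 1, 0]) ↔
      A.1 0 1 = 0 ∧ A.1 1 0 = 0 ∧ A.1 0 0 ^ (2 * (q - 1)) = 1 := by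
  have hdet := A.2
  rw [det_fin_two] at hdet
  have hb0 : b ≠ 0 := by
    rintro rfl
    simp at hb
  have anis : ∀ x y : F, 0 = x ^ q * y * b + y ^ q * x → x = 0 ∨ y = 0 := by
    intro x y hxy
    have h1 : (x ^ q * y * b) ^ q * (x ^ q * y * b) = (y ^ q * x) ^ q * (y ^ q * x) := by
      rw [show x ^ q * y * b = -(y ^ q * x) by linear_combination -hxy, h.neg]
      ring
    simp only [mul_pow, h.invol] at h1
    rw [pow_succ] at hb
    have h3 : 2 * (x ^ q * x * (y ^ q * y)) = 0 := by
      linear_combination x ^ q * x * (y ^ q * y) * hb - h1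
    simpa [h2, h.ne_zero] using h3
  simp only [smul_vec_eq_tensorAct_iff, cons_val, mul_zero, mul_one, add_zero, zero_add]
  generalize A.1 0 0 = α at *
  generalize A.1 0 1 = β at *
  generalize A.1 1 0 = γ at *
  generalize A.1 1 1 = δ at *
  obtain ⟨m, rfl⟩ : ∃ m, q = m + 1 := ⟨q - 1, by have := hq.pos; omega⟩
  rw [Nat.add_sub_cancel] at hb2 ⊢
  constructor
  · rintro ⟨c, e0, e1, e2, e3⟩
    rcases anis α β e0 with rfl | rfl
    · exfalso
      have hβγ : β * γ = -1 := by linear_combination -hdet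
      have hγ : γ ≠ 0 := by rintro rfl; simp at hβγ
      rcases anis γ δ e3 with rfl | rfl
      · exact hγ rfl
      apply hb2 β
      simp only [zero_mul, mul_zero, zero_pow h.ne_zero, add_zero, zero_add] at e1 e2
      have hm : Even m := by simpa [Nat.odd_add_one] using hq
      have hN : (β * γ) ^ m = 1 := by rw [hβγ, hm.neg_one_pow]
      simp only [mul_pow, pow_succ] at hN e1 e2
      rw [show β ^ (2 * m) = (β ^ m) ^ 2 by ring]
      have e4 : β * γ * (β ^ m - γ ^ m * b ^ 2) = 0 := by linear_combination b * e2 - e1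
      rw [hβγ] at e4
      linear_combination -β ^ m * e4 + b ^ 2 * hN
    · simp only [zero_mul, mul_zero, zero_pow h.ne_zero, add_zero, zero_add, sub_zero] at e1 e2 hdet
      rcases anis γ δ e3 with rfl | rfl
      · refine ⟨rfl, rfl, ?_⟩
        have hN : (α * δ) ^ m = 1 := by rw [hdet, one_pow]
        have hc : c = α ^ (m + 1) * δ := mul_right_cancel₀ hb0 e1
        simp only [mul_pow, pow_succ] at hN hc e2
        rw [show α ^ (2 * m) = (α ^ m) ^ 2 by ring]
        have e4 : α * δ * (α ^ m - δ ^ m) = 0 := by linear_combination e2 - hc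
        rw [hdet] at e4
        linear_combination α ^ m * e4 + hN
      · simp at hdet
  · rintro ⟨rfl, rfl, hα⟩
    simp only [mul_zero, sub_zero] at hdet
    refine ⟨α ^ (m + 1) * δ, ?_⟩
    simp only [zero_mul, mul_zero, zero_pow h.ne_zero, add_zero, zero_add, true_and, and_true]
    have hN : (α * δ) ^ m = 1 := by rw [hdet, one_pow]
    simp only [mul_pow, pow_succ] at hN ⊢
    rw [show α ^ (2 * m) = (α ^ m) ^ 2 by ring] at hα
    linear_combination α * δ * (δ ^ m * hα - α ^ m * hN)

end Stabilizers

section Hermitian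

variable {F : Type*} [Field F] {q : ℕ}

/-- `v` is the vector of entries of a Hermitian `2 × 2` matrix. -/
def IsHermVec (q : ℕ) (v : Fin 4 → F) : Prop :=
  v 0 ^ q = v 0 ∧ v 2 = v 1 ^ q ∧ v 3 ^ q = v 3

lemma mem_SigmaSet_iff {P : PGPoint F} :
    P ∈ SigmaSet F q ↔ ∃ (v : Fin 4 → F) (hv : v ≠ 0),
      IsHermVec q v ∧ P = Projectivization.mk F v hv := by
  constructor
  · rintro ⟨a, b, c, hv, ha, hc, rfl⟩
    exact ⟨_, hv, ⟨by simpa using ha, by simp, by simpa using hc⟩, rfl⟩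
  · rintro ⟨v, hv, ⟨h0, h2, h3⟩, rfl⟩
    have hv' : ![v 0, v 1, v 1 ^ q, v 3] = v := by
      ext i
      fin_cases i <;> simp [h2]
    refine ⟨v 0, v 1, v 3, by rwa [hv'], h0, h3, ?_⟩
    simp_rw [hv']

lemma IsHermVec.map_tensorAct (h : IsInvolutivePower F q) {v : Fin 4 → F} (hv : IsHermVec q v)
    (A : Matrix (Fin 2) (Fin 2) F) : IsHermVec q (tensorAct q A v) := by
  obtain ⟨h0, h2, h3⟩ := hv
  simp only [IsHermVec, tensorAct_eq, cons_val, h.add, mul_pow, h.invol, h0, h2, h3]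
  refine ⟨by ring, by ring, by ring⟩

lemma IsHermVec.Fgam_zero_eq (h : IsInvolutivePower F q) {v : Fin 4 → F} (hv : IsHermVec q v) :
    Fgam q 0 v = 2 * vecDet v := by
  obtain ⟨h0, h2, h3⟩ := hv
  rw [Fgam_zero, vecDet, h0, h2, h3, h.invol]
  ring

lemma IsHermVec.scalar_fixed {v : Fin 4 → F} {c : F} (hv0 : v ≠ 0)
    (hv : IsHermVec q v) (hcv : IsHermVec q (c • v)) : c ^ q = c := by
  obtain ⟨h0, h2, h3⟩ := hv
  obtain ⟨k0, k2, k3⟩ := hcv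
  simp only [Pi.smul_apply, smul_eq_mul, mul_pow, h0, h2, h3] at k0 k2 k3
  by_cases e0 : v 0 = 0
  · by_cases e1 : v 1 ^ q = 0
    · by_cases e3 : v 3 = 0
      · refine absurd ?_ hv0
        ext i
        fin_cases i
        · exact e0
        · exact eq_zero_of_pow_eq_zero e1
        · exact h2.trans e1
        · exact e3
      · exact mul_right_cancel₀ e3 k3
    · exact (mul_right_cancel₀ e1 k2).symm
  · exact mul_right_cancel₀ e0 k0

lemma mk_mem_SigmaSet_diff_Oset (h : IsInvolutivePower F q) {v : Fin 4 → F} (hv0 : v ≠ 0)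
    (hv : IsHermVec q v) (hd : vecDet v ≠ 0) :
    Projectivization.mk F v hv0 ∈ SigmaSet F q \ Oset F q :=
  ⟨mem_SigmaSet_iff.2 ⟨v, hv0, hv, rfl⟩, fun hO => hd ((mk_mem_Oset h hv0).1 hO).1⟩

lemma Oset_subset_SigmaSet (h : IsInvolutivePower F q) : Oset F q ⊆ SigmaSet F q := by
  intro P hP
  obtain ⟨u, hu, rfl⟩ := (mem_Oset_iff h).1 hP
  refine mem_SigmaSet_iff.2 ⟨_, veronese_ne_zero hu, ?_, rfl⟩
  simp only [IsHermVec, veronese, cons_val, mul_pow, h.invol]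
  refine ⟨by ring, by ring, by ring⟩

/-- A nondegenerate Hermitian form takes a nonzero value at the first basis vector, after a change
of basis of determinant one. -/
lemma IsHermVec.exists_apply_zero_ne_zero (h : IsInvolutivePower F q) (h2 : (2 : F) ≠ 0)
    {v : Fin 4 → F} (hv : IsHermVec q v) (hd : vecDet v ≠ 0) :
    ∃ A : Matrix (Fin 2) (Fin 2) F, A.det = 1 ∧ tensorAct q A v 0 ≠ 0 := by
  obtain ⟨-, k2, -⟩ := hv
  by_cases h0 : v 0 = 0
  · by_cases h3 : v 3 = 0
    · have h1 : v 1 ≠ 0 := by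
        intro h1
        simp [vecDet, h0, h1] at hd
      refine ⟨!![1, (v 1)⁻¹; 0, 1], by simp [det_fin_two], ?_⟩
      have h1q : v 1 ^ q ≠ 0 := pow_ne_zero _ h1
      simp [tensorAct_eq, h0, h3, h1, h1q, k2, one_add_one_eq_two, h2]
    · exact ⟨!![0, 1; -1, 0], by simp [det_fin_two], by simp [tensorAct_eq, h3, h.ne_zero]⟩
  · exact ⟨1, by simp, by simp [tensorAct_eq, h0, h.ne_zero]⟩

lemma IsHermVec.exists_diagonal (h : IsInvolutivePower F q) (h2 : (2 : F) ≠ 0)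
    {v : Fin 4 → F} (hv : IsHermVec q v) (hd : vecDet v ≠ 0) :
    ∃ A : Matrix (Fin 2) (Fin 2) F, A.det = 1 ∧ ∃ c d : F, c ≠ 0 ∧ d ≠ 0 ∧
      c ^ q = c ∧ d ^ q = d ∧ tensorAct q A v = ![c, 0, 0, d] := by
  obtain ⟨A, hA, hA0⟩ := hv.exists_apply_zero_ne_zero h h2 hd
  have hw := hv.map_tensorAct h A
  have hB : (!![1, 0; -(tensorAct q A v 1) / tensorAct q A v 0, 1] :
      Matrix (Fin 2) (Fin 2) F).det = 1 := by simp [det_fin_two]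
  have hd' : vecDet (tensorAct q A v) ≠ 0 := by rwa [vecDet_tensorAct h hA]
  refine ⟨!![1, 0; -(tensorAct q A v 1) / tensorAct q A v 0, 1] * A,
    by rw [det_mul, hA, hB, one_mul], ?_⟩
  rw [tensorAct_mul h]
  generalize tensorAct q A v = w at *
  have hdiag := hw.map_tensorAct h !![1, 0; -(w 1) / w 0, 1]
  have hdet := vecDet_tensorAct h hB w
  have e0 : tensorAct q !![1, 0; -(w 1) / w 0, 1] w 0 = w 0 := by
    simp [tensorAct_eq, h.ne_zero]
  have e1 : tensorAct q !![1, 0; -(w 1) / w 0, 1] w 1 = 0 := by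
    simp [tensorAct_eq, h.ne_zero]
    field_simp
    ring
  generalize tensorAct q !![1, 0; -(w 1) / w 0, 1] w = z at *
  obtain ⟨k0, k2, k3⟩ := hdiag
  rw [e1, zero_pow h.ne_zero] at k2
  refine ⟨z 0, z 3, by rwa [e0], ?_, k0, k3, ?_⟩
  · intro h3
    apply hd'
    rw [← hdet, vecDet, h3, e1]
    simp
  · ext i
    fin_cases i <;> simp [e1, k2]

lemma exists_eq_pow_of_fixed {ξ x : F} (hξ : IsPrimitiveRoot ξ (q ^ 2 - 1)) (hq : 1 < q)
    (hgen : ∀ x : F, x ≠ 0 → ∃ m : ℕ, x = ξ ^ m) (hx0 : x ≠ 0) (hx : x ^ q = x) :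
    ∃ k : ℕ, x = ξ ^ ((q + 1) * k) := by
  obtain ⟨k, rfl⟩ := hgen x hx0
  obtain ⟨m, rfl⟩ : ∃ m, q = m + 1 := ⟨q - 1, by omega⟩
  have h1 : ξ ^ (k * m) = 1 := by
    rw [pow_succ] at hx
    simpa [pow_mul, hx0] using hx
  have h2 := hξ.dvd_of_pow_eq_one _ h1
  rw [show (m + 1) ^ 2 - 1 = (m + 2) * m by
    rw [show (m + 1) ^ 2 = (m + 2) * m + 1 by ring]; rfl] at h2
  obtain ⟨l, rfl⟩ := Nat.dvd_of_mul_dvd_mul_right (by omega) h2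
  exact ⟨l, rfl⟩

/-- Every nondegenerate Hermitian form is `SL(2)`-equivalent, up to scalars, to one of two diagonal
forms. -/
lemma SigmaSet_diff_Oset_subset (h : IsInvolutivePower F q) (h2 : (2 : F) ≠ 0) (hq : 1 < q) {ξ : F}
    (hξ : IsPrimitiveRoot ξ (q ^ 2 - 1)) (hgen : ∀ x : F, x ≠ 0 → ∃ m : ℕ, x = ξ ^ m)
    (hv₁ : ![1, 0, 0, 1] ≠ (0 : Fin 4 → F)) (hv₂ : ![1, 0, 0, ξ ^ (q + 1)] ≠ 0) :
    SigmaSet F q \ Oset F q ⊆ Korb q (Projectivization.mk F _ hv₁) ∪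
      Korb q (Projectivization.mk F _ hv₂) := by
  rintro P ⟨hP, hO⟩
  have hξ0 : ξ ≠ 0 := hξ.ne_zero (Nat.sub_pos_of_lt (Nat.one_lt_pow two_ne_zero hq)).ne'
  obtain ⟨v, hv0, hv, rfl⟩ := mem_SigmaSet_iff.1 hP
  have hd : vecDet v ≠ 0 := fun hd => hO ((mk_mem_Oset h hv0).2 ⟨hd, by
    rw [hv.Fgam_zero_eq h, hd, mul_zero]⟩)
  obtain ⟨A, hA, c, d, hc0, hd0, hc, hd, hAv⟩ := hv.exists_diagonal h h2 hd
  obtain ⟨k, hk⟩ := exists_eq_pow_of_fixed hξ hq hgen (div_ne_zero hd0 hc0)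
    (by rw [div_pow, hc, hd])
  have hAv0 : tensorAct q A v ≠ 0 := tensorAct_ne_zero h (by simp [hA]) hv0
  have key : ∀ (l i : ℕ) (hw : ![1, 0, 0, ξ ^ ((q + 1) * i)] ≠ 0), k = 2 * l + i →
      Projectivization.mk F v hv0 ∈ Korb q (Projectivization.mk F _ hw) := by
    rintro l i hw rfl
    apply mem_Korb_of_mk_tensorAct_mem h hA hv0 hAv0
    have hα : ξ ^ l ≠ 0 := pow_ne_zero _ hξ0
    have hdet : (!![(ξ ^ l)⁻¹, 0; 0, ξ ^ l] : Matrix (Fin 2) (Fin 2) F).det = 1 := by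
      simp [det_fin_two, hα]
    rw [mem_Korb_mk]
    refine ⟨_, hdet, tensorAct_ne_zero h (by rw [hdet]; exact one_ne_zero) hw, ?_⟩
    rw [Projectivization.mk_eq_mk_iff', hAv]
    have hd' : d = c * ξ ^ ((q + 1) * (2 * l + i)) := by
      rw [← hk]
      field_simp
    have hαq : (ξ ^ l) ^ q ≠ 0 := pow_ne_zero _ hα
    refine ⟨c * (ξ ^ l) ^ q * ξ ^ l, ?_⟩
    rw [tensorAct_eq]
    ext j
    fin_cases j
    · simp [h.ne_zero]
      field_simp
    · simp [h.ne_zero]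
    · simp [h.ne_zero]
    · simp [h.ne_zero, hd']
      ring
  obtain ⟨l, hl⟩ := Nat.even_or_odd' k
  rcases hl with hl | hl
  · left
    simpa using key l 0 (by simp) hl
  · right
    simpa using key l 1 (by simp) hl

lemma Korb_subset_SigmaSet_diff_Oset (h : IsInvolutivePower F q) {v : Fin 4 → F} (hv0 : v ≠ 0)
    (hv : IsHermVec q v) (hd : vecDet v ≠ 0) :
    Korb q (Projectivization.mk F v hv0) ⊆ SigmaSet F q \ Oset F q := by
  intro P hP
  obtain ⟨A, hA, hw, rfl⟩ := (mem_Korb_mk hv0).1 hP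
  exact mk_mem_SigmaSet_diff_Oset h hw (hv.map_tensorAct h A) (by rwa [vecDet_tensorAct h hA])

lemma Korb_subset_Cgam_zero_diff_Oset (h : IsInvolutivePower F q) {v : Fin 4 → F} (hv0 : v ≠ 0)
    (hv : Fgam q 0 v = 0) (hd : vecDet v ≠ 0) :
    Korb q (Projectivization.mk F v hv0) ⊆ Cgam q 0 \ Oset F q := by
  intro P hP
  obtain ⟨A, hA, hw, rfl⟩ := (mem_Korb_mk hv0).1 hP
  refine ⟨(mk_mem_Cgam_zero hw).2 (by rwa [Fgam_zero_tensorAct h hA]), fun hO => hd ?_⟩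
  rw [← vecDet_tensorAct h hA]
  exact ((mk_mem_Oset h hw).1 hO).1

lemma Korb_inter_eq_empty {v w : Fin 4 → F} (h : IsInvolutivePower F q) (hv : v ≠ 0) (hw : w ≠ 0)
    (hvw : ∀ A B : Matrix (Fin 2) (Fin 2) F, ∀ c : F, tensorAct q A w ≠ 0 →
      c • tensorAct q A w = tensorAct q B v → vecDet v ≠ c ^ 2 * vecDet w) :
    Korb q (Projectivization.mk F v hv) ∩ Korb q (Projectivization.mk F w hw) = ∅ := by
  rw [Set.eq_empty_iff_forall_notMem]
  rintro P ⟨h1, h2⟩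
  obtain ⟨B, hB, hBv, rfl⟩ := (mem_Korb_mk hv).1 h1
  obtain ⟨A, hA, hAw, hP⟩ := (mem_Korb_mk hw).1 h2
  obtain ⟨c, hc⟩ := (Projectivization.mk_eq_mk_iff' F _ _ hBv hAw).1 hP
  apply hvw A B c hAw hc
  rw [← vecDet_tensorAct h hB, ← vecDet_tensorAct h hA w, ← hc, vecDet_smul]

lemma ncard_Korb_le_ncard_Korb_tensorAct [Finite F] (h : IsInvolutivePower F q)
    {D : Matrix (Fin 2) (Fin 2) F} (hD : D.det ≠ 0) {v : Fin 4 → F} (hv : v ≠ 0)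
    (hw : tensorAct q D v ≠ 0) :
    (Korb q (Projectivization.mk F v hv)).ncard ≤
      (Korb q (Projectivization.mk F (tensorAct q D v) hw)).ncard := by
  have hinj : Function.Injective (mulVecLin (kron (matq q D) D)) :=
    Function.LeftInverse.injective (g := tensorAct q D⁻¹) (tensorAct_inv_left h hD)
  refine Set.ncard_le_ncard_of_injOn (Projectivization.map _ hinj) ?_
    (Projectivization.map_injective _ hinj).injOn
  intro P hP
  obtain ⟨A, hA, hAv, rfl⟩ := (mem_Korb_mk hv).1 hP
  rw [mem_Korb_mk]
  have hDu : IsUnit D.det := isUnit_iff_ne_zero.2 hD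
  have key : tensorAct q (D * A * D⁻¹) (tensorAct q D v) = tensorAct q D (tensorAct q A v) := by
    rw [← tensorAct_mul h, ← tensorAct_mul h, Matrix.mul_assoc (D * A), nonsing_inv_mul _ hDu,
      Matrix.mul_one]
  refine ⟨D * A * D⁻¹, ?_, ?_, ?_⟩
  · rw [det_mul, det_mul, hA, mul_one, ← det_mul, mul_nonsing_inv _ hDu, det_one]
  · rw [key]
    exact tensorAct_ne_zero h hD hAv
  · simp_rw [key]
    rfl

end Hermitian

section Counting

/-- A product-type bound for the size of a subset of `α × α × α` all of whose fibres over the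
first two coordinates have at most `k` elements. -/
lemma ncard_le_card_sq_mul {α : Type*} [Fintype α] (S : Set (α × α × α)) (k : ℕ)
    (hS : ∀ x y : α, {z : α | (x, y, z) ∈ S}.ncard ≤ k) :
    S.ncard ≤ Fintype.card α ^ 2 * k := by
  classical
  have h1 : S.toFinset.card ≤ k * (Finset.univ : Finset (α × α)).card := by
    refine Finset.card_le_mul_card_image_of_maps_to (f := fun p : α × α × α => (p.1, p.2.1))
      (fun _ _ => Finset.mem_univ _) k ?_
    rintro ⟨x, y⟩ -
    refine le_trans ?_ (hS x y)
    rw [← Set.ncard_coe_finset]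
    refine Set.ncard_le_ncard_of_injOn (fun p => p.2.2) ?_ ?_
    · rintro ⟨x', y', z⟩ hp
      simp only [Finset.coe_filter, Set.mem_toFinset, Set.mem_ofPred_eq, Prod.mk.injEq] at hp
      obtain ⟨hp, rfl, rfl⟩ := hp
      exact hp
    · rintro ⟨x₁, y₁, z₁⟩ h₁ ⟨x₂, y₂, z₂⟩ h₂ h
      simp only [Finset.coe_filter, Set.mem_toFinset, Set.mem_ofPred_eq, Prod.mk.injEq] at h₁ h₂
      obtain ⟨-, rfl, rfl⟩ := h₁
      obtain ⟨-, rfl, rfl⟩ := h₂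
      simpa using h
  rw [Set.ncard_eq_toFinset_card']
  refine h1.trans_eq ?_
  rw [Finset.card_univ, Fintype.card_prod]
  ring

variable {F : Type*} [Field F] {q : ℕ}

lemma ncard_Oset [Fintype F] (hF : Fintype.card F = q ^ 2) : (Oset F q).ncard = q ^ 2 + 1 := by
  have hv : ∀ t : F, ![1, t, t ^ q, t ^ (q + 1)] ≠ 0 := fun t h => by simpa using congrFun h 0
  have hw : (![0, 0, 0, 1] : Fin 4 → F) ≠ 0 := fun h => by simpa using congrFun h 3
  have heq : Oset F q = insert (Projectivization.mk F _ hw)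
      ((fun t : F => Projectivization.mk F _ (hv t)) '' Set.univ) := by
    ext P
    constructor
    · rintro (⟨t, -, rfl⟩ | ⟨-, rfl⟩)
      · exact Or.inr ⟨t, trivial, rfl⟩
      · exact Or.inl rfl
    · rintro (rfl | ⟨t, -, rfl⟩)
      · exact Or.inr ⟨hw, rfl⟩
      · exact Or.inl ⟨t, hv t, rfl⟩
  rw [heq, Set.ncard_insert_of_notMem, Set.ncard_image_of_injective, Set.ncard_univ,
    Nat.card_eq_fintype_card, hF]
  · intro s t hst
    obtain ⟨c, hc⟩ := (Projectivization.mk_eq_mk_iff' F _ _ (hv s) (hv t)).1 hst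
    have h0 := congrFun hc 0
    have h1 := congrFun hc 1
    simp at h0 h1
    rw [← h1, h0, one_mul]
  · rintro ⟨t, -, ht⟩
    obtain ⟨c, hc⟩ := (Projectivization.mk_eq_mk_iff' F _ _ (hv t) hw).1 ht
    simpa using congrFun hc 0

/-- A Hermitian vector is given by its entries `v 0`, `v 1` and `v 3`. -/
def hermVecEquiv (F : Type*) [Field F] (q : ℕ) :
    {v : Fin 4 → F // IsHermVec q v} ≃ {x : F | x ^ q = x} × F × {x : F | x ^ q = x} where
  toFun v := (⟨v.1 0, v.2.1⟩, v.1 1, ⟨v.1 3, v.2.2.2⟩)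
  invFun x := ⟨![x.1.1, x.2.1, x.2.1 ^ q, x.2.2.1], x.1.2, rfl, x.2.2.2⟩
  left_inv v := by
    ext i
    fin_cases i
    · rfl
    · rfl
    · exact v.2.2.1.symm
    · rfl
  right_inv _ := rfl

lemma card_hermVec_ne_zero [Fintype F] (h : IsInvolutivePower F q) (hF : Fintype.card F = q ^ 2)
    {ξ : F} (hξ : IsPrimitiveRoot ξ (q ^ 2 - 1)) (hq : 1 < q) :
    Nat.card {v : Fin 4 → F // IsHermVec q v ∧ v ≠ 0} = q ^ 4 - 1 := by
  have h0 : (0 : Fin 4 → F) ∈ {v : Fin 4 → F | IsHermVec q v} := by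
    change IsHermVec q (0 : Fin 4 → F)
    simp [IsHermVec, h.ne_zero]
  have h1 := Set.ncard_sdiff_singleton_of_mem h0
  have h2 : {v : Fin 4 → F | IsHermVec q v}.ncard = q ^ 4 := by
    rw [← Nat.card_coe_set_eq]
    refine (Nat.card_congr (hermVecEquiv F q)).trans ?_
    rw [Nat.card_prod, Nat.card_prod, Nat.card_coe_set_eq, ncard_pow_eq_self hξ hq,
      Nat.card_eq_fintype_card, hF]
    ring
  rw [h2, ← Nat.card_coe_set_eq] at h1
  exact h1

lemma ncard_SigmaSet_mul [Fintype F] (h : IsInvolutivePower F q) (hF : Fintype.card F = q ^ 2)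
    {ξ : F} (hξ : IsPrimitiveRoot ξ (q ^ 2 - 1)) (hq : 1 < q) :
    (SigmaSet F q).ncard * (q - 1) = q ^ 4 - 1 := by
  have hd : q - 1 ∣ q ^ 2 - 1 := by simpa using Nat.sub_dvd_pow_sub_pow q 1 2
  have hN : 0 < q ^ 2 - 1 := Nat.sub_pos_of_lt (Nat.one_lt_pow two_ne_zero hq)
  have hfix : ∀ c : F, c ^ (q - 1) = 1 ↔ c ≠ 0 ∧ c ^ q = c := by
    intro c
    obtain ⟨m, rfl⟩ : ∃ m, q = m + 2 := ⟨q - 2, by omega⟩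
    by_cases hc : c = 0
    · simp [hc]
    · simp [hc, pow_succ]
  choose f hf0 hf using fun P : SigmaSet F q => mem_SigmaSet_iff.1 P.2
  rw [← card_hermVec_ne_zero h hF hξ hq, ← ncard_pow_eq_one hξ hN hd, ← Nat.card_coe_set_eq,
    ← Nat.card_coe_set_eq, ← Nat.card_prod]
  have hmem : ∀ (P : SigmaSet F q) (c : F), c ^ (q - 1) = 1 →
      IsHermVec q (c • f P) ∧ c • f P ≠ 0 := by
    intro P c hc
    obtain ⟨hc0, hcq⟩ := (hfix c).1 hc
    obtain ⟨h0, h2, h3⟩ := (hf P).1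
    refine ⟨⟨?_, ?_, ?_⟩, smul_ne_zero hc0 (hf0 P)⟩ <;>
      simp [mul_pow, hcq, h0, h2, h3]
  refine Nat.card_eq_of_bijective
    (fun x : SigmaSet F q × {x : F | x ^ (q - 1) = 1} =>
      (⟨x.2.1 • f x.1, hmem x.1 x.2.1 x.2.2⟩ : {v : Fin 4 → F // IsHermVec q v ∧ v ≠ 0}))
    ⟨?_, ?_⟩
  · rintro ⟨P, c, hc⟩ ⟨Q, d, hd⟩ heq
    have heq' : c • f P = d • f Q := congrArg Subtype.val heq
    have hc0 : c ≠ 0 := ((hfix c).1 hc).1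
    have hPQ : P = Q := by
      ext1
      rw [(hf P).2, (hf Q).2, Projectivization.mk_eq_mk_iff']
      exact ⟨c⁻¹ * d, by rw [mul_smul, ← heq', inv_smul_smul₀ hc0]⟩
    subst hPQ
    have hcd : c = d := smul_left_injective F (hf0 P) heq'
    subst hcd
    rfl
  · rintro ⟨v, hv, hv0⟩
    let P : SigmaSet F q := ⟨Projectivization.mk F v hv0, mem_SigmaSet_iff.2 ⟨v, hv0, hv, rfl⟩⟩
    obtain ⟨c, hc⟩ := (Projectivization.mk_eq_mk_iff' F _ _ hv0 (hf0 P)).1 (hf P).2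
    have hc0 : c ≠ 0 := by
      rintro rfl
      exact hv0 (by rw [← hc, zero_smul])
    have hcq : c ^ q = c := IsHermVec.scalar_fixed (hf0 P) (hf P).1 (by rwa [hc])
    exact ⟨(P, ⟨c, (hfix c).2 ⟨hc0, hcq⟩⟩), Subtype.ext hc⟩

lemma ncard_SigmaSet_diff_Oset [Fintype F] (h : IsInvolutivePower F q)
    (hF : Fintype.card F = q ^ 2) {ξ : F} (hξ : IsPrimitiveRoot ξ (q ^ 2 - 1)) (hq : 1 < q) :
    (SigmaSet F q \ Oset F q).ncard = q ^ 3 + q := by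
  have h1 := ncard_SigmaSet_mul h hF hξ hq
  have h2 := Set.ncard_sdiff_add_ncard_of_subset (Oset_subset_SigmaSet h)
  rw [ncard_Oset hF] at h2
  obtain ⟨m, rfl⟩ : ∃ m, q = m + 1 := ⟨q - 1, by omega⟩
  have h3 : (SigmaSet F (m + 1)).ncard = (m + 1) ^ 3 + (m + 1) ^ 2 + (m + 1) + 1 := by
    refine Nat.eq_of_mul_eq_mul_right (show 0 < m by omega) (h1.trans ?_)
    rw [show (m + 1) ^ 4 = ((m + 1) ^ 3 + (m + 1) ^ 2 + (m + 1) + 1) * m + 1 by ring]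
    rfl
  omega

lemma ncard_Cgam_zero_le [Fintype F] (h : IsInvolutivePower F q)
    (hF : Fintype.card F = q ^ 2) (hq : 1 < q) :
    (Cgam q (0 : F)).ncard ≤ q ^ 5 + q ^ 2 * (q + 1) + 1 := by
  have hv₁ : ∀ x : F × F × F, ![1, x.1, x.2.1, x.2.2] ≠ 0 :=
    fun x h => by simpa using congrFun h 0
  have hv₂ : ∀ x : F × F, ![0, x.1, 1, x.2] ≠ 0 := fun x h => by simpa using congrFun h 2
  have hv₃ : (![0, 0, 0, 1] : Fin 4 → F) ≠ 0 := fun h => by simpa using congrFun h 3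
  let S : Set (F × F × F) := {x | x.2.2 ^ q + x.2.2 = x.1 ^ (q + 1) + x.2.1 ^ (q + 1)}
  let T : Set F := {x | x ^ (q + 1) = -1}
  have hS : S.ncard ≤ q ^ 5 := by
    refine (ncard_le_card_sq_mul S q fun x y =>
      ncard_pow_add_eq_le (x ^ (q + 1) + y ^ (q + 1)) hq).trans_eq ?_
    rw [hF]
    ring
  have hT : (T ×ˢ (Set.univ : Set F)).ncard ≤ (q + 1) * q ^ 2 := by
    rw [Set.ncard_prod, Set.ncard_univ, Nat.card_eq_fintype_card, hF]
    exact Nat.mul_le_mul_right _ (ncard_pow_eq_le _ q.succ_pos)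
  have hsub : Cgam q (0 : F) ⊆ (fun x => Projectivization.mk F _ (hv₁ x)) '' S ∪
      (fun x => Projectivization.mk F _ (hv₂ x)) '' (T ×ˢ (Set.univ : Set F)) ∪
      {Projectivization.mk F _ hv₃} := by
    have hscale : ∀ (v w : Fin 4 → F) (hv : v ≠ 0) (hw : w ≠ 0) (c : F), c • w = v →
        Projectivization.mk F v hv ∈ Cgam q (0 : F) →
        Projectivization.mk F v hv = Projectivization.mk F w hw ∧ Fgam q 0 w = 0 := by
      intro v w hv hw c hc hP
      have hPQ := (Projectivization.mk_eq_mk_iff' F _ _ hv hw).2 ⟨c, hc⟩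
      exact ⟨hPQ, (mk_mem_Cgam_zero hw).1 (hPQ ▸ hP)⟩
    intro P hP
    induction P using Projectivization.ind with
    | h v hv =>
      by_cases h0 : v 0 = 0
      · by_cases h2 : v 2 = 0
        · right
          have hF0 := (mk_mem_Cgam_zero hv).1 hP
          have h1 : v 1 = 0 := by
            simpa [Fgam_zero, h0, h2, h.ne_zero] using hF0
          refine (Projectivization.mk_eq_mk_iff' F _ _ hv hv₃).2 ⟨v 3, ?_⟩
          ext i
          fin_cases i <;> simp [h0, h1, h2]
        · left; right
          obtain ⟨hPQ, hw⟩ := hscale v _ hv (hv₂ (v 1 / v 2, v 3 / v 2)) (v 2) (by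
            ext i
            fin_cases i <;> simp [h0, mul_div_cancel₀ _ h2]) hP
          refine ⟨(v 1 / v 2, v 3 / v 2), ⟨?_, trivial⟩, hPQ.symm⟩
          change (v 1 / v 2) ^ (q + 1) = -1
          simp [Fgam_zero, h.ne_zero] at hw
          linear_combination -hw
      · left; left
        obtain ⟨hPQ, hw⟩ := hscale v _ hv (hv₁ (v 1 / v 0, v 2 / v 0, v 3 / v 0)) (v 0) (by
          ext i
          fin_cases i <;> simp [mul_div_cancel₀ _ h0]) hP
        refine ⟨(v 1 / v 0, v 2 / v 0, v 3 / v 0), ?_, hPQ.symm⟩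
        change (v 3 / v 0) ^ q + v 3 / v 0 = (v 1 / v 0) ^ (q + 1) + (v 2 / v 0) ^ (q + 1)
        simp [Fgam_zero] at hw
        linear_combination hw
  calc (Cgam q (0 : F)).ncard ≤ _ := Set.ncard_le_ncard hsub
    _ ≤ _ := Set.ncard_union_le _ _
    _ ≤ _ := Nat.add_le_add_right (Set.ncard_union_le _ _) _
    _ ≤ q ^ 5 + (q + 1) * q ^ 2 + 1 := by
      gcongr
      · exact (Set.ncard_image_le).trans hS
      · exact (Set.ncard_image_le).trans hT
      · rw [Set.ncard_singleton]
    _ = _ := by ring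

lemma ncard_Cgam_zero_diff_Oset_le [Fintype F] (h : IsInvolutivePower F q)
    (hF : Fintype.card F = q ^ 2) (hq : 1 < q) :
    (Cgam q (0 : F) \ Oset F q).ncard ≤ q ^ 5 + q ^ 3 := by
  have hsub : Oset F q ⊆ Cgam q (0 : F) := by
    intro P hP
    induction P using Projectivization.ind with
    | h v hv => exact (mk_mem_Cgam_zero hv).2 ((mk_mem_Oset h hv).1 hP).2
  have h1 := Set.ncard_sdiff_add_ncard_of_subset hsub
  have h2 := ncard_Cgam_zero_le h hF hq
  rw [ncard_Oset hF] at h1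
  rw [show q ^ 2 * (q + 1) = q ^ 3 + q ^ 2 by ring] at h2
  omega

end Counting

section Orbits

variable {F : Type*} [Field F] {q : ℕ}

lemma sq_sub_one_eq (m : ℕ) : (2 * m + 1) ^ 2 - 1 = 2 * (2 * (m * (m + 1))) := by
  rw [show (2 * m + 1) ^ 2 = 2 * (2 * (m * (m + 1))) + 1 by ring]
  rfl

lemma pow_half_eq_neg_one {ξ : F} {m : ℕ} (hξ : IsPrimitiveRoot ξ ((2 * m + 1) ^ 2 - 1))
    (hm : 0 < m) : ξ ^ (2 * (m * (m + 1))) = -1 := by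
  rw [sq_sub_one_eq] at hξ
  have hm' : 0 < m * (m + 1) := by positivity
  have h1 : ξ ^ (2 * (m * (m + 1))) * ξ ^ (2 * (m * (m + 1))) = 1 := by
    rw [← pow_add, ← two_mul, hξ.pow_eq_one]
  exact (mul_self_eq_one_iff.1 h1).resolve_left
    (hξ.pow_ne_one_of_pos_of_lt (by omega) (by omega))

lemma pow_sq_sub_one_eq_one [Fintype F] (hF : Fintype.card F = q ^ 2) {x : F} (hx : x ≠ 0) :
    x ^ (q ^ 2 - 1) = 1 := by
  rw [← hF, FiniteField.pow_card_sub_one_eq_one x hx]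

theorem Korb_orbits_SigmaSet [Fintype F] (h : IsInvolutivePower F q)
    (hF : Fintype.card F = q ^ 2) (h2 : (2 : F) ≠ 0) (hodd : Odd q) (hq : 1 < q) {ξ : F}
    (hξ : IsPrimitiveRoot ξ (q ^ 2 - 1)) (hgen : ∀ x : F, x ≠ 0 → ∃ m : ℕ, x = ξ ^ m)
    (hv₁ : ![1, 0, 0, 1] ≠ (0 : Fin 4 → F)) (hv₂ : ![1, 0, 0, ξ ^ (q + 1)] ≠ 0) :
    Korb q (Projectivization.mk F _ hv₁) ∩ Korb q (Projectivization.mk F _ hv₂) = ∅ ∧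
    (Korb q (Projectivization.mk F _ hv₁)).ncard = (q ^ 3 + q) / 2 ∧
    (Korb q (Projectivization.mk F _ hv₂)).ncard = (q ^ 3 + q) / 2 ∧
    Korb q (Projectivization.mk F _ hv₁) ∪ Korb q (Projectivization.mk F _ hv₂) =
      SigmaSet F q \ Oset F q := by
  have hξ0 : ξ ≠ 0 := hξ.ne_zero (Nat.sub_pos_of_lt (Nat.one_lt_pow two_ne_zero hq)).ne'
  have hH₁ : IsHermVec q (![1, 0, 0, 1] : Fin 4 → F) := by simp [IsHermVec, h.ne_zero]
  have hH₂ : IsHermVec q ![1, 0, 0, ξ ^ (q + 1)] := by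
    simp [IsHermVec, h.ne_zero, h.norm_fixed]
  have hunion : Korb q (Projectivization.mk F _ hv₁) ∪ Korb q (Projectivization.mk F _ hv₂) =
      SigmaSet F q \ Oset F q := by
    refine Set.Subset.antisymm (Set.union_subset ?_ ?_)
      (SigmaSet_diff_Oset_subset h h2 hq hξ hgen hv₁ hv₂)
    · exact Korb_subset_SigmaSet_diff_Oset h hv₁ hH₁ (by simp [vecDet])
    · exact Korb_subset_SigmaSet_diff_Oset h hv₂ hH₂ (by simp [vecDet, hξ0])
  have hinter : Korb q (Projectivization.mk F _ hv₁) ∩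
      Korb q (Projectivization.mk F _ hv₂) = ∅ := by
    refine Korb_inter_eq_empty h hv₁ hv₂ fun A B c hA hc hdet => ?_
    have hcq : c ^ q = c := by
      refine IsHermVec.scalar_fixed hA (hH₂.map_tensorAct h A) ?_
      rw [hc]
      exact hH₁.map_tensorAct h B
    simp only [vecDet, cons_val, mul_one, mul_zero, sub_zero, one_mul] at hdet
    obtain ⟨m, rfl⟩ := hodd
    have hc0 : c ≠ 0 := by
      rintro rfl
      simp at hdet
    have h1 : c ^ (2 * m) = 1 := by
      rw [pow_succ] at hcq
      simpa [hc0] using hcq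
    have h3 := congrArg (· ^ m) hdet
    simp only [one_pow, mul_pow, ← pow_mul, h1, one_mul] at h3
    rw [show (2 * m + 1 + 1) * m = 2 * (m * (m + 1)) by ring,
      pow_half_eq_neg_one hξ (by omega)] at h3
    exact h2 (by linear_combination h3)
  have hcard : (Korb q (Projectivization.mk F _ hv₁)).ncard =
      (Korb q (Projectivization.mk F _ hv₂)).ncard := by
    apply le_antisymm
    · have hD : tensorAct q !![1, 0; 0, ξ] ![1, 0, 0, 1] = ![1, 0, 0, ξ ^ (q + 1)] := by
        simp [tensorAct_eq, h.ne_zero, pow_succ]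
      simpa only [hD] using ncard_Korb_le_ncard_Korb_tensorAct h (D := !![1, 0; 0, ξ])
        (by simp [det_fin_two, hξ0]) hv₁ (by rwa [hD])
    · have hD : tensorAct q !![1, 0; 0, ξ⁻¹] ![1, 0, 0, ξ ^ (q + 1)] = ![1, 0, 0, 1] := by
        simp [tensorAct_eq, h.ne_zero, pow_succ]
        field_simp
      simpa only [hD] using ncard_Korb_le_ncard_Korb_tensorAct h (D := !![1, 0; 0, ξ⁻¹])
        (by simp [det_fin_two, hξ0]) hv₂ (by rwa [hD])
  have hsum := Set.ncard_union_eq (Set.disjoint_iff_inter_eq_empty.2 hinter)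
  rw [hunion, ncard_SigmaSet_diff_Oset h hF hξ hq] at hsum
  exact ⟨hinter, by omega, by omega, hunion⟩

theorem Korb_orbits_hermitianSurface [Fintype F] (h : IsInvolutivePower F q)
    (hF : Fintype.card F = q ^ 2) (h2 : (2 : F) ≠ 0) (hodd : Odd q) (hq : 1 < q) {ξ : F}
    (hξ : IsPrimitiveRoot ξ (q ^ 2 - 1))
    (hv₁ : ![ξ ^ ((q + 1) / 2), 0, 0, 1] ≠ 0) (hv₂ : ![0, ξ ^ ((q - 1) / 2), 1, 0] ≠ 0) :
    Korb q (Projectivization.mk F _ hv₁) ∩ Korb q (Projectivization.mk F _ hv₂) = ∅ ∧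
    (Korb q (Projectivization.mk F _ hv₁)).ncard = q ^ 2 * (q ^ 2 + 1) * (q - 1) / 2 ∧
    (Korb q (Projectivization.mk F _ hv₂)).ncard = q ^ 2 * (q ^ 2 + 1) * (q + 1) / 2 ∧
    Korb q (Projectivization.mk F _ hv₁) ∪ Korb q (Projectivization.mk F _ hv₂) =
      Cgam q (0 : F) \ Oset F q := by
  have hN : 0 < q ^ 2 - 1 := Nat.sub_pos_of_lt (Nat.one_lt_pow two_ne_zero hq)
  have hξ0 : ξ ≠ 0 := hξ.ne_zero hN.ne'
  have hodd' := hodd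
  obtain ⟨m, rfl⟩ := hodd
  have hE := pow_half_eq_neg_one hξ (by omega)
  have hone : ∀ x : F, x ≠ 0 → x ^ (2 * (2 * (m * (m + 1)))) = 1 := fun x hx => by
    rw [← sq_sub_one_eq]
    exact pow_sq_sub_one_eq_one hF hx
  have hneg : (-1 : F) ≠ 1 := fun h => h2 (by linear_combination -h)
  have em₁ : (2 * m + 1 + 1) / 2 = m + 1 := by omega
  have em₂ : (2 * m + 1 - 1) / 2 = m := by omega
  have ha : (ξ ^ (m + 1)) ^ (2 * m + 1) = -ξ ^ (m + 1) := by
    rw [← pow_mul, show (m + 1) * (2 * m + 1) = 2 * (m * (m + 1)) + (m + 1) by ring, pow_add, hE]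
    ring
  have ha2 : ∀ x : F, x ^ (2 * (2 * m + 1 + 1)) ≠ (ξ ^ (m + 1)) ^ 2 := by
    intro x hx
    have hx0 : x ≠ 0 := by
      rintro rfl
      rw [zero_pow (by omega)] at hx
      exact pow_ne_zero _ (pow_ne_zero _ hξ0) hx.symm
    have h3 := congrArg (· ^ m) hx
    simp only [← pow_mul] at h3
    rw [show 2 * (2 * m + 1 + 1) * m = 2 * (2 * (m * (m + 1))) by ring, hone x hx0,
      show (m + 1) * 2 * m = 2 * (m * (m + 1)) by ring, hE] at h3
    exact hneg h3.symm
  have hb : (ξ ^ m) ^ (2 * m + 1 + 1) = -1 := by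
    rw [← pow_mul, show m * (2 * m + 1 + 1) = 2 * (m * (m + 1)) by ring, hE]
  have hb2 : ∀ x : F, x ^ (2 * (2 * m + 1 - 1)) ≠ (ξ ^ m) ^ 2 := by
    intro x hx
    have hx0 : x ≠ 0 := by
      rintro rfl
      rw [zero_pow (by omega)] at hx
      exact pow_ne_zero _ (pow_ne_zero _ hξ0) hx.symm
    have h3 := congrArg (· ^ (m + 1)) hx
    simp only [← pow_mul, Nat.add_sub_cancel] at h3
    rw [show 2 * (2 * m) * (m + 1) = 2 * (2 * (m * (m + 1))) by ring, hone x hx0,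
      show m * 2 * (m + 1) = 2 * (m * (m + 1)) by ring, hE] at h3
    exact hneg h3.symm
  have hd₁ : 2 * (2 * m + 1 + 1) ∣ (2 * m + 1) ^ 2 - 1 :=
    ⟨m, by rw [sq_sub_one_eq]; ring⟩
  have hd₂ : 2 * (2 * m + 1 - 1) ∣ (2 * m + 1) ^ 2 - 1 :=
    ⟨m + 1, by rw [sq_sub_one_eq, Nat.add_sub_cancel]; ring⟩
  have hs₁ := card_stabilizer_of_diagonal (by omega)
    (stabilizer_diagonal h h2 hodd' (pow_ne_zero (m + 1) hξ0) ha ha2)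
  have hs₂ := card_stabilizer_of_diagonal (by omega)
    (stabilizer_antidiagonal h h2 hodd' hb hb2)
  rw [ncard_pow_eq_one hξ hN hd₁] at hs₁
  rw [ncard_pow_eq_one hξ hN hd₂, Nat.add_sub_cancel] at hs₂
  simp only [em₁, em₂] at hv₁ hv₂ ⊢
  have hc₁ := ncard_Korb_mul_card_stabilizer h hv₁
  have hc₂ := ncard_Korb_mul_card_stabilizer h hv₂
  have hpow : ((2 * m + 1) ^ 2) ^ 2 - 1 = 2 * (2 * m + 1 + 1) * (m * ((2 * m + 1) ^ 2 + 1)) := by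
    rw [show ((2 * m + 1) ^ 2) ^ 2 =
      2 * (2 * m + 1 + 1) * (m * ((2 * m + 1) ^ 2 + 1)) + 1 by ring]
    rfl
  rw [hs₁, hF, hpow] at hc₁
  rw [hs₂, hF, hpow] at hc₂
  have hn₁ : (Korb (2 * m + 1) (Projectivization.mk F _ hv₁)).ncard =
      (2 * m + 1) ^ 2 * ((2 * m + 1) ^ 2 + 1) * m :=
    Nat.eq_of_mul_eq_mul_right (show 0 < 2 * (2 * m + 1 + 1) by omega) (hc₁.trans (by ring))
  have hn₂ : (Korb (2 * m + 1) (Projectivization.mk F _ hv₂)).ncard =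
      (2 * m + 1) ^ 2 * ((2 * m + 1) ^ 2 + 1) * (m + 1) :=
    Nat.eq_of_mul_eq_mul_right (show 0 < 2 * (2 * m) by omega) (hc₂.trans (by ring))
  have hinter : Korb (2 * m + 1) (Projectivization.mk F _ hv₁) ∩
      Korb (2 * m + 1) (Projectivization.mk F _ hv₂) = ∅ := by
    refine Korb_inter_eq_empty h hv₁ hv₂ fun _ _ c _ _ hdet => ?_
    simp only [vecDet, cons_val, mul_one, mul_zero, sub_zero, zero_sub, pow_succ ξ m]
      at hdet
    have hξc : ξ = -c ^ 2 := mul_left_cancel₀ (pow_ne_zero m hξ0) (by linear_combination hdet)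
    have hc0 : c ≠ 0 := by
      rintro rfl
      simp at hξc
      exact hξ0 hξc
    rw [hξc, (even_two_mul _).neg_pow, ← pow_mul, hone c hc0] at hE
    exact hneg hE.symm
  have hsub : Korb (2 * m + 1) (Projectivization.mk F _ hv₁) ∪
      Korb (2 * m + 1) (Projectivization.mk F _ hv₂) ⊆
      Cgam (2 * m + 1) (0 : F) \ Oset F (2 * m + 1) := by
    refine Set.union_subset (Korb_subset_Cgam_zero_diff_Oset h hv₁ ?_ ?_)
      (Korb_subset_Cgam_zero_diff_Oset h hv₂ ?_ ?_)
    · simp [Fgam_zero, ha]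
    · simp [vecDet, hξ0]
    · simp [Fgam_zero]
      linear_combination -hb
    · simp [vecDet, hξ0]
  refine ⟨hinter, ?_, ?_, Set.eq_of_subset_of_ncard_le hsub ?_⟩
  · rw [hn₁, Nat.add_sub_cancel, mul_left_comm, Nat.mul_div_cancel_left _ two_pos]
  · rw [hn₂, show 2 * m + 1 + 1 = 2 * (m + 1) by ring, mul_left_comm,
      Nat.mul_div_cancel_left _ two_pos]
  · rw [Set.ncard_union_eq (Set.disjoint_iff_inter_eq_empty.2 hinter), hn₁, hn₂]
    refine (ncard_Cgam_zero_diff_Oset_le h hF hq).trans_eq ?_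
    ring

end Orbits

/-- Lemma 2.1: the `K`-orbits on `O`, on `Σ \ O` and on `H(3,q²) \ O`. -/
theorem stmt7 {F : Type*} [Field F] [Fintype F] (p n q : ℕ) (hp : p.Prime)
    (hodd : Odd p) (hn : 0 < n) (hq : q = p ^ n) (hF : Fintype.card F = q ^ 2)
    (ξ : F) (hξ : ∀ x : F, x ≠ 0 → ∃ m : ℕ, x = ξ ^ m) :
    (∀ P ∈ Oset F q, Korb q P = Oset F q) ∧
    (Korb q (Projectivization.mk F ![1, 0, 0, 1]
          (by intro h; have := congrFun h 0; simp at this)) ∩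
        Korb q (Projectivization.mk F ![1, 0, 0, ξ ^ (q + 1)]
          (by intro h; have := congrFun h 0; simp at this)) = ∅ ∧
      (Korb q (Projectivization.mk F ![1, 0, 0, 1]
          (by intro h; have := congrFun h 0; simp at this))).ncard = (q ^ 3 + q) / 2 ∧
      (Korb q (Projectivization.mk F ![1, 0, 0, ξ ^ (q + 1)]
          (by intro h; have := congrFun h 0; simp at this))).ncard = (q ^ 3 + q) / 2 ∧
      Korb q (Projectivization.mk F ![1, 0, 0, 1]
          (by intro h; have := congrFun h 0; simp at this)) ∪
        Korb q (Projectivization.mk F ![1, 0, 0, ξ ^ (q + 1)]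
          (by intro h; have := congrFun h 0; simp at this))
        = SigmaSet F q \ Oset F q) ∧
    (Korb q (Projectivization.mk F ![ξ ^ ((q + 1) / 2), 0, 0, 1]
          (by intro h; have := congrFun h 3; simp at this)) ∩
        Korb q (Projectivization.mk F ![0, ξ ^ ((q - 1) / 2), 1, 0]
          (by intro h; have := congrFun h 2; simp at this)) = ∅ ∧
      (Korb q (Projectivization.mk F ![ξ ^ ((q + 1) / 2), 0, 0, 1]
          (by intro h; have := congrFun h 3; simp at this))).ncard
        = q ^ 2 * (q ^ 2 + 1) * (q - 1) / 2 ∧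
      (Korb q (Projectivization.mk F ![0, ξ ^ ((q - 1) / 2), 1, 0]
          (by intro h; have := congrFun h 2; simp at this))).ncard
        = q ^ 2 * (q ^ 2 + 1) * (q + 1) / 2 ∧
      Korb q (Projectivization.mk F ![ξ ^ ((q + 1) / 2), 0, 0, 1]
          (by intro h; have := congrFun h 3; simp at this)) ∪
        Korb q (Projectivization.mk F ![0, ξ ^ ((q - 1) / 2), 1, 0]
          (by intro h; have := congrFun h 2; simp at this))
        = Cgam q (0 : F) \ Oset F q) := by
  have h := isInvolutivePower_of_card hp hq hF
  have h2 := two_ne_zero_of_card hp hodd hq hF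
  have hq1 : 1 < q := by
    rw [hq]
    exact Nat.one_lt_pow hn.ne' hp.one_lt
  have hqodd : Odd q := hq ▸ hodd.pow
  have hξ0 : ξ ≠ 0 := by
    rintro rfl
    have h1 : ∀ x : F, x ≠ 0 → x = 1 := by
      intro x hx
      obtain ⟨m, rfl⟩ := hξ x hx
      by_cases hm : m = 0
      · rw [hm, pow_zero]
      · exact absurd (zero_pow hm) hx
    exact h2 (by linear_combination -h1 (-1) (neg_ne_zero.2 one_ne_zero))
  have hprim := isPrimitiveRoot_of_forall_exists_pow hξ0 hξ
  rw [hF] at hprim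
  exact ⟨fun P hP => Korb_eq_Oset h hP, Korb_orbits_SigmaSet h hF h2 hqodd hq1 hprim hξ _ _,
    Korb_orbits_hermitianSurface h hF h2 hqodd hq1 hprim _ _⟩
end
end

section
/- Let q be an odd prime power. The action of the group K ≅ PSL(2,q²) (induced on PG(3,q²) by the matrices A^q ⊗ A with A ∈ SL(2,𝔽_{q²})) has exactly 2q + 4 orbits on the points of PG(3,q²). -/
noncomputable section

open Matrix

/-- The conjugate transpose of a matrix with respect to `σ`. -/
def sigmaTranspose {F : Type*} [Field F] (σ : F →+* F) (A : Matrix (Fin 2) (Fin 2) F) :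
    Matrix (Fin 2) (Fin 2) F :=
  (A.map σ)ᵀ

/-- Congruence, up to a nonzero scalar, of the sesquilinear forms given by `X` and `Y`. -/
def ProjCongr {F : Type*} [Field F] (σ : F →+* F) (X Y : Matrix (Fin 2) (Fin 2) F) : Prop :=
  ∃ (A : Matrix (Fin 2) (Fin 2) F) (l : F), A.det = 1 ∧ l ≠ 0 ∧
    Y = l • (sigmaTranspose σ A * X * A)

/-- The coefficient of `t` in `det (X + t X*)`. -/
def mixedDet {F : Type*} [Field F] (σ : F →+* F) (X : Matrix (Fin 2) (Fin 2) F) : F :=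
  X 0 0 * σ (X 1 1) + σ (X 0 0) * X 1 1 - X 0 1 * σ (X 0 1) - X 1 0 * σ (X 1 0)

/-- `X` is a nonzero scalar multiple of a Hermitian matrix. -/
def ProjHermitian {F : Type*} [Field F] (σ : F →+* F) (X : Matrix (Fin 2) (Fin 2) F) : Prop :=
  ∃ l : F, l ≠ 0 ∧ sigmaTranspose σ (l • X) = l • X

/-- The value of the sesquilinear form `X` at the vector `(x, y)`. -/
def sesqValue {F : Type*} [Field F] (σ : F →+* F) (X : Matrix (Fin 2) (Fin 2) F) (x y : F) : F :=
  σ x * X 0 0 * x + σ x * X 0 1 * y + σ y * X 1 0 * x + σ y * X 1 1 * y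

/-- The properties of the involution of a finite field of odd square order that are needed to
classify sesquilinear forms. -/
structure IsNormInvolution {F : Type*} [Field F] (σ : F →+* F) : Prop where
  invol : ∀ x, σ (σ x) = x
  two_ne : (2 : F) ≠ 0
  norm_surj : ∀ x, σ x = x → ∃ y, y * σ y = x
  sq_of_fixed : ∀ x, σ x = x → ∃ y, y ^ 2 = x
  sq_of_norm_one : ∀ x, x * σ x = 1 → ∃ y, y ^ 2 = x
  exists_sq_ne : ∃ g, g ≠ 0 ∧ σ g ^ 2 ≠ g ^ 2

section Congruence
variable {F : Type*} [Field F] {σ : F →+* F}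

theorem IsNormInvolution.exists_norm_one (h : IsNormInvolution σ) :
    ∃ z, z * σ z = 1 ∧ z ^ 2 ≠ 1 := by
  obtain ⟨g, hg, hg2⟩ := h.exists_sq_ne
  have hσg : σ g ≠ 0 := by simpa using hg
  refine ⟨σ g / g, by rw [map_div₀, h.invol]; field_simp, fun H => hg2 ?_⟩
  rwa [div_pow, div_eq_one_iff_eq (pow_ne_zero _ hg)] at H

theorem sigmaTranspose_mul (A B : Matrix (Fin 2) (Fin 2) F) :
    sigmaTranspose σ (A * B) = sigmaTranspose σ B * sigmaTranspose σ A := by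
  simp [sigmaTranspose, Matrix.map_mul]

theorem sigmaTranspose_invol (h : IsNormInvolution σ) (A : Matrix (Fin 2) (Fin 2) F) :
    sigmaTranspose σ (sigmaTranspose σ A) = A := by
  ext i j; simp [sigmaTranspose, h.invol]

theorem sigmaTranspose_one : sigmaTranspose σ (1 : Matrix (Fin 2) (Fin 2) F) = 1 := by
  simp [sigmaTranspose]

theorem det_sigmaTranspose (A : Matrix (Fin 2) (Fin 2) F) :
    (sigmaTranspose σ A).det = σ A.det := by
  simp [sigmaTranspose, Matrix.det_fin_two]

theorem ProjCongr.refl (X : Matrix (Fin 2) (Fin 2) F) : ProjCongr σ X X :=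
  ⟨1, 1, by simp, one_ne_zero, by simp [sigmaTranspose_one]⟩

theorem ProjCongr.trans {X Y Z : Matrix (Fin 2) (Fin 2) F} (h₁ : ProjCongr σ X Y)
    (h₂ : ProjCongr σ Y Z) : ProjCongr σ X Z := by
  obtain ⟨A, l, hA, hl, rfl⟩ := h₁
  obtain ⟨B, m, hB, hm, rfl⟩ := h₂
  refine ⟨A * B, m * l, by simp [hA, hB], mul_ne_zero hm hl, ?_⟩
  simp [sigmaTranspose_mul, smul_smul, Matrix.mul_assoc]

theorem ProjCongr.symm {X Y : Matrix (Fin 2) (Fin 2) F} (h₁ : ProjCongr σ X Y) :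
    ProjCongr σ Y X := by
  obtain ⟨A, l, hA, hl, rfl⟩ := h₁
  have hu : IsUnit A.det := by simp [hA]
  refine ⟨A⁻¹, l⁻¹, by simp [Matrix.det_nonsing_inv, hA], inv_ne_zero hl, ?_⟩
  have h1 : sigmaTranspose σ A⁻¹ * sigmaTranspose σ A = 1 := by
    rw [← sigmaTranspose_mul, Matrix.mul_nonsing_inv _ hu, sigmaTranspose_one]
  have h2 : A * A⁻¹ = 1 := Matrix.mul_nonsing_inv _ hu
  have h3 : sigmaTranspose σ A⁻¹ * (sigmaTranspose σ A * X * A) * A⁻¹ = X := by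
    calc _ = (sigmaTranspose σ A⁻¹ * sigmaTranspose σ A) * X * (A * A⁻¹) := by
          simp only [Matrix.mul_assoc]
      _ = X := by rw [h1, h2]; simp
  rw [Matrix.mul_smul, Matrix.smul_mul, smul_smul, inv_mul_cancel₀ hl, one_smul, h3]

theorem ProjCongr.smul (X : Matrix (Fin 2) (Fin 2) F) {l : F} (hl : l ≠ 0) :
    ProjCongr σ X (l • X) :=
  ⟨1, l, by simp, hl, by simp [sigmaTranspose_one]⟩

theorem ProjCongr.congruent (X : Matrix (Fin 2) (Fin 2) F) {A : Matrix (Fin 2) (Fin 2) F}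
    (hA : A.det = 1) : ProjCongr σ X (sigmaTranspose σ A * X * A) :=
  ⟨A, 1, hA, one_ne_zero, by simp⟩

theorem det_congruent (X : Matrix (Fin 2) (Fin 2) F) {A : Matrix (Fin 2) (Fin 2) F}
    (hA : A.det = 1) : (sigmaTranspose σ A * X * A).det = X.det := by
  simp [det_sigmaTranspose, hA]

theorem mixedDet_congruent (h : IsNormInvolution σ) (X : Matrix (Fin 2) (Fin 2) F)
    {A : Matrix (Fin 2) (Fin 2) F} (hA : A.det = 1) :
    mixedDet σ (sigmaTranspose σ A * X * A) = mixedDet σ X := by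
  have hA' : σ A.det = 1 := by rw [hA, map_one]
  rw [Matrix.det_fin_two] at hA hA'
  have key : mixedDet σ (sigmaTranspose σ A * X * A) =
      (A 0 0 * A 1 1 - A 0 1 * A 1 0) * σ (A 0 0 * A 1 1 - A 0 1 * A 1 0) * mixedDet σ X := by
    simp [mixedDet, sigmaTranspose, Matrix.mul_apply, Fin.sum_univ_two, h.invol]
    ring
  rw [key, hA', hA]; simp

theorem mixedDet_smul (X : Matrix (Fin 2) (Fin 2) F) (l : F) :
    mixedDet σ (l • X) = l * σ l * mixedDet σ X := by
  simp [mixedDet]; ring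

theorem ProjCongr.invariants (h : IsNormInvolution σ) {X Y : Matrix (Fin 2) (Fin 2) F}
    (hXY : ProjCongr σ X Y) :
    ∃ l : F, l ≠ 0 ∧ Y.det = l ^ 2 * X.det ∧ mixedDet σ Y = l * σ l * mixedDet σ X := by
  obtain ⟨A, l, hA, hl, rfl⟩ := hXY
  refine ⟨l, hl, ?_, ?_⟩
  · rw [Matrix.det_smul, det_congruent X hA]; simp
  · rw [mixedDet_smul, mixedDet_congruent h X hA]

theorem ProjCongr.projHermitian (h : IsNormInvolution σ) {X Y : Matrix (Fin 2) (Fin 2) F}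
    (hXY : ProjCongr σ X Y) (hX : ProjHermitian σ X) : ProjHermitian σ Y := by
  obtain ⟨A, l, hA, hl, rfl⟩ := hXY
  obtain ⟨m, hm, hmX⟩ := hX
  refine ⟨m * l⁻¹, mul_ne_zero hm (inv_ne_zero hl), ?_⟩
  have : (m * l⁻¹) • l • (sigmaTranspose σ A * X * A) = sigmaTranspose σ A * (m • X) * A := by
    rw [smul_smul, mul_assoc, inv_mul_cancel₀ hl, mul_one, Matrix.mul_smul, Matrix.smul_mul]
  rw [this, sigmaTranspose_mul, sigmaTranspose_mul, hmX, sigmaTranspose_invol h,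
    Matrix.mul_assoc]

theorem sesqValue_smul (X : Matrix (Fin 2) (Fin 2) F) (l x y : F) :
    sesqValue σ (l • X) x y = l * sesqValue σ X x y := by
  simp [sesqValue]; ring

theorem sesqValue_congruent (A X : Matrix (Fin 2) (Fin 2) F) (x y : F) :
    sesqValue σ (sigmaTranspose σ A * X * A) x y =
      sesqValue σ X (A 0 0 * x + A 0 1 * y) (A 1 0 * x + A 1 1 * y) := by
  simp [sesqValue, sigmaTranspose, Matrix.mul_apply, Fin.sum_univ_two]
  ring

theorem exists_sesqValue_ne_zero (h : IsNormInvolution σ) {X : Matrix (Fin 2) (Fin 2) F}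
    (hX : X ≠ 0) : ∃ x y, sesqValue σ X x y ≠ 0 := by
  by_contra! H
  obtain ⟨z, hz, hz2⟩ := h.exists_norm_one
  have h00 : X 0 0 = 0 := by simpa [sesqValue] using H 1 0
  have h11 : X 1 1 = 0 := by simpa [sesqValue] using H 0 1
  have e1 : X 0 1 + X 1 0 = 0 := by simpa [sesqValue, h00, h11] using H 1 1
  have e2 : σ z * X 0 1 + X 1 0 * z = 0 := by simpa [sesqValue, h00, h11] using H z 1
  have e3 : X 0 1 * (z ^ 2 - 1) = 0 := by linear_combination (z ^ 2) * e1 - z * e2 + X 0 1 * hz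
  have h01 : X 0 1 = 0 := (mul_eq_zero.1 e3).resolve_right (sub_ne_zero.2 hz2)
  have h10 : X 1 0 = 0 := by simpa [h01] using e1
  apply hX
  ext i j
  fin_cases i <;> fin_cases j <;> simp [h00, h01, h10, h11]

/-- If the form `X` takes the value `a ≠ 0`, then `X` is congruent to an upper triangular matrix
with first entry `a`. -/
theorem exists_congruent_upper (h : IsNormInvolution σ) {X : Matrix (Fin 2) (Fin 2) F} {a x y : F}
    (ha : a ≠ 0) (hxy : sesqValue σ X x y = a) :
    ∃ A : Matrix (Fin 2) (Fin 2) F, A.det = 1 ∧ ∃ b e,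
      sigmaTranspose σ A * X * A = !![a, b; 0, e] := by
  obtain ⟨A, hA, hA0, hA1⟩ : ∃ A : Matrix (Fin 2) (Fin 2) F,
      A.det = 1 ∧ A 0 0 = x ∧ A 1 0 = y := by
    by_cases hx : x = 0
    · have hy : y ≠ 0 := by
        rintro rfl
        apply ha
        rw [← hxy, hx]
        simp [sesqValue]
      exact ⟨!![x, -y⁻¹; y, 0], by simp [hy], by simp, by simp⟩
    · exact ⟨!![x, 0; y, x⁻¹], by simp [hx], by simp, by simp⟩
  set Y := sigmaTranspose σ A * X * A with hY
  have hY0 : Y 0 0 = a := by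
    have := sesqValue_congruent (σ := σ) A X 1 0
    rw [← hY] at this
    simpa [sesqValue, hA0, hA1, ← hxy] using this
  have hσa : σ a ≠ 0 := by simpa using ha
  let s := -σ (Y 1 0) / σ a
  have hs : σ s = -Y 1 0 / a := by simp [s, h.invol]
  refine ⟨A * !![1, s; 0, 1], by simp [hA], Y 0 1 + a * s,
    Y 1 1 + Y 1 0 * s + σ s * (Y 0 1 + a * s), ?_⟩
  have : sigmaTranspose σ (A * !![1, s; 0, 1]) * X * (A * !![1, s; 0, 1]) =
      sigmaTranspose σ !![1, s; 0, 1] * Y * !![1, s; 0, 1] := by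
    rw [hY, sigmaTranspose_mul]; simp only [Matrix.mul_assoc]
  rw [this]
  ext i j
  fin_cases i <;> fin_cases j <;>
    simp [sigmaTranspose, Matrix.mul_apply, Fin.sum_univ_two, hY0, hs]
  · ring
  · field_simp; ring
  · ring

theorem exists_congruent_upper_of_ne_zero (h : IsNormInvolution σ)
    {X : Matrix (Fin 2) (Fin 2) F} (hX : X ≠ 0) :
    ∃ A : Matrix (Fin 2) (Fin 2) F, A.det = 1 ∧ ∃ a b e, a ≠ 0 ∧
      sigmaTranspose σ A * X * A = !![a, b; 0, e] := by
  obtain ⟨x, y, hxy⟩ := exists_sesqValue_ne_zero h hX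
  obtain ⟨A, hA, b, e, hAX⟩ := exists_congruent_upper h hxy rfl
  exact ⟨A, hA, _, b, e, hxy, hAX⟩

theorem exists_fixed_sesqValue (h : IsNormInvolution σ) {X : Matrix (Fin 2) (Fin 2) F}
    (hX : ¬ ProjHermitian σ X) (hd : X.det + σ X.det ≠ mixedDet σ X) :
    ∃ x y, sesqValue σ X x y ≠ 0 ∧ σ (sesqValue σ X x y) = sesqValue σ X x y := by
  have hX0 : X ≠ 0 := by
    rintro rfl
    exact hX ⟨1, one_ne_zero, by ext i j; simp [sigmaTranspose]⟩
  obtain ⟨A, hA, a, b, e, ha, hAX⟩ := exists_congruent_upper_of_ne_zero h hX0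
  have hd' := det_congruent (σ := σ) X hA
  have hm' := mixedDet_congruent h X hA
  have hY : ¬ ProjHermitian σ !![a, b; 0, e] := fun H =>
    hX ((hAX ▸ ProjCongr.congruent (σ := σ) X hA).symm.projHermitian h H)
  rw [← hd', ← hm', hAX] at hd
  suffices H : ∃ x y, sesqValue σ !![a, b; 0, e] x y ≠ 0 ∧
      σ (sesqValue σ !![a, b; 0, e] x y) = sesqValue σ !![a, b; 0, e] x y by
    obtain ⟨x, y, H⟩ := H
    rw [← hAX, sesqValue_congruent] at H
    exact ⟨_, _, H⟩
  simp only [mixedDet, Matrix.det_fin_two_of] at hd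
  simp at hd
  by_cases hs : a - σ a = 0
  · exact ⟨1, 0, by simpa [sesqValue] using ha, by simpa [sesqValue] using (sub_eq_zero.1 hs).symm⟩
  set s := a - σ a with hs_def
  have hσs : σ s = -s := by simp [hs_def, h.invol]
  set n := -(b * σ b + s * (e - σ e)) / s ^ 2 with hn
  have hn0 : n ≠ 0 := by
    rw [hn]
    refine div_ne_zero (neg_ne_zero.2 fun H => hd ?_) (pow_ne_zero _ hs)
    linear_combination H + (e - σ e) * hs_def
  have hσn : σ n = n := by
    simp only [hn, map_div₀, map_neg, map_add, map_mul, map_sub, h.invol, map_pow, hσs]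
    ring
  obtain ⟨z, hz⟩ := h.norm_surj n hσn
  obtain ⟨w, hw, hw2⟩ := h.exists_norm_one
  by_contra! H
  have fixed : ∀ t, t * σ t = n → a * t * σ b / s - b * σ a * σ t / s
      + (a * n - a * b * σ b / s ^ 2 + b * σ b / s + e) = 0 := by
    intro t ht
    by_contra hne
    have hval : sesqValue σ !![a, b; 0, e] (t - b / s) 1 = a * t * σ b / s - b * σ a * σ t / s
      + (a * n - a * b * σ b / s ^ 2 + b * σ b / s + e) := by
      simp [sesqValue, hσs]
      field_simp
      rw [← ht, hs_def]
      ring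
    refine H (t - b / s) 1 (by rwa [hval]) ?_
    have hn' : n * s ^ 2 = -(b * σ b + s * (e - σ e)) := by rw [hn]; field_simp
    simp [sesqValue, hσs, h.invol]
    field_simp
    rw [← sub_eq_zero]
    have ha' : σ a = a - s := by rw [hs_def]; ring
    rw [ha']
    linear_combination (-s^3) * ht - s * hn'
  have h1 := fixed z hz
  have hw0 : w ≠ 0 := by rintro rfl; simp at hw
  have hz0 : z ≠ 0 := by rintro rfl; simp at hz; exact hn0 hz.symm
  have hσz : σ z ≠ 0 := by simpa using hz0
  have h2 := fixed (z * w) (by rw [map_mul]; linear_combination (w * σ w) * hz + n * hw)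
  have h3 := fixed (z * w ^ 2) (by
    rw [map_mul, map_pow]; linear_combination (w * σ w) ^ 2 * hz + n * (w * σ w + 1) * hw)
  rw [map_mul] at h2
  rw [map_mul, map_pow] at h3
  have hw1 : w - 1 ≠ 0 := fun hw1 => hw2 (by rw [sub_eq_zero.1 hw1]; simp)
  set P := a * z * σ b / s with hP
  set Q := b * σ a * σ z / s with hQ
  have e2 : P * w = -Q := by
    apply mul_right_cancel₀ hw1
    have : P * w * (w - 1) + Q * (w - 1) = 0 := by
      rw [hP, hQ]
      linear_combination w * h2 - w * h1 + (b * σ a * σ z / s) * hw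
    linear_combination this
  have e3 : P * w ^ 3 = -Q := by
    apply mul_right_cancel₀ hw1
    have : P * w ^ 3 * (w - 1) + Q * (w - 1) = 0 := by
      rw [hP, hQ]
      linear_combination w ^ 2 * h3 - w ^ 2 * h2 +
        (b * σ a * σ z / s) * (w * σ w + 1 - w) * hw
    linear_combination this
  have e4 : Q = 0 := by
    refine (mul_eq_zero.1 (?_ : Q * (w ^ 2 - 1) = 0)).resolve_right (sub_ne_zero.2 hw2)
    linear_combination w ^ 2 * e2 - e3
  have hσa : σ a ≠ 0 := by simpa using ha
  have hb : b = 0 := by simpa [hQ, hs, hσz, hσa] using e4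
  subst hb
  have he : e = -(a * n) := by
    simp [hP, hQ] at h1
    linear_combination h1
  refine hY ⟨a⁻¹, inv_ne_zero ha, ?_⟩
  ext i j
  fin_cases i <;> fin_cases j <;> simp [sigmaTranspose, he, ha, hσn]

/-- Two upper triangular forms that agree up to a factor of norm one off the diagonal are
projectively congruent. -/
theorem projCongr_upper_of_norm_one (h : IsNormInvolution σ) (a b e : F) {w : F}
    (hw : w * σ w = 1) : ProjCongr σ !![a, b; 0, e] !![a, w * b; 0, e] := by
  obtain ⟨m, rfl⟩ := h.sq_of_norm_one w hw
  have hm : m ≠ 0 := by rintro rfl; simp at hw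
  have hσm : σ m ≠ 0 := by simpa using hm
  rw [map_pow] at hw
  refine ⟨!![m⁻¹, 0; 0, m], m * σ m, by simp [hm], mul_ne_zero hm hσm, ?_⟩
  ext i j
  fin_cases i <;> fin_cases j <;> simp [sigmaTranspose, Matrix.mul_apply, Fin.sum_univ_two]
  · field_simp
  · field_simp
  · linear_combination (-e) * hw

theorem projCongr_upper_of_norm_eq (h : IsNormInvolution σ) (a e : F) {b c : F}
    (hb : b ≠ 0) (hbc : b * σ b = c * σ c) : ProjCongr σ !![a, b; 0, e] !![a, c; 0, e] := by
  have hσb : σ b ≠ 0 := by simpa using hb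
  have := projCongr_upper_of_norm_one h a b e (w := c / b) (by
    rw [map_div₀]; field_simp; exact hbc.symm)
  rwa [div_mul_cancel₀ _ hb] at this

/-- A form that is not projectively Hermitian is determined up to congruence by its
invariants. -/
theorem projCongr_of_invariants (h : IsNormInvolution σ) {X : Matrix (Fin 2) (Fin 2) F}
    (hX : ¬ ProjHermitian σ X) {b c d : F} (hc : c ≠ 0) (hb : b ≠ 0) (hd : X.det = d)
    (hm : mixedDet σ X = mixedDet σ !![c, b; 0, d / c]) :
    ProjCongr σ X !![c, b; 0, d / c] := by
  have hσc : σ c ≠ 0 := by simpa using hc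
  have hσb : σ b ≠ 0 := by simpa using hb
  have hX' : ¬ ProjHermitian σ (c⁻¹ • X) := fun H =>
    hX ((ProjCongr.smul X (inv_ne_zero hc)).symm.projHermitian h H)
  obtain ⟨x, y, hxy0, hxy⟩ := exists_fixed_sesqValue h hX' (by
    rw [mixedDet_smul, Matrix.det_smul, hm, hd]
    simp [mixedDet]
    field_simp
    intro H
    have : c * σ c * b * σ b = 0 := by linear_combination H
    simp [hb, hc] at this)
  rw [sesqValue_smul] at hxy hxy0
  set r := c⁻¹ * sesqValue σ X x y with hr
  obtain ⟨ρ, hρ⟩ := h.norm_surj r hxy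
  have hρ0 : ρ ≠ 0 := by rintro rfl; simp at hρ; exact hxy0 hρ.symm
  have hσρ : σ ρ ≠ 0 := by simpa using hρ0
  have hv : sesqValue σ X (x / ρ) (y / ρ) = c := by
    have h1 : sesqValue σ X (x / ρ) (y / ρ) = sesqValue σ X x y / (ρ * σ ρ) := by
      simp [sesqValue]; field_simp
    have h2 : sesqValue σ X x y = c * r := by rw [hr]; field_simp
    rw [h1, hρ, h2]; field_simp
  obtain ⟨A, hA, b', e, hAX⟩ := exists_congruent_upper h hc hv
  have hd' := det_congruent (σ := σ) X hA
  have hm' := mixedDet_congruent h X hA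
  rw [hAX] at hd' hm'
  have he : e = d / c := by
    rw [eq_div_iff hc, ← hd, ← hd']; simp [mul_comm]
  subst he
  have hbb : b * σ b = b' * σ b' := by
    rw [hm] at hm'
    simp [mixedDet] at hm'
    linear_combination -hm'
  exact (hAX ▸ ProjCongr.congruent (σ := σ) X hA).trans
    (projCongr_upper_of_norm_eq h c _ hb hbb).symm

theorem not_projHermitian_upper {b c e : F} (hb : b ≠ 0) :
    ¬ ProjHermitian σ !![c, b; 0, e] := by
  rintro ⟨l, hl, H⟩
  have := congrFun (congrFun H 0) 1
  simp [sigmaTranspose, hl, hb] at this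

/-- Every invertible projectively Hermitian form is projectively congruent to `diag(1, 1)` or
`diag(1, δ²)`. -/
theorem ProjHermitian.projCongr_diag (h : IsNormInvolution σ) {X : Matrix (Fin 2) (Fin 2) F}
    (hX : ProjHermitian σ X) (hdet : X.det ≠ 0) {δ : F} (hδ : δ ≠ 0) (hσδ : σ δ = -δ) :
    ProjCongr σ X !![1, 0; 0, 1] ∨ ProjCongr σ X !![1, 0; 0, δ ^ 2] := by
  obtain ⟨l, hl, hH⟩ := hX
  have hX0 : l • X ≠ 0 := by
    intro H
    rw [(smul_eq_zero.1 H).resolve_left hl] at hdet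
    simp at hdet
  obtain ⟨A, hA, a, b, e, ha, hAX⟩ := exists_congruent_upper_of_ne_zero h hX0
  have hT : sigmaTranspose σ !![a, b; 0, e] = !![a, b; 0, e] := by
    rw [← hAX, sigmaTranspose_mul, sigmaTranspose_mul, hH, sigmaTranspose_invol h,
      Matrix.mul_assoc]
  have hσa : σ a = a := by simpa [sigmaTranspose] using congrFun (congrFun hT 0) 0
  have hσe : σ e = e := by simpa [sigmaTranspose] using congrFun (congrFun hT 1) 1
  have hb : b = 0 := by simpa [sigmaTranspose] using (congrFun (congrFun hT 0) 1).symm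
  subst hb
  have he : e ≠ 0 := by
    rintro rfl
    have := det_congruent (σ := σ) (l • X) hA
    rw [hAX] at this
    simp [hl, hdet] at this
  have h1 : ProjCongr σ X !![a, 0; 0, e] :=
    (ProjCongr.smul X hl).trans (hAX ▸ ProjCongr.congruent (σ := σ) (l • X) hA)
  have key : ∀ t s : F, t ≠ 0 → σ t = t → e = a * s * t ^ 2 →
      ProjCongr σ !![a, 0; 0, e] !![1, 0; 0, s] := by
    intro t s ht hσt hs
    obtain ⟨m, hm⟩ := h.norm_surj t hσt
    have hm0 : m ≠ 0 := by rintro rfl; simp at hm; exact ht hm.symm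
    have hσm : σ m ≠ 0 := by simpa using hm0
    refine ⟨!![m, 0; 0, m⁻¹], (a * t)⁻¹, by simp [hm0], inv_ne_zero (mul_ne_zero ha ht), ?_⟩
    ext i j
    fin_cases i <;> fin_cases j <;> simp [sigmaTranspose, Matrix.mul_apply, Fin.sum_univ_two]
    · field_simp; rw [← hm]; ring
    · rw [hs, ← hm]; field_simp
  obtain ⟨y, hy⟩ := h.sq_of_fixed (e / a) (by rw [map_div₀, hσa, hσe])
  have hy0 : y ≠ 0 := by
    rintro rfl
    exact div_ne_zero he ha (by rw [← hy]; simp)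
  have hσy : σ y ^ 2 = y ^ 2 := by rw [← map_pow, hy, map_div₀, hσa, hσe]
  rw [eq_div_iff ha] at hy
  rcases sq_eq_sq_iff_eq_or_eq_neg.1 hσy with H | H
  · exact .inl (h1.trans (key y 1 hy0 H (by rw [← hy]; ring)))
  · refine .inr (h1.trans (key (y / δ) _ (div_ne_zero hy0 hδ) ?_ ?_))
    · rw [map_div₀, H, hσδ, neg_div_neg_eq]
    · rw [← hy]; field_simp

/-- Every form of rank one is projectively congruent to one of two normal forms. -/
theorem projCongr_of_det_eq_zero (h : IsNormInvolution σ) {X : Matrix (Fin 2) (Fin 2) F}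
    (hX : X ≠ 0) (hdet : X.det = 0) :
    ProjCongr σ X !![1, 0; 0, 0] ∨ ProjCongr σ X !![0, 1; 0, 0] := by
  obtain ⟨A, hA, a, b, e, ha, hAX⟩ := exists_congruent_upper_of_ne_zero h hX
  have he : e = 0 := by
    have := det_congruent (σ := σ) X hA
    rw [hAX, hdet] at this
    simpa [ha] using this
  subst he
  have h1 : ProjCongr σ X !![a, b; 0, 0] := hAX ▸ ProjCongr.congruent (σ := σ) X hA
  by_cases hb : b = 0
  · refine .inl (h1.trans ⟨1, a⁻¹, by simp, inv_ne_zero ha, ?_⟩)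
    ext i j
    fin_cases i <;> fin_cases j <;> simp [sigmaTranspose_one, ha, hb]
  · refine .inr (h1.trans ⟨!![1, 0; -a / b, 1], b⁻¹, by simp, inv_ne_zero hb, ?_⟩)
    ext i j
    fin_cases i <;> fin_cases j <;>
      simp [sigmaTranspose, Matrix.mul_apply, Fin.sum_univ_two, hb]
    field_simp
    simp

/-- Every pair of invariants is attained by a form that is not projectively Hermitian. -/
theorem exists_upper_mixedDet_eq (h : IsNormInvolution σ) {d k : F} (hd : d ≠ 0) (hk : σ k = k) :
    ∃ c b, c ≠ 0 ∧ b ≠ 0 ∧ mixedDet σ !![c, b; 0, d / c] = k := by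
  have hσd : σ d ≠ 0 := by simpa using hd
  obtain ⟨c, hc, hck⟩ : ∃ c, c ≠ 0 ∧ d * σ c / c + σ d * c / σ c ≠ k := by
    obtain ⟨g, hg, hg2⟩ := h.exists_sq_ne
    have hσg : σ g ≠ 0 := by simpa using hg
    by_contra! H
    have h0 := H 1 one_ne_zero
    have h1 := H g hg
    have h2 := H (g ^ 2) (pow_ne_zero _ hg)
    simp only [map_one, map_pow] at h0 h1 h2
    set w := σ g / g with hw
    have hσg' : σ g = w * g := by rw [hw]; field_simp
    have hw0 : w ≠ 0 := div_ne_zero hσg hg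
    have hw2 : w ^ 2 - 1 ≠ 0 := by
      intro H
      apply hg2
      rw [hσg']
      linear_combination g ^ 2 * H
    have hw1 : w - 1 ≠ 0 := fun hw1 => hw2 (by linear_combination (w + 1) * hw1)
    rw [hσg'] at h1 h2
    field_simp at h0 h1 h2
    have e1 : d * (w + 1) = k := by
      apply mul_right_cancel₀ hw1
      linear_combination h1 - h0
    have e2 : d * w * (w + 1) = k := by
      apply mul_right_cancel₀ (mul_ne_zero hw0 hw1)
      linear_combination h2 - h1
    have e3 : d * (w ^ 2 - 1) = 0 := by linear_combination e2 - e1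
    exact (mul_ne_zero hd hw2) e3
  have hσc : σ c ≠ 0 := by simpa using hc
  obtain ⟨b, hb⟩ := h.norm_surj (d * σ c / c + σ d * c / σ c - k) (by
    simp only [map_sub, map_add, map_div₀, map_mul, h.invol, hk]; ring)
  refine ⟨c, b, hc, ?_, ?_⟩
  · rintro rfl
    apply hck
    rw [zero_mul] at hb
    exact (sub_eq_zero.1 hb.symm)
  · simp [mixedDet]
    rw [hb]
    ring

theorem not_projCongr_diag (h : IsNormInvolution σ) {δ : F} (hδ : δ ≠ 0) (hσδ : σ δ = -δ) :
    ¬ ProjCongr σ !![1, 0; 0, 1] !![1, 0; 0, δ ^ 2] := by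
  intro H
  obtain ⟨l, hl, h1, h2⟩ := H.invariants h
  simp [mixedDet, hσδ] at h1 h2
  have h4 : 4 * δ ^ 2 = 0 := by
    rcases sq_eq_sq_iff_eq_or_eq_neg.1 h1 with rfl | rfl
    · rw [hσδ] at h2; linear_combination h2
    · have hσl : σ l = - l := neg_eq_iff_eq_neg.1 (by simpa using hσδ)
      rw [hσl] at h2; linear_combination h2
  have : (2 * 2 : F) * δ ^ 2 ≠ 0 := mul_ne_zero (mul_ne_zero h.two_ne h.two_ne) (pow_ne_zero _ hδ)
  apply this
  linear_combination h4

theorem ProjCongr.det_eq_zero_iff (h : IsNormInvolution σ) {X Y : Matrix (Fin 2) (Fin 2) F}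
    (hXY : ProjCongr σ X Y) : Y.det = 0 ↔ X.det = 0 := by
  obtain ⟨l, hl, h1, -⟩ := hXY.invariants h
  simp [h1, hl]

theorem ProjCongr.projHermitian_iff (h : IsNormInvolution σ) {X Y : Matrix (Fin 2) (Fin 2) F}
    (hXY : ProjCongr σ X Y) : ProjHermitian σ Y ↔ ProjHermitian σ X :=
  ⟨hXY.symm.projHermitian h, hXY.projHermitian h⟩

theorem projHermitian_diag {d : F} (hd : σ d = d) : ProjHermitian σ !![1, 0; 0, d] := by
  refine ⟨1, one_ne_zero, ?_⟩
  ext i j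
  fin_cases i <;> fin_cases j <;> simp [sigmaTranspose, hd]

/-- A system of representatives of the nonzero sesquilinear forms in two variables up to
projective congruence. -/
theorem exists_normalForms (h : IsNormInvolution σ) {ν δ : F} (hν : ¬ IsSquare ν)
    (hsq : ∀ x : F, IsSquare x ∨ IsSquare (x / ν)) (hδ : δ ≠ 0) (hσδ : σ δ = -δ) :
    ∃ R : ({x : F // σ x = x} × Bool) ⊕ Fin 4 → Matrix (Fin 2) (Fin 2) F,
      (∀ t, R t ≠ 0) ∧ (∀ X, X ≠ 0 → ∃ t, ProjCongr σ X (R t)) ∧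
      ∀ s t, ProjCongr σ (R s) (R t) → s = t := by
  have hν0 : ν ≠ 0 := by rintro rfl; exact hν (IsSquare.zero)
  let d : Bool → F := fun i => cond i 1 ν
  have hd : ∀ i, d i ≠ 0 := by rintro (_ | _) <;> simp [d, hν0]
  have hex : ∀ (k : {x : F // σ x = x}) (i : Bool), ∃ c b, c ≠ 0 ∧ b ≠ 0 ∧
      mixedDet σ !![c, b; 0, d i / c] = k := fun k i => exists_upper_mixedDet_eq h (hd i) k.2
  choose c b hc hb hm using hex
  let Q : {x : F // σ x = x} → Bool → Matrix (Fin 2) (Fin 2) F :=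
    fun k i => !![c k i, b k i; 0, d i / c k i]
  let S : Fin 4 → Matrix (Fin 2) (Fin 2) F :=
    ![!![1, 0; 0, 0], !![0, 1; 0, 0], !![1, 0; 0, 1], !![1, 0; 0, δ ^ 2]]
  have hQdet : ∀ k i, (Q k i).det = d i := fun k i => by
    simp only [Q, Matrix.det_fin_two_of]; have := hc k i; field_simp; ring
  have hQdet0 : ∀ k i, (Q k i).det ≠ 0 := fun k i => by rw [hQdet]; exact hd i
  have hQherm : ∀ k i, ¬ ProjHermitian σ (Q k i) := fun k i => not_projHermitian_upper (hb k i)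
  have hS0 : (S 0).det = 0 := by simp [S]
  have hS1 : (S 1).det = 0 := by simp [S]
  have hS2 : (S 2).det ≠ 0 := by simp [S]
  have hS3 : (S 3).det ≠ 0 := by simp [S, hδ]
  have hS0' : ProjHermitian σ (S 0) := projHermitian_diag (map_zero σ)
  have hS1' : ¬ ProjHermitian σ (S 1) := not_projHermitian_upper one_ne_zero
  have hS2' : ProjHermitian σ (S 2) := projHermitian_diag (map_one σ)
  have hS3' : ProjHermitian σ (S 3) := projHermitian_diag (by rw [map_pow, hσδ, neg_sq])
  have hS23 : ¬ ProjCongr σ (S 2) (S 3) := not_projCongr_diag h hδ hσδ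
  have hQS : ∀ k i j, ¬ ProjCongr σ (Q k i) (S j) := by
    intro k i j H
    have h1 := H.det_eq_zero_iff h
    have h2 := H.projHermitian_iff h
    have h3 := hQdet0 k i
    have h4 := hQherm k i
    fin_cases j <;> simp_all
  have hSS : ∀ i j, ProjCongr σ (S i) (S j) → i = j := by
    intro i j H
    have h1 := H.det_eq_zero_iff h
    have h2 := H.projHermitian_iff h
    have h3 := H.symm
    fin_cases i <;> fin_cases j <;> simp_all
  have hQQ : ∀ k i k' i', ProjCongr σ (Q k i) (Q k' i') → k = k' ∧ i = i' := by
    intro k i k' i' H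
    obtain ⟨l, hl, h1, h2⟩ := H.invariants h
    have hm1 : mixedDet σ (Q k i) = k := hm k i
    have hm2 : mixedDet σ (Q k' i') = k' := hm k' i'
    rw [hQdet, hQdet] at h1
    rw [hm1, hm2] at h2
    have hi : i = i' := by
      cases i <;> cases i' <;> simp only [d, cond_true, cond_false] at h1 ⊢
      · exact (hν ⟨l⁻¹, by field_simp; linear_combination -h1⟩).elim
      · exact (hν ⟨l, by linear_combination h1⟩).elim
    subst hi
    refine ⟨?_, rfl⟩
    have hl2 : l ^ 2 = 1 := by
      apply mul_right_cancel₀ (hd i)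
      linear_combination -h1
    have hl1 : l * σ l = 1 := by
      rcases sq_eq_sq_iff_eq_or_eq_neg.1 (hl2.trans (one_pow 2).symm) with rfl | rfl <;> simp
    rw [hl1, one_mul] at h2
    exact Subtype.ext h2.symm
  refine ⟨Sum.elim (fun t => Q t.1 t.2) S, ?_, ?_, ?_⟩
  · rintro (⟨k, i⟩ | j)
    · intro H
      apply hQdet0 k i
      simp only [Sum.elim_inl] at H
      rw [H]; simp
    · intro H
      simp only [Sum.elim_inr] at H
      fin_cases j
      · simpa [S] using congrFun (congrFun H 0) 0
      · simpa [S] using congrFun (congrFun H 0) 1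
      · simpa [S] using congrFun (congrFun H 0) 0
      · simpa [S] using congrFun (congrFun H 0) 0
  · intro X hX
    by_cases hdet : X.det = 0
    · rcases projCongr_of_det_eq_zero h hX hdet with H | H
      · exact ⟨.inr 0, H⟩
      · exact ⟨.inr 1, H⟩
    by_cases hH : ProjHermitian σ X
    · rcases hH.projCongr_diag h hdet hδ hσδ with H | H
      · exact ⟨.inr 2, H⟩
      · exact ⟨.inr 3, H⟩
    obtain ⟨i, r, hr⟩ : ∃ i, ∃ r, X.det = r ^ 2 * d i := by
      rcases hsq X.det with ⟨r, hr⟩ | ⟨r, hr⟩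
      · exact ⟨true, r, by simp [d, hr, sq]⟩
      · refine ⟨false, r, ?_⟩
        rw [div_eq_iff hν0] at hr
        simp [d, hr, sq]
    have hr0 : r ≠ 0 := by rintro rfl; simp at hr; exact hdet hr
    have h1 : ProjCongr σ X (r⁻¹ • X) := ProjCongr.smul X (inv_ne_zero hr0)
    have hk : σ (mixedDet σ (r⁻¹ • X)) = mixedDet σ (r⁻¹ • X) := by
      simp [mixedDet, h.invol]; ring
    refine ⟨.inl (⟨_, hk⟩, i), h1.trans ?_⟩
    refine projCongr_of_invariants h (fun H => hH (h1.symm.projHermitian h H)) (hc _ _) (hb _ _)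
      ?_ (hm ⟨_, hk⟩ i).symm
    rw [Matrix.det_smul, hr]
    simp
    field_simp
  · rintro (⟨k, i⟩ | j) (⟨k', i'⟩ | j') H
    · obtain ⟨rfl, rfl⟩ := hQQ _ _ _ _ H
      rfl
    · exact absurd H (hQS _ _ _)
    · exact absurd H.symm (hQS _ _ _)
    · rw [hSS _ _ H]

end Congruence

section FiniteFields

theorem IsCyclic.exists_pow_eq_of_pow_eq_one {G : Type*} [Group G] [IsCyclic G] {a b : ℕ}
    (ha : 0 < a) (hG : Nat.card G = a * b) {x : G} (hx : x ^ a = 1) : ∃ y : G, y ^ b = x := by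
  obtain ⟨g, hg⟩ := IsCyclic.exists_generator (α := G)
  obtain ⟨k, rfl⟩ := Subgroup.mem_zpowers_iff.1 (hg x)
  have hord : orderOf g = a * b := by rw [orderOf_eq_card_of_forall_mem_zpowers hg, hG]
  rw [← zpow_natCast, ← _root_.zpow_mul, ← orderOf_dvd_iff_zpow_eq_one, hord] at hx
  have hb : (b : ℤ) ∣ k := by
    push_cast at hx
    rw [mul_comm k] at hx
    exact Int.dvd_of_mul_dvd_mul_left (by exact_mod_cast ha.ne') hx
  obtain ⟨m, rfl⟩ := hb
  exact ⟨g ^ m, by rw [← zpow_natCast, ← _root_.zpow_mul, mul_comm]⟩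

theorem exists_pow_eq_of_pow_eq_one {F : Type*} [Field F] [Fintype F] {a b : ℕ} (ha : 0 < a)
    (hF : Fintype.card F = a * b + 1)
    {x : F} (hx : x ^ a = 1) : ∃ y : F, y ^ b = x := by
  have hcard : Nat.card Fˣ = a * b := by
    rw [Nat.card_units, Nat.card_eq_fintype_card, hF]; simp
  have hx0 : x ≠ 0 := by rintro rfl; simp [ha.ne'] at hx
  obtain ⟨y, hy⟩ := IsCyclic.exists_pow_eq_of_pow_eq_one ha hcard (x := Units.mk0 x hx0)
    (by ext; simpa using hx)
  exact ⟨y, by simpa using congrArg Units.val hy⟩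

theorem pow_sub_one_eq_one_of_fixed {F : Type*} [Field F] {q : ℕ} (hq : 1 ≤ q) {x : F}
    (hx0 : x ≠ 0) (hx : x ^ q = x) :
    x ^ (q - 1) = 1 := by
  apply mul_right_cancel₀ hx0
  rw [← pow_succ, Nat.sub_add_cancel hq, hx, one_mul]

theorem exists_primitiveRoot_of_card {F : Type*} [Field F] [Fintype F] {a b : ℕ} (ha : 0 < a)
    (hb : 0 < b)
    (hF : Fintype.card F = a * b + 1) : ∃ g : F, IsPrimitiveRoot g a := by
  obtain ⟨g, hg⟩ := IsCyclic.exists_generator (α := Fˣ)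
  have hord : orderOf g = a * b := by
    rw [orderOf_eq_card_of_forall_mem_zpowers hg, Nat.card_units, Nat.card_eq_fintype_card, hF]
    simp
  refine ⟨(g : F) ^ b, ?_⟩
  have := (IsPrimitiveRoot.orderOf g).map_of_injective (f := Units.coeHom F) Units.val_injective
  rw [hord] at this
  exact this.pow (Nat.mul_pos ha hb) (mul_comm a b)

theorem card_eq_sub_one_mul_add_one {F : Type*} [Fintype F] {q : ℕ} (hq : 1 ≤ q)
    (hF : Fintype.card F = q ^ 2) :
    Fintype.card F = (q - 1) * (q + 1) + 1 := by
  obtain ⟨k, rfl⟩ := Nat.exists_eq_add_of_le hq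
  rw [hF, Nat.add_sub_cancel_left]; ring

theorem card_fixed_pow {F : Type*} [Field F] [Fintype F] {q : ℕ} (hq : 2 ≤ q)
    (hF : Fintype.card F = q ^ 2) :
    Nat.card {x : F // x ^ q = x} = q := by
  classical
  obtain ⟨g, hg⟩ := exists_primitiveRoot_of_card (a := q - 1) (b := q + 1) (by omega) (by omega)
    (card_eq_sub_one_mul_add_one (by omega) hF)
  have hset : {x : F | x ^ q = x} =
      ((insert 0 (Polynomial.nthRootsFinset (q - 1) (1 : F)) : Finset F) : Set F) := by
    ext x
    simp only [Set.mem_ofPred_eq, Finset.coe_insert, Set.mem_insert_iff, Finset.mem_coe,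
      Polynomial.mem_nthRootsFinset (show 0 < q - 1 by omega)]
    constructor
    · intro hx
      by_cases hx0 : x = 0
      · exact .inl hx0
      · exact .inr (pow_sub_one_eq_one_of_fixed (by omega) hx0 hx)
    · rintro (rfl | hx)
      · exact zero_pow (by omega)
      · calc x ^ q = x ^ (q - 1) * x := by rw [← pow_succ, Nat.sub_add_cancel (by omega)]
          _ = x := by rw [hx, one_mul]
  have h0 : (0 : F) ∉ Polynomial.nthRootsFinset (q - 1) (1 : F) := by
    rw [Polynomial.mem_nthRootsFinset (show 0 < q - 1 by omega), zero_pow (by omega)]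
    exact zero_ne_one
  change Nat.card ({x : F | x ^ q = x} : Set F) = q
  rw [Nat.card_coe_set_eq, hset, Set.ncard_coe_finset, Finset.card_insert_of_notMem h0,
    hg.card_nthRootsFinset]
  omega

theorem isNormInvolution_of_card {F : Type*} [Field F] [Fintype F] {q : ℕ} {σ : F →+* F}
    (hσ : ∀ x, σ x = x ^ q) (hodd : Odd q) (hq : 3 ≤ q) (hF : Fintype.card F = q ^ 2) :
    IsNormInvolution σ := by
  have hcard := card_eq_sub_one_mul_add_one (by omega) hF
  have two_ne : (2 : F) ≠ 0 := by
    refine Ring.two_ne_zero fun H => ?_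
    have := FiniteField.even_card_of_char_two H
    rw [hF, Nat.odd_iff.1 hodd.pow] at this
    exact one_ne_zero this
  have norm_surj : ∀ x, σ x = x → ∃ y, y * σ y = x := by
    intro x hx
    rw [hσ] at hx
    by_cases hx0 : x = 0
    · exact ⟨0, by simp [hx0]⟩
    obtain ⟨y, hy⟩ := exists_pow_eq_of_pow_eq_one (by omega) hcard
      (pow_sub_one_eq_one_of_fixed (by omega) hx0 hx)
    exact ⟨y, by rw [hσ, ← hy]; ring⟩
  obtain ⟨m, hm⟩ := hodd
  refine ⟨fun x => ?_, two_ne, norm_surj, fun x hx => ?_, fun x hx => ?_, ?_⟩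
  · rw [hσ, hσ, ← pow_mul, ← sq, ← hF, FiniteField.pow_card]
  · obtain ⟨y, rfl⟩ := norm_surj x hx
    refine ⟨y ^ (m + 1), ?_⟩
    rw [hσ, hm]; ring
  · obtain ⟨y, rfl⟩ := exists_pow_eq_of_pow_eq_one (a := q + 1) (b := q - 1) (by omega)
      (by rw [hcard, mul_comm]) (x := x) (by rw [hσ] at hx; rw [← hx]; ring)
    refine ⟨y ^ m, ?_⟩
    rw [← pow_mul]; congr 1; omega
  · obtain ⟨g, hg⟩ := exists_primitiveRoot_of_card (F := F) (a := (q - 1) * (q + 1)) (b := 1)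
      (Nat.mul_pos (by omega) (by omega)) one_pos (by rw [hcard, mul_one])
    have hpos : 0 < (q - 1) * (q + 1) := Nat.mul_pos (by omega) (by omega)
    have hg0 : g ≠ 0 := hg.ne_zero hpos.ne'
    refine ⟨g, hg0, fun H => ?_⟩
    rw [hσ, ← pow_mul] at H
    have h2 : 2 < (q - 1) * (q + 1) := by nlinarith [Nat.sub_add_cancel (show 1 ≤ q by omega)]
    have h3 : g ^ (2 * (q - 1)) = 1 := by
      apply mul_right_cancel₀ (pow_ne_zero 2 hg0)
      rw [← pow_add, one_mul, ← H]; congr 1; omega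
    refine hg.pow_ne_one_of_pos_of_lt (by omega) ?_ h3
    rw [mul_comm]
    exact Nat.mul_lt_mul_of_pos_left (by omega) (by omega)

theorem exists_neg_fixed {F : Type*} [Field F] [Fintype F] {q : ℕ} (hodd : Odd q) (hq : 3 ≤ q)
    (hF : Fintype.card F = q ^ 2) :
    ∃ δ : F, δ ≠ 0 ∧ δ ^ q = -δ := by
  have hcard := card_eq_sub_one_mul_add_one (by omega) hF
  obtain ⟨δ, hδ⟩ := exists_pow_eq_of_pow_eq_one (F := F) (a := q + 1) (b := q - 1) (by omega)
    (by rw [hcard, mul_comm]) (x := -1) (hodd.add_one.neg_one_pow)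
  refine ⟨δ, ?_, ?_⟩
  · rintro rfl
    rw [zero_pow (by omega)] at hδ
    simp at hδ
  · rw [← Nat.sub_add_cancel (show 1 ≤ q by omega), pow_succ, hδ, neg_one_mul]

theorem FiniteField.exists_nonsquare_isSquare_or_isSquare_div {F : Type*} [Field F] [Fintype F]
    (h2 : (2 : F) ≠ 0) :
    ∃ ν : F, ¬ IsSquare ν ∧ ∀ x : F, IsSquare x ∨ IsSquare (x / ν) := by
  have hchar : ringChar F ≠ 2 := fun H => h2 (by
    have := ringChar.Nat.cast_ringChar (R := F); rw [H] at this; exact_mod_cast this)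
  obtain ⟨ν, hν⟩ := FiniteField.exists_nonsquare hchar
  have hν0 : ν ≠ 0 := by rintro rfl; exact hν IsSquare.zero
  refine ⟨ν, hν, fun x => or_iff_not_imp_left.2 fun hx => ?_⟩
  have hx0 : x ≠ 0 := by rintro rfl; exact hx IsSquare.zero
  have neg : ∀ y : F, y ≠ 0 → ¬ IsSquare y → y ^ (Fintype.card F / 2) = -1 := fun y hy h =>
    (FiniteField.pow_dichotomy hchar hy).resolve_left fun H =>
      h ((FiniteField.isSquare_iff hchar hy).2 H)
  rw [FiniteField.isSquare_iff hchar (div_ne_zero hx0 hν0), div_pow, neg x hx0 hx, neg ν hν0 hν]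
  simp

end FiniteFields

section Orbits
variable {F : Type*} [Field F] {σ : F →+* F} {q : ℕ}

/-- The `2 × 2` matrix with the entries of a vector of length four. -/
def vecToMat {F : Type*} (v : Fin 4 → F) : Matrix (Fin 2) (Fin 2) F := !![v 0, v 1; v 2, v 3]

theorem vecToMat_injective {F : Type*} : Function.Injective (vecToMat (F := F)) := by
  intro v w h
  ext i
  fin_cases i
  · exact congrFun (congrFun h 0) 0
  · exact congrFun (congrFun h 0) 1
  · exact congrFun (congrFun h 1) 0
  · exact congrFun (congrFun h 1) 1

theorem vecToMat_surjective {F : Type*} : Function.Surjective (vecToMat (F := F)) := fun X =>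
  ⟨![X 0 0, X 0 1, X 1 0, X 1 1], by ext i j; fin_cases i <;> fin_cases j <;> rfl⟩

theorem vecToMat_smul (l : F) (v : Fin 4 → F) : vecToMat (l • v) = l • vecToMat v := by
  ext i j; fin_cases i <;> fin_cases j <;> rfl

theorem vecToMat_zero : vecToMat (0 : Fin 4 → F) = 0 := by
  ext i j; fin_cases i <;> fin_cases j <;> rfl

theorem vecToMat_ne_zero {v : Fin 4 → F} : vecToMat v ≠ 0 ↔ v ≠ 0 := by
  rw [← vecToMat_zero, vecToMat_injective.ne_iff]

theorem vecToMat_vecMul_kron (hσ : ∀ x, σ x = x ^ q) (A : Matrix (Fin 2) (Fin 2) F)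
    (v : Fin 4 → F) :
    vecToMat (vecMul v (kron (matq q A) A)) = sigmaTranspose σ A * vecToMat v * A := by
  ext i j
  fin_cases i <;> fin_cases j <;>
    simp [vecToMat, vecMul, dotProduct, kron, matq, sigmaTranspose, Matrix.mul_apply,
      Fin.sum_univ_two, Fin.sum_univ_four, hσ] <;> ring

theorem mk_mem_Korb_iff (hσ : ∀ x, σ x = x ^ q) {v w : Fin 4 → F} (hv : v ≠ 0) (hw : w ≠ 0) :
    Projectivization.mk F w hw ∈ Korb q (Projectivization.mk F v hv) ↔
      ProjCongr σ (vecToMat v) (vecToMat w) := by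
  constructor
  · rintro ⟨A, hA, v', hv', hw', h1, h2⟩
    obtain ⟨a, rfl⟩ := (Projectivization.mk_eq_mk_iff' F _ _ hv hv').1 h1
    obtain ⟨b, rfl⟩ := (Projectivization.mk_eq_mk_iff' F _ _ hw hw').1 h2
    have ha : a ≠ 0 := by rintro rfl; simp at hv
    have hb : b ≠ 0 := by rintro rfl; simp at hw
    rw [vecToMat_smul, vecToMat_smul, vecToMat_vecMul_kron hσ]
    exact (ProjCongr.smul _ ha).symm.trans ((ProjCongr.congruent _ hA).trans (ProjCongr.smul _ hb))
  · rintro ⟨A, l, hA, hl, h⟩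
    rw [← vecToMat_vecMul_kron hσ, ← vecToMat_smul] at h
    have h := vecToMat_injective h
    have hw' : vecMul v (kron (matq q A) A) ≠ 0 := by
      intro H; rw [H, smul_zero] at h; exact hw h
    exact ⟨A, hA, v, hv, hw', rfl, (Projectivization.mk_eq_mk_iff' F _ _ hw hw').2 ⟨l, h.symm⟩⟩

theorem Korb_mk_eq_iff (hσ : ∀ x, σ x = x ^ q) {v w : Fin 4 → F} (hv : v ≠ 0) (hw : w ≠ 0) :
    Korb q (Projectivization.mk F v hv) = Korb q (Projectivization.mk F w hw) ↔
      ProjCongr σ (vecToMat v) (vecToMat w) := by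
  constructor
  · intro h
    rw [← mk_mem_Korb_iff hσ hv hw, h, mk_mem_Korb_iff hσ hw hw]
    exact ProjCongr.refl _
  · intro h
    ext P
    induction P using Projectivization.ind with
    | h u hu =>
      rw [mk_mem_Korb_iff hσ hv hu, mk_mem_Korb_iff hσ hw hu]
      exact ⟨h.symm.trans, h.trans⟩

end Orbits

/-- Proposition 2.7 (count): `K ≅ PSL(2,q²)` has exactly `2q + 4` orbits on the
    points of `PG(3,q²)`. -/
theorem stmt8 {F : Type*} [Field F] [Fintype F] (p n q : ℕ) (hp : p.Prime)
    (hodd : Odd p) (hn : 0 < n) (hq : q = p ^ n) (hF : Fintype.card F = q ^ 2) :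
    {S : Set (PGPoint F) | ∃ P : PGPoint F, S = Korb q P}.ncard = 2 * q + 4 := by
  have hq_odd : Odd q := hq ▸ hodd.pow
  have hq3 : 3 ≤ q := by
    have h1 : p ≤ p ^ n := Nat.le_self_pow hn.ne' p
    have h2 := hp.two_le
    obtain ⟨m, hm⟩ := hodd
    omega
  have : Fact p.Prime := ⟨hp⟩
  have : CharP F p := charP_of_card_eq_prime_pow (f := n * 2) (by rw [hF, hq, pow_mul])
  have hσ : ∀ x, iterateFrobenius F p n x = x ^ q := fun x => by rw [iterateFrobenius_def, hq]
  have h := isNormInvolution_of_card hσ hq_odd hq3 hF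
  obtain ⟨δ, hδ, hσδ⟩ := exists_neg_fixed hq_odd hq3 hF
  obtain ⟨ν, hν, hsq⟩ := FiniteField.exists_nonsquare_isSquare_or_isSquare_div h.two_ne
  obtain ⟨R, hR0, hR, hRinj⟩ := exists_normalForms h hν hsq hδ ((hσ δ).trans hσδ)
  choose r hr using fun t => vecToMat_surjective (R t)
  have hr0 : ∀ t, r t ≠ 0 := fun t => vecToMat_ne_zero.1 (hr t ▸ hR0 t)
  have hrange : {S : Set (PGPoint F) | ∃ P : PGPoint F, S = Korb q P} =
      Set.range fun t => Korb q (Projectivization.mk F (r t) (hr0 t)) := by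
    ext S
    constructor
    · rintro ⟨P, rfl⟩
      induction P using Projectivization.ind with
      | h v hv =>
        obtain ⟨t, ht⟩ := hR (vecToMat v) (vecToMat_ne_zero.2 hv)
        exact ⟨t, (Korb_mk_eq_iff hσ _ _).2 (by rw [hr]; exact ht.symm)⟩
    · rintro ⟨t, rfl⟩
      exact ⟨_, rfl⟩
  have hfix : Nat.card {x : F // iterateFrobenius F p n x = x} = q := by
    simp only [hσ]
    exact card_fixed_pow (by omega) hF
  rw [hrange, Set.ncard_range_of_injective, Nat.card_sum, Nat.card_prod, hfix]
  · simp [mul_comm]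
  · intro s t hst
    have := (Korb_mk_eq_iff hσ _ _).1 hst
    rw [hr, hr] at this
    exact hRinj s t this
end
end

section
/- Let q be an odd prime power and let ℓ be a line of PG(3,q²) having exactly q+1 points in the Baer subgeometry Σ (an 'extended subline of Σ'). (i) For j ∈ {1,…,q}\{(q+1)/2}: if ℓ contains a point of S_j \ O, then |ℓ ∩ O| = 2 and |ℓ ∩ (S_j \ O)| = q − 1. (ii) For k ∈ {1,…,q−2}\{(q−1)/2}: if ℓ contains a point of E_k \ O, then |ℓ ∩ O| = 0 and |ℓ ∩ E_k| = q + 1. -/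
noncomputable section

open Matrix

/-- The quadratic form `X₁X₄ − X₂X₃`. -/
def quadForm {F : Type*} [Field F] (x : Fin 4 → F) : F := x 0 * x 3 - x 1 * x 2

/-- The polar form of `quadForm`. -/
def polarForm {F : Type*} [Field F] (x y : Fin 4 → F) : F :=
  x 0 * y 3 + x 3 * y 0 - x 1 * y 2 - x 2 * y 1

/-- The semilinear involution whose fixed points are the vectors `(a, b, φ b, c)` with `a`, `c`
fixed by `φ`. -/
def baerConj {F : Type*} [Field F] (φ : F →+* F) (x : Fin 4 → F) : Fin 4 → F :=
  ![φ (x 0), φ (x 2), φ (x 1), φ (x 3)]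

/-- Linear independence of two vectors. -/
def PairIndep {F : Type*} [Field F] (u v : Fin 4 → F) : Prop :=
  ∀ a b : F, a • u + b • v = 0 → a = 0 ∧ b = 0

section Forms

variable {F : Type*} [Field F]

lemma quadForm_comb (a b : F) (u v : Fin 4 → F) :
    quadForm (a • u + b • v) =
      a ^ 2 * quadForm u + a * b * polarForm u v + b ^ 2 * quadForm v := by
  simp only [quadForm, polarForm, Pi.add_apply, Pi.smul_apply, smul_eq_mul]
  ring

lemma polarForm_comb (a b c d : F) (u v w z : Fin 4 → F) :
    polarForm (a • u + b • v) (c • w + d • z) =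
      a * c * polarForm u w + a * d * polarForm u z
        + b * c * polarForm v w + b * d * polarForm v z := by
  simp only [polarForm, Pi.add_apply, Pi.smul_apply, smul_eq_mul]
  ring

lemma polarForm_self (u : Fin 4 → F) : polarForm u u = 2 * quadForm u := by
  simp only [polarForm, quadForm]
  ring

lemma polarForm_comm (u v : Fin 4 → F) : polarForm u v = polarForm v u := by
  simp only [polarForm]
  ring

lemma polarForm_comb_left (a b : F) (u v w : Fin 4 → F) :
    polarForm (a • u + b • v) w = a * polarForm u w + b * polarForm v w := by
  simp only [polarForm, Pi.add_apply, Pi.smul_apply, smul_eq_mul]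
  ring

variable (φ : F →+* F)

lemma baerConj_comb (a b : F) (u v : Fin 4 → F) :
    baerConj φ (a • u + b • v) = φ a • baerConj φ u + φ b • baerConj φ v := by
  ext i
  fin_cases i <;> simp [baerConj]

lemma quadForm_baerConj (u : Fin 4 → F) : quadForm (baerConj φ u) = φ (quadForm u) := by
  simp [quadForm, baerConj]
  ring

lemma polarForm_baerConj (u v : Fin 4 → F) :
    polarForm (baerConj φ u) (baerConj φ v) = φ (polarForm u v) := by
  simp [polarForm, baerConj]
  ring

lemma Fgam_eq_forms {q : ℕ} (hφ : ∀ x, φ x = x ^ q) (γ : F) (x : Fin 4 → F) :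
    Fgam q γ x = polarForm x (baerConj φ x) - γ * quadForm x ^ ((q + 1) / 2) := by
  simp [Fgam, polarForm, quadForm, baerConj, hφ, pow_succ]
  ring

variable {φ}

lemma PairIndep.symm {u v : Fin 4 → F} (h : PairIndep u v) : PairIndep v u := by
  intro a b hab
  have := h b a (by rw [add_comm]; exact hab)
  exact ⟨this.2, this.1⟩

lemma PairIndep.comb_ne_zero {u v : Fin 4 → F} (h : PairIndep u v) {a b : F}
    (hab : a ≠ 0 ∨ b ≠ 0) : a • u + b • v ≠ 0 := by
  intro h0
  have := h a b h0
  tauto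

lemma PairIndep.mem_iff {u v : Fin 4 → F} (h : PairIndep u v)
    {W : Submodule F (Fin 4 → F)} (hW : Module.finrank F W = 2) (hu : u ∈ W) (hv : v ∈ W)
    (x : Fin 4 → F) : x ∈ W ↔ ∃ a b : F, a • u + b • v = x := by
  have hli : LinearIndependent F ![u, v] := LinearIndependent.pair_iff.2 h
  have hspan : Submodule.span F {u, v} = W := by
    apply Submodule.eq_of_le_of_finrank_eq
    · rw [Submodule.span_le]
      rintro y (rfl | rfl)
      exacts [hu, hv]
    · have := finrank_span_eq_card hli
      rw [Matrix.range_cons_cons_empty] at this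
      simpa [hW] using this
  rw [← hspan, Submodule.mem_span_pair]

lemma not_pairIndep_of_isotropic {u v : Fin 4 → F} (hu : baerConj φ u = u)
    (hv : baerConj φ v = v) (hQu : quadForm u = 0) (hQv : quadForm v = 0)
    (hB : polarForm u v = 0) : ¬ PairIndep u v := by
  have key : ∀ z : Fin 4 → F, baerConj φ z = z → quadForm z = 0 → z 0 = 0 →
      z 1 = 0 ∧ z 2 = 0 := by
    intro z hz hQ h0
    have h2 : φ (z 1) = z 2 := by simpa [baerConj] using congrFun hz 2
    rw [quadForm, h0, ← h2] at hQ
    have h1 : z 1 = 0 := by simpa using hQ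
    exact ⟨h1, by rw [← h2, h1, map_zero]⟩
  have hu0 : φ (u 0) = u 0 := by simpa [baerConj] using congrFun hu 0
  have hv0 : φ (v 0) = v 0 := by simpa [baerConj] using congrFun hv 0
  intro hind
  by_cases h0 : u 0 = 0 ∧ v 0 = 0
  · obtain ⟨hu1, hu2⟩ := key u hu hQu h0.1
    obtain ⟨hv1, hv2⟩ := key v hv hQv h0.2
    have := hind (v 3) (-u 3) (by
      ext i
      fin_cases i <;> simp [h0, hu1, hu2, hv1, hv2, mul_comm])
    have hz := hind 1 0 (by
      ext i
      have : u 3 = 0 := by simpa using this.2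
      fin_cases i <;> simp [h0, hu1, hu2, this])
    exact one_ne_zero hz.1
  · have hne : v 0 ≠ 0 ∨ -u 0 ≠ 0 := by
      by_contra! h
      exact h0 ⟨by simpa using h.2, h.1⟩
    have hz : v 0 • u + (-u 0) • v ≠ 0 := hind.comb_ne_zero hne
    set z := v 0 • u + (-u 0) • v with hzdef
    have hz0 : z 0 = 0 := by
      simp [hzdef]
      ring
    obtain ⟨hz1, hz2⟩ := key z (by rw [hzdef, baerConj_comb, hu, hv, map_neg, hu0, hv0])
      (by rw [hzdef, quadForm_comb, hQu, hQv, hB]; ring) hz0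
    have hz3 : z 3 ≠ 0 := by
      intro hz3
      apply hz
      ext i
      fin_cases i <;> simp [hz0, hz1, hz2, hz3]
    have hBu : z 3 * u 0 = 0 := by
      have : polarForm z u = 0 := by
        rw [hzdef, polarForm_comb_left, polarForm_self, hQu, polarForm_comm v u, hB]
        ring
      simpa [polarForm, hz0, hz1, hz2] using this
    have hBv : z 3 * v 0 = 0 := by
      have : polarForm z v = 0 := by
        rw [hzdef, polarForm_comb_left, polarForm_self, hQv, hB]
        ring
      simpa [polarForm, hz0, hz1, hz2] using this
    exact h0 ⟨by simpa [hz3] using hBu, by simpa [hz3] using hBv⟩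

/-- A basis of a line whose Baer subline meets the elliptic quadric in two points. -/
structure SecantBasis (φ : F →+* F) (u v : Fin 4 → F) : Prop where
  conj_left : baerConj φ u = u
  conj_right : baerConj φ v = v
  quad_left : quadForm u = 0
  quad_right : quadForm v = 0
  polar : polarForm u v = 1

/-- A basis of a line whose Baer subline meets the elliptic quadric in one point. -/
structure TangentBasis (φ : F →+* F) (u v : Fin 4 → F) : Prop where
  conj_left : baerConj φ u = u
  conj_right : baerConj φ v = v
  quad_left : quadForm u = 0
  quad_right : quadForm v ≠ 0
  polar : polarForm u v = 0

/-- A basis of a line whose Baer subline misses the elliptic quadric. -/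
structure ExternalBasis (φ : F →+* F) (u v : Fin 4 → F) : Prop where
  conj_left : baerConj φ u = v
  conj_right : baerConj φ v = u
  quad_left : quadForm u = 0
  quad_right : quadForm v = 0
  polar : polarForm u v ≠ 0

lemma PairIndep.comb {u v : Fin 4 → F} (h : PairIndep u v) {a b c d : F}
    (hdet : a * d - b * c ≠ 0) : PairIndep (a • u + b • v) (c • u + d • v) := by
  intro s t hst
  obtain ⟨h1, h2⟩ := h (s * a + t * c) (s * b + t * d) (by rw [← hst]; module)
  constructor
  · apply (mul_eq_zero.1 (_ : s * (a * d - b * c) = 0)).resolve_right hdet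
    linear_combination d * h1 - c * h2
  · apply (mul_eq_zero.1 (_ : t * (a * d - b * c) = 0)).resolve_right hdet
    linear_combination a * h2 - b * h1

lemma map_polarForm_of_fixed {u v : Fin 4 → F} (hu : baerConj φ u = u)
    (hv : baerConj φ v = v) : φ (polarForm u v) = polarForm u v := by
  rw [← polarForm_baerConj, hu, hv]

lemma map_quadForm_of_fixed {u : Fin 4 → F} (hu : baerConj φ u = u) :
    φ (quadForm u) = quadForm u := by
  rw [← quadForm_baerConj, hu]

lemma exists_basis_of_isotropic {W : Submodule F (Fin 4 → F)} {u v : Fin 4 → F}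
    (huW : u ∈ W) (hvW : v ∈ W) (hu : baerConj φ u = u) (hv : baerConj φ v = v)
    (hind : PairIndep u v) (hQ : quadForm u = 0) :
    ∃ u ∈ W, ∃ v ∈ W, PairIndep u v ∧ (SecantBasis φ u v ∨ TangentBasis φ u v) := by
  by_cases hB : polarForm u v = 0
  · exact ⟨u, huW, v, hvW, hind, Or.inr ⟨hu, hv, hQ,
      fun hQv => not_pairIndep_of_isotropic hu hv hQ hQv hB hind, hB⟩⟩
  · set B := polarForm u v with hBdef
    set C := quadForm v with hCdef
    have hφB : φ B = B := map_polarForm_of_fixed hu hv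
    have hφC : φ C = C := map_quadForm_of_fixed hv
    refine ⟨u, huW, (-C / B ^ 2) • u + (1 / B) • v,
      W.add_mem (W.smul_mem _ huW) (W.smul_mem _ hvW), ?_, Or.inl ⟨hu, ?_, hQ, ?_, ?_⟩⟩
    · have := hind.comb (a := 1) (b := 0) (c := -C / B ^ 2) (d := 1 / B) (by simpa using hB)
      simpa using this
    · rw [baerConj_comb, hu, hv]
      simp [hφB, hφC]
    · rw [quadForm_comb, hQ, ← hBdef, ← hCdef]
      field_simp
      ring
    · rw [polarForm_comm, polarForm_comb_left, polarForm_self, hQ, polarForm_comm v u, ← hBdef]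
      field_simp
      ring

lemma exists_basis (h2 : (2 : F) ≠ 0) (hinv : ∀ x, φ (φ x) = x)
    (hsq : ∀ D : F, φ D = D → ∃ d, d ^ 2 = D)
    {W : Submodule F (Fin 4 → F)} {u v : Fin 4 → F}
    (huW : u ∈ W) (hvW : v ∈ W) (hu : baerConj φ u = u) (hv : baerConj φ v = v)
    (hind : PairIndep u v) :
    ∃ u ∈ W, ∃ v ∈ W, PairIndep u v ∧
      (SecantBasis φ u v ∨ TangentBasis φ u v ∨ ExternalBasis φ u v) := by
  by_cases hA : quadForm u = 0
  · obtain ⟨u, hu, v, hv, h, h'⟩ := exists_basis_of_isotropic huW hvW hu hv hind hA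
    exact ⟨u, hu, v, hv, h, by tauto⟩
  set A := quadForm u with hAdef
  set B := polarForm u v with hBdef
  set C := quadForm v with hCdef
  have hφA : φ A = A := map_quadForm_of_fixed hu
  have hφB : φ B = B := map_polarForm_of_fixed hu hv
  have hφC : φ C = C := map_quadForm_of_fixed hv
  obtain ⟨d, hd⟩ := hsq (B ^ 2 - 4 * A * C) (by simp [map_ofNat φ 4, hφA, hφB, hφC])
  have h2A : 2 * A ≠ 0 := mul_ne_zero h2 hA
  set r := (-B + d) / (2 * A) with hr
  have hr' : 2 * A * r = -B + d := by rw [hr]; field_simp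
  have hQr : A * r ^ 2 + B * r + C = 0 := by
    apply (mul_eq_zero.1 (_ : (2 * (2 * A)) * (A * r ^ 2 + B * r + C) = 0)).resolve_left
      (mul_ne_zero h2 h2A)
    linear_combination (2 * A * r + d + B) * hr' + hd
  have hQu : quadForm (r • u + (1 : F) • v) = 0 := by
    rw [quadForm_comb, ← hAdef, ← hBdef, ← hCdef]
    linear_combination hQr
  have huW' : r • u + (1 : F) • v ∈ W := W.add_mem (W.smul_mem _ huW) (W.smul_mem _ hvW)
  have hconj : baerConj φ (r • u + (1 : F) • v) = φ r • u + (1 : F) • v := by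
    rw [baerConj_comb, hu, hv, map_one]
  have hφr : 2 * A * φ r = -B + φ d := by
    rw [← hφA, ← hφB, ← map_ofNat φ 2, ← map_neg, ← map_mul, ← map_mul, hr', map_add]
  have hφd : (φ d - d) * (φ d + d) = 0 := by
    have : φ d ^ 2 = d ^ 2 := by rw [hd, ← map_pow, hd]; simp [map_ofNat φ 4, hφA, hφB, hφC]
    linear_combination this
  by_cases hdd : φ d = d
  · have hφr' : φ r = r := mul_left_cancel₀ h2A (by rw [hφr, hr', hdd])
    have := hind.comb (a := r) (b := 1) (c := 1) (d := 0) (by simp)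
    rw [hφr'] at hconj
    obtain ⟨u, hu, v, hv, h, h'⟩ := exists_basis_of_isotropic huW' huW hconj hu
      (by simpa using this) hQu
    exact ⟨u, hu, v, hv, h, by tauto⟩
  · have hφd' : φ d = -d := by
      have := (mul_eq_zero.1 hφd).resolve_left (sub_ne_zero.2 hdd)
      linear_combination this
    have hd0 : d ≠ 0 := by
      rintro rfl
      simp at hdd
    refine ⟨r • u + (1 : F) • v, huW', φ r • u + (1 : F) • v,
      W.add_mem (W.smul_mem _ huW) (W.smul_mem _ hvW), hind.comb ?_,
      Or.inr (Or.inr ⟨hconj, ?_, hQu, ?_, ?_⟩)⟩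
    · intro h
      apply mul_ne_zero h2 hd0
      rw [hφd'] at hφr
      linear_combination -hr' + hφr + 2 * A * h
    · rw [baerConj_comb, hu, hv, map_one, hinv]
    · rw [← hconj, quadForm_baerConj, hQu, map_zero]
    · rw [polarForm_comb, polarForm_self, polarForm_self, polarForm_comm v u, ← hAdef,
        ← hBdef, ← hCdef]
      intro h
      rw [hφd'] at hφr
      apply mul_ne_zero h2 (pow_ne_zero 2 hd0)
      linear_combination -2 * A * h + (2 * A * φ r + B) * hr' + d * hφr + hd

end Forms

section Points

variable {F : Type*} [Field F]

lemma mk_rep_mem_iff {W : Submodule F (Fin 4 → F)} {x : Fin 4 → F} (hx : x ≠ 0) :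
    (Projectivization.mk F x hx).rep ∈ W ↔ x ∈ W := by
  obtain ⟨a, ha⟩ := Projectivization.exists_smul_eq_mk_rep F x hx
  rw [← ha]
  exact W.smul_mem_iff a.ne_zero

lemma Fgam_smul (m : ℕ) (γ c : F) (x : Fin 4 → F) :
    Fgam (2 * m + 1) γ (c • x) = c ^ (2 * m + 2) * Fgam (2 * m + 1) γ x := by
  have : (2 * m + 1 + 1) / 2 = m + 1 := by omega
  simp only [Fgam, this, Pi.smul_apply, smul_eq_mul]
  rw [show c * x 0 * (c * x 3) - c * x 1 * (c * x 2) = c ^ 2 * (x 0 * x 3 - x 1 * x 2) by ring]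
  simp only [mul_pow, ← pow_mul]
  ring

lemma mk_mem_Cgam_iff {m : ℕ} {γ : F} {x : Fin 4 → F} (hx : x ≠ 0) :
    Projectivization.mk F x hx ∈ Cgam (2 * m + 1) γ ↔ Fgam (2 * m + 1) γ x = 0 := by
  constructor
  · intro h
    exact h x hx rfl
  · intro h v hv hxv
    obtain ⟨a, ha⟩ := (Projectivization.mk_eq_mk_iff' F x v hx hv).1 hxv
    rw [← ha, Fgam_smul] at h
    refine (mul_eq_zero.1 h).resolve_left (pow_ne_zero _ ?_)
    rintro rfl
    exact hx (by rw [← ha, zero_smul])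

variable {φ : F →+* F} {q : ℕ}

lemma SigmaSet.exists_fixed (hφ : ∀ x, φ x = x ^ q) (hinv : ∀ x, φ (φ x) = x) {P : PGPoint F}
    (hP : P ∈ SigmaSet F q) :
    ∃ (x : Fin 4 → F) (hx : x ≠ 0), baerConj φ x = x ∧ P = Projectivization.mk F x hx := by
  obtain ⟨a, b, c, hv, ha, hc, rfl⟩ := hP
  refine ⟨_, hv, ?_, rfl⟩
  ext i
  fin_cases i <;> simp [baerConj, ← hφ, hinv] <;> rwa [hφ]

lemma Oset.exists_fixed (hφ : ∀ x, φ x = x ^ q) (hinv : ∀ x, φ (φ x) = x) {P : PGPoint F}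
    (hP : P ∈ Oset F q) :
    ∃ (x : Fin 4 → F) (hx : x ≠ 0), baerConj φ x = x ∧ quadForm x = 0 ∧
      P = Projectivization.mk F x hx := by
  rcases hP with ⟨t, hv, rfl⟩ | ⟨hv, rfl⟩
  · refine ⟨_, hv, ?_, ?_, rfl⟩
    · ext i
      fin_cases i <;> simp [baerConj, ← hφ, hinv, pow_succ, mul_comm]
    · simp [quadForm, pow_succ]
      ring
  · refine ⟨_, hv, ?_, ?_, rfl⟩
    · ext i
      fin_cases i <;> simp [baerConj]
    · simp [quadForm]

lemma mk_mem_Oset_s9 (hφ : ∀ x, φ x = x ^ q) {x : Fin 4 → F} (hx : x ≠ 0)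
    (hfix : baerConj φ x = x) (hQ : quadForm x = 0) :
    Projectivization.mk F x hx ∈ Oset F q := by
  have h0 : φ (x 0) = x 0 := by simpa [baerConj] using congrFun hfix 0
  have h2 : φ (x 1) = x 2 := by simpa [baerConj] using congrFun hfix 2
  by_cases hx0 : x 0 = 0
  · right
    have hx1 : x 1 = 0 := by simpa [quadForm, hx0, ← h2] using hQ
    have hx2 : x 2 = 0 := by rw [← h2, hx1, map_zero]
    refine ⟨fun h => one_ne_zero (α := F) (by simpa using congrFun h 3), ?_⟩
    rw [Projectivization.mk_eq_mk_iff']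
    refine ⟨x 3, ?_⟩
    ext i
    fin_cases i <;> simp [hx0, hx1, hx2]
  · left
    refine ⟨x 1 / x 0, fun h => one_ne_zero (α := F) (by simpa using congrFun h 0), ?_⟩
    rw [Projectivization.mk_eq_mk_iff']
    refine ⟨x 0, ?_⟩
    have hq : (x 1 / x 0) ^ q = x 2 / x 0 := by rw [← hφ, map_div₀, h0, h2]
    have hQ' : x 0 * x 3 = x 1 * x 2 := sub_eq_zero.1 hQ
    ext i
    fin_cases i
    · simp
    · simp
      field_simp
    · simp [hq]
      field_simp
    · simp [pow_succ, hq]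
      field_simp
      linear_combination -hQ'

lemma exists_fixed_pair (hφ : ∀ x, φ x = x ^ q) (hinv : ∀ x, φ (φ x) = x)
    {W : Submodule F (Fin 4 → F)}
    (h : 1 < ({P : PGPoint F | P.rep ∈ W} ∩ SigmaSet F q).ncard) :
    ∃ u ∈ W, ∃ v ∈ W, baerConj φ u = u ∧ baerConj φ v = v ∧ PairIndep u v := by
  obtain ⟨P, Q, hP, hQ, hne⟩ := (Set.one_lt_ncard_iff (Set.finite_of_ncard_pos (by omega))).1 h
  obtain ⟨x, hx, hfx, rfl⟩ := SigmaSet.exists_fixed hφ hinv hP.2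
  obtain ⟨y, hy, hfy, rfl⟩ := SigmaSet.exists_fixed hφ hinv hQ.2
  refine ⟨x, (mk_rep_mem_iff hx).1 hP.1, y, (mk_rep_mem_iff hy).1 hQ.1, hfx, hfy, ?_⟩
  intro a b hab
  have ha : a = 0 := by
    by_contra ha
    apply hne
    rw [Projectivization.mk_eq_mk_iff']
    refine ⟨-b / a, ?_⟩
    have : a • x = (-b) • y := by rw [neg_smul]; exact eq_neg_of_add_eq_zero_left hab
    rw [div_eq_inv_mul, mul_smul, ← this, smul_smul, inv_mul_cancel₀ ha, one_smul]
  subst ha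
  exact ⟨rfl, by simpa [hy] using hab⟩

/-- Points of a line other than `⟨u⟩` are parametrized by the field. -/
lemma ncard_line_inter {W : Submodule F (Fin 4 → F)} {u v : Fin 4 → F}
    (hW : ∀ x, x ∈ W ↔ ∃ a b : F, a • u + b • v = x) (hind : PairIndep u v)
    {T : Set (PGPoint F)} {S : Set F} (hu : ∀ hu0 : u ≠ 0, Projectivization.mk F u hu0 ∉ T)
    (hS : ∀ a (h : a • u + (1 : F) • v ≠ 0), Projectivization.mk F _ h ∈ T ↔ a ∈ S) :
    ({P : PGPoint F | P.rep ∈ W} ∩ T).ncard = S.ncard := by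
  have hne : ∀ a : F, a • u + (1 : F) • v ≠ 0 := fun a =>
    hind.comb_ne_zero (Or.inr one_ne_zero)
  have hinj : Function.Injective fun a : F => Projectivization.mk F _ (hne a) := by
    intro a a' h
    obtain ⟨c, hc⟩ := (Projectivization.mk_eq_mk_iff' F _ _ _ _).1 h
    obtain ⟨h1, h2⟩ := hind (c * a' - a) (c - 1) (by
      rw [← sub_eq_zero] at hc
      rw [← hc]
      module)
    linear_combination -h1 + a' * h2
  rw [← Set.ncard_image_of_injective S hinj]
  congr 1
  ext P
  constructor
  · rintro ⟨hPW, hPT⟩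
    induction P using Projectivization.ind with
    | h x hx =>
      obtain ⟨a, b, rfl⟩ := (hW x).1 ((mk_rep_mem_iff hx).1 hPW)
      by_cases hb : b = 0
      · subst hb
        exfalso
        have hu0 : u ≠ 0 := by
          rintro rfl
          simp at hx
        apply hu hu0
        convert hPT using 1
        rw [eq_comm, Projectivization.mk_eq_mk_iff']
        exact ⟨a, by simp⟩
      · have heq : Projectivization.mk F _ hx = Projectivization.mk F _ (hne (a / b)) := by
          rw [Projectivization.mk_eq_mk_iff']
          refine ⟨b, ?_⟩
          rw [smul_add, smul_smul, mul_div_cancel₀ _ hb, smul_smul, mul_one]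
        rw [heq] at hPT ⊢
        exact ⟨_, (hS _ _).1 hPT, rfl⟩
  · rintro ⟨a, ha, rfl⟩
    exact ⟨(mk_rep_mem_iff _).2 ((hW _).2 ⟨a, 1, rfl⟩), (hS _ _).2 ha⟩

end Points

section Roots

variable {F : Type*} [Field F]

lemma ncard_pow_eq {ζ s : F} {d : ℕ} (hd : 0 < d) (hζ : IsPrimitiveRoot ζ d) (hs : s ≠ 0)
    (hex : ∃ β, β ^ d = s) : {a : F | a ^ d = s}.ncard = d := by
  classical
  have h1 : {a : F | a ^ d = s} = ↑(Polynomial.nthRoots d s).toFinset := by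
    ext a
    simp [Polynomial.mem_nthRoots hd]
  rw [h1, Set.ncard_coe_finset, Multiset.toFinset_card_of_nodup (hζ.nthRoots_nodup hs),
    hζ.card_nthRoots, if_pos hex]

lemma ncard_pow_eq_or {ζ s t : F} {d : ℕ} (hd : 0 < d) (hζ : IsPrimitiveRoot ζ d) (hs : s ≠ 0)
    (ht : t ≠ 0) (hst : s ≠ t) (hexs : ∃ β, β ^ d = s) (hext : ∃ β, β ^ d = t) :
    {a : F | a ^ d = s ∨ a ^ d = t}.ncard = 2 * d := by
  have h1 := ncard_pow_eq hd hζ hs hexs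
  have h2 := ncard_pow_eq hd hζ ht hext
  rw [Set.ofPred_or, Set.ncard_union_eq ?_ (Set.finite_of_ncard_pos (by omega))
    (Set.finite_of_ncard_pos (by omega)), h1, h2, two_mul]
  rw [Set.disjoint_left]
  intro a ha hb
  exact hst (ha.symm.trans hb)

/-- The equation `x + x⁻¹ = s + s⁻¹`, cleared of denominators. -/
lemma sq_sub_add_inv_mul_add_one_eq_zero_iff {s x : F} (hs : s ≠ 0) :
    x ^ 2 - (s + s⁻¹) * x + 1 = 0 ↔ x = s ∨ x = s⁻¹ := by
  have : x ^ 2 - (s + s⁻¹) * x + 1 = (x - s) * (x - s⁻¹) := by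
    field_simp
    ring
  rw [this, mul_eq_zero, sub_eq_zero, sub_eq_zero]

end Roots

section Lines

variable {F : Type*} [Field F] {φ : F →+* F} {m : ℕ} {u v : Fin 4 → F}
  {W : Submodule F (Fin 4 → F)}

lemma forms_eq_zero_of_mem_Oset {q : ℕ} (hφ : ∀ x, φ x = x ^ q) (hinv : ∀ x, φ (φ x) = x)
    {x : Fin 4 → F} (hx : x ≠ 0) (h : Projectivization.mk F x hx ∈ Oset F q) :
    quadForm x = 0 ∧ polarForm x (baerConj φ x) = 0 := by
  obtain ⟨y, hy, hfix, hQ, hxy⟩ := Oset.exists_fixed hφ hinv h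
  obtain ⟨a, rfl⟩ := (Projectivization.mk_eq_mk_iff' F x y hx hy).1 hxy
  have h1 := quadForm_comb a 0 y 0
  have h2 := baerConj_comb φ a 0 y 0
  have h3 := polarForm_comb a 0 (φ a) 0 y 0 y 0
  simp only [zero_smul, add_zero, map_zero, zero_mul, mul_zero, ne_eq, OfNat.ofNat_ne_zero,
    not_false_eq_true, zero_pow, hfix, hQ, polarForm_self] at h1 h2 h3
  rw [h2]
  exact ⟨h1, h3⟩

lemma exists_eq_mk_of_rep_mem (hW : ∀ x, x ∈ W ↔ ∃ a b : F, a • u + b • v = x)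
    {P : PGPoint F} (hP : P.rep ∈ W) :
    ∃ (a b : F) (h : a • u + b • v ≠ 0), P = Projectivization.mk F _ h := by
  obtain ⟨a, b, h⟩ := (hW _).1 hP
  exact ⟨a, b, h ▸ P.rep_nonzero, by simp only [h, Projectivization.mk_rep]⟩

lemma SecantBasis.Fgam_comb (hB : SecantBasis φ u v) (hφ : ∀ x, φ x = x ^ (2 * m + 1))
    (γ a b : F) : Fgam (2 * m + 1) γ (a • u + b • v) =
      a * φ b + b * φ a - γ * (a * b) ^ (m + 1) := by
  have h : (2 * m + 1 + 1) / 2 = m + 1 := by omega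
  rw [Fgam_eq_forms φ hφ, baerConj_comb, hB.conj_left, hB.conj_right, polarForm_comb,
    quadForm_comb, polarForm_self, polarForm_self, polarForm_comm v u, hB.quad_left,
    hB.quad_right, hB.polar, h]
  ring

lemma TangentBasis.Fgam_comb (hB : TangentBasis φ u v) (hφ : ∀ x, φ x = x ^ (2 * m + 1))
    (γ a b : F) : Fgam (2 * m + 1) γ (a • u + b • v) =
      2 * quadForm v * (b * φ b) - γ * (quadForm v * b ^ 2) ^ (m + 1) := by
  have h : (2 * m + 1 + 1) / 2 = m + 1 := by omega
  rw [Fgam_eq_forms φ hφ, baerConj_comb, hB.conj_left, hB.conj_right, polarForm_comb,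
    quadForm_comb, polarForm_self, polarForm_self, polarForm_comm v u, hB.quad_left,
    hB.polar, h]
  ring

lemma ExternalBasis.Fgam_comb (hB : ExternalBasis φ u v) (hφ : ∀ x, φ x = x ^ (2 * m + 1))
    (γ a b : F) : Fgam (2 * m + 1) γ (a • u + b • v) =
      polarForm u v * (a * φ a + b * φ b) - γ * (polarForm u v * (a * b)) ^ (m + 1) := by
  have h : (2 * m + 1 + 1) / 2 = m + 1 := by omega
  rw [Fgam_eq_forms φ hφ, baerConj_comb, hB.conj_left, hB.conj_right, polarForm_comb,
    quadForm_comb, polarForm_self, polarForm_self, polarForm_comm v u, hB.quad_left,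
    hB.quad_right, h]
  ring

lemma pow_two_mul_eq_one (hφ : ∀ x, φ x = x ^ (2 * m + 1)) {c : F} (hc : c ≠ 0)
    (hfix : φ c = c) : (c ^ m) ^ 2 = 1 := by
  rw [hφ] at hfix
  apply mul_left_cancel₀ hc
  linear_combination hfix

lemma SecantBasis.Fgam_eq_zero_iff (hB : SecantBasis φ u v) (hφ : ∀ x, φ x = x ^ (2 * m + 1))
    {s a : F} (hs : s ≠ 0) (ha : a ≠ 0) :
    Fgam (2 * m + 1) (s + s⁻¹) (a • u + (1 : F) • v) = 0 ↔ a ^ m = s ∨ a ^ m = s⁻¹ := by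
  have : Fgam (2 * m + 1) (s + s⁻¹) (a • u + (1 : F) • v) =
      a * ((a ^ m) ^ 2 - (s + s⁻¹) * a ^ m + 1) := by
    rw [hB.Fgam_comb hφ, map_one, hφ]
    ring
  rw [this, mul_eq_zero, or_iff_right ha, sq_sub_add_inv_mul_add_one_eq_zero_iff hs]

lemma TangentBasis.Fgam_ne_zero (hB : TangentBasis φ u v) (hφ : ∀ x, φ x = x ^ (2 * m + 1))
    {s a b : F} (hs : s ≠ 0) (hs2 : s ^ 2 ≠ 1) (hb : b ≠ 0) :
    Fgam (2 * m + 1) (s + s⁻¹) (a • u + b • v) ≠ 0 := by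
  have hsq := pow_two_mul_eq_one hφ hB.quad_right (map_quadForm_of_fixed hB.conj_right)
  set χ := quadForm v ^ m with hχ
  intro h0
  rw [hB.Fgam_comb hφ, hφ] at h0
  have h1 : χ ^ 2 - (s + s⁻¹) * χ + 1 = 0 := by
    have : quadForm v * b ^ (2 * m + 2) ≠ 0 := mul_ne_zero hB.quad_right (pow_ne_zero _ hb)
    apply mul_left_cancel₀ this
    rw [hχ] at hsq ⊢
    linear_combination h0 + quadForm v * b ^ (2 * m + 2) * hsq
  rcases (sq_sub_add_inv_mul_add_one_eq_zero_iff hs).1 h1 with h | h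
  · exact hs2 (by rw [← h, hsq])
  · exact hs2 (by rw [← inv_eq_one, ← inv_pow, ← h, hsq])

lemma ExternalBasis.Fgam_eq_zero_iff (hB : ExternalBasis φ u v)
    (hφ : ∀ x, φ x = x ^ (2 * m + 1)) {s a : F} (hs : s ≠ 0) :
    Fgam (2 * m + 1) (s + s⁻¹) (a • u + (1 : F) • v) = 0 ↔
      a ^ (m + 1) = polarForm u v ^ m * s ∨ a ^ (m + 1) = polarForm u v ^ m * s⁻¹ := by
  have hfix : φ (polarForm u v) = polarForm u v := by
    rw [← polarForm_baerConj, hB.conj_left, hB.conj_right, polarForm_comm]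
  have hsq := pow_two_mul_eq_one hφ hB.polar hfix
  have hiff : ∀ t : F, polarForm u v ^ m * a ^ (m + 1) = t ↔
      a ^ (m + 1) = polarForm u v ^ m * t := by
    intro t
    constructor
    · intro h
      linear_combination polarForm u v ^ m * h - a ^ (m + 1) * hsq
    · intro h
      linear_combination polarForm u v ^ m * h + t * hsq
  rw [← hiff, ← hiff, ← sq_sub_add_inv_mul_add_one_eq_zero_iff hs]
  have : Fgam (2 * m + 1) (s + s⁻¹) (a • u + (1 : F) • v) = polarForm u v *
      ((polarForm u v ^ m * a ^ (m + 1)) ^ 2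
        - (s + s⁻¹) * (polarForm u v ^ m * a ^ (m + 1)) + 1) := by
    rw [hB.Fgam_comb hφ, map_one, hφ]
    linear_combination -polarForm u v * (a ^ (m + 1)) ^ 2 * hsq
  rw [this, mul_eq_zero, or_iff_right hB.polar]

lemma SecantBasis.mk_mem_Oset_iff (hB : SecantBasis φ u v) (hind : PairIndep u v)
    (hφ : ∀ x, φ x = x ^ (2 * m + 1)) (hinv : ∀ x, φ (φ x) = x) {a b : F}
    (h : a • u + b • v ≠ 0) :
    Projectivization.mk F _ h ∈ Oset F (2 * m + 1) ↔ a = 0 ∨ b = 0 := by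
  constructor
  · intro hO
    have := (forms_eq_zero_of_mem_Oset hφ hinv h hO).1
    rw [quadForm_comb, hB.quad_left, hB.quad_right, hB.polar] at this
    simpa using this
  · have hne : ∀ c d : F, c ≠ 0 ∨ d ≠ 0 → c • u + d • v ≠ 0 := fun c d => hind.comb_ne_zero
    rintro (rfl | rfl)
    · have hO := mk_mem_Oset_s9 hφ (hne 0 1 (by simp))
        (by simpa using hB.conj_right) (by simpa using hB.quad_right)
      convert hO using 1
      rw [Projectivization.mk_eq_mk_iff']
      exact ⟨b, by simp⟩
    · have hO := mk_mem_Oset_s9 hφ (hne 1 0 (by simp))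
        (by simpa using hB.conj_left) (by simpa using hB.quad_left)
      convert hO using 1
      rw [Projectivization.mk_eq_mk_iff']
      exact ⟨a, by simp⟩

lemma SecantBasis.ncard_inter_Oset (hB : SecantBasis φ u v) (hind : PairIndep u v)
    (hW : ∀ x, x ∈ W ↔ ∃ a b : F, a • u + b • v = x)
    (hφ : ∀ x, φ x = x ^ (2 * m + 1)) (hinv : ∀ x, φ (φ x) = x) :
    ({P : PGPoint F | P.rep ∈ W} ∩ Oset F (2 * m + 1)).ncard = 2 := by
  have hu : (1 : F) • u + (0 : F) • v ≠ 0 := hind.comb_ne_zero (by simp)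
  have hv : (0 : F) • u + (1 : F) • v ≠ 0 := hind.comb_ne_zero (by simp)
  rw [Set.ncard_eq_two]
  refine ⟨Projectivization.mk F _ hu, Projectivization.mk F _ hv, ?_, ?_⟩
  · intro h
    obtain ⟨a, ha⟩ := (Projectivization.mk_eq_mk_iff' F _ _ hu hv).1 h
    have := (hind 1 (-a) (by
      rw [← sub_eq_zero] at ha
      rw [← neg_eq_zero, ← ha]
      module)).1
    exact one_ne_zero this
  · ext P
    constructor
    · rintro ⟨hPW, hPO⟩
      obtain ⟨a, b, h, rfl⟩ := exists_eq_mk_of_rep_mem hW hPW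
      rcases (hB.mk_mem_Oset_iff hind hφ hinv h).1 hPO with rfl | rfl
      · right
        rw [Set.mem_singleton_iff, Projectivization.mk_eq_mk_iff']
        exact ⟨b, by simp⟩
      · left
        rw [Projectivization.mk_eq_mk_iff']
        exact ⟨a, by simp⟩
    · rintro (rfl | rfl)
      · exact ⟨(mk_rep_mem_iff hu).2 ((hW _).2 ⟨_, _, rfl⟩),
          (hB.mk_mem_Oset_iff hind hφ hinv hu).2 (Or.inr rfl)⟩
      · exact ⟨(mk_rep_mem_iff hv).2 ((hW _).2 ⟨_, _, rfl⟩),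
          (hB.mk_mem_Oset_iff hind hφ hinv hv).2 (Or.inl rfl)⟩

lemma SecantBasis.ncard_inter_Cgam (hB : SecantBasis φ u v) (hind : PairIndep u v)
    (hW : ∀ x, x ∈ W ↔ ∃ a b : F, a • u + b • v = x)
    (hφ : ∀ x, φ x = x ^ (2 * m + 1)) (hinv : ∀ x, φ (φ x) = x) (hm : 0 < m)
    {ζ r : F} (hζ : IsPrimitiveRoot ζ m) (hr : r ≠ 0) (hr2 : (r ^ m) ^ 2 ≠ 1) :
    ({P : PGPoint F | P.rep ∈ W} ∩
      (Cgam (2 * m + 1) (r ^ m + (r ^ m)⁻¹) \ Oset F (2 * m + 1))).ncard = 2 * m := by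
  have hs : r ^ m ≠ 0 := pow_ne_zero m hr
  refine (ncard_line_inter hW hind ?_ ?_).trans (ncard_pow_eq_or hm hζ hs (inv_ne_zero hs)
    (fun h => hr2 ?_) ⟨r, rfl⟩ ⟨r⁻¹, inv_pow r m⟩)
  · rintro hu0 ⟨-, hO⟩
    exact hO (mk_mem_Oset_s9 hφ hu0 hB.conj_left hB.quad_left)
  · intro a h
    rw [Set.mem_sdiff, hB.mk_mem_Oset_iff hind hφ hinv h, mk_mem_Cgam_iff]
    by_cases ha : a = 0
    · subst ha
      simp [hm.ne', hr, eq_comm]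
    · rw [hB.Fgam_eq_zero_iff hφ hs ha]
      simp [ha]
  · rw [sq]
    nth_rewrite 2 [h]
    exact mul_inv_cancel₀ hs

lemma SecantBasis.pow_eq_one (hB : SecantBasis φ u v) (hind : PairIndep u v)
    (hW : ∀ x, x ∈ W ↔ ∃ a b : F, a • u + b • v = x)
    (hφ : ∀ x, φ x = x ^ (2 * m + 1)) (hinv : ∀ x, φ (φ x) = x)
    (hcard : ∀ x : F, x ≠ 0 → x ^ (4 * m * (m + 1)) = 1) {s : F} (hs : s ≠ 0)
    {P : PGPoint F} (hPW : P.rep ∈ W)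
    (hP : P ∈ Cgam (2 * m + 1) (s + s⁻¹) \ Oset F (2 * m + 1)) : s ^ (4 * (m + 1)) = 1 := by
  obtain ⟨a, b, h, rfl⟩ := exists_eq_mk_of_rep_mem hW hPW
  obtain ⟨hC, hO⟩ := hP
  rw [hB.mk_mem_Oset_iff hind hφ hinv h, not_or] at hO
  rw [mk_mem_Cgam_iff, show a • u + b • v = b • ((a / b) • u + (1 : F) • v) by
    rw [smul_add, smul_smul, mul_div_cancel₀ _ hO.2, smul_smul, mul_one], Fgam_smul,
    mul_eq_zero, or_iff_right (pow_ne_zero _ hO.2),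
    hB.Fgam_eq_zero_iff hφ hs (div_ne_zero hO.1 hO.2)] at hC
  have h1 := hcard (a / b) (div_ne_zero hO.1 hO.2)
  rw [show 4 * m * (m + 1) = m * (4 * (m + 1)) by ring, pow_mul] at h1
  rcases hC with hC | hC
  · rwa [hC] at h1
  · rwa [hC, inv_pow, inv_eq_one] at h1

lemma TangentBasis.notMem_Cgam (hB : TangentBasis φ u v)
    (hW : ∀ x, x ∈ W ↔ ∃ a b : F, a • u + b • v = x)
    (hφ : ∀ x, φ x = x ^ (2 * m + 1)) {s : F} (hs : s ≠ 0) (hs2 : s ^ 2 ≠ 1)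
    {P : PGPoint F} (hPW : P.rep ∈ W) :
    P ∉ Cgam (2 * m + 1) (s + s⁻¹) \ Oset F (2 * m + 1) := by
  rintro ⟨hC, hO⟩
  obtain ⟨a, b, h, rfl⟩ := exists_eq_mk_of_rep_mem hW hPW
  rw [mk_mem_Cgam_iff] at hC
  by_cases hb : b = 0
  · subst hb
    have hu0 : u ≠ 0 := by
      rintro rfl
      simp at h
    apply hO
    convert mk_mem_Oset_s9 hφ hu0 hB.conj_left hB.quad_left using 1
    rw [Projectivization.mk_eq_mk_iff']
    exact ⟨a, by simp⟩
  · exact hB.Fgam_ne_zero hφ hs hs2 hb hC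

lemma ExternalBasis.notMem_Oset (hB : ExternalBasis φ u v)
    (hW : ∀ x, x ∈ W ↔ ∃ a b : F, a • u + b • v = x)
    (hφ : ∀ x, φ x = x ^ (2 * m + 1)) (hinv : ∀ x, φ (φ x) = x)
    {P : PGPoint F} (hPW : P.rep ∈ W) : P ∉ Oset F (2 * m + 1) := by
  intro hO
  obtain ⟨a, b, h, rfl⟩ := exists_eq_mk_of_rep_mem hW hPW
  obtain ⟨h1, h2⟩ := forms_eq_zero_of_mem_Oset hφ hinv h hO
  rw [quadForm_comb, hB.quad_left, hB.quad_right] at h1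
  rw [baerConj_comb, hB.conj_left, hB.conj_right, polarForm_comb, polarForm_self,
    polarForm_self, hB.quad_left, hB.quad_right, polarForm_comm v u] at h2
  apply h
  have hab : a = 0 ∨ b = 0 := by simpa [hB.polar] using h1
  rcases hab with rfl | rfl
  · have : b = 0 := by simpa [hB.polar] using h2
    simp [this]
  · have : a = 0 := by simpa [hB.polar] using h2
    simp [this]

lemma ExternalBasis.Fgam_left_ne_zero (hB : ExternalBasis φ u v)
    (hφ : ∀ x, φ x = x ^ (2 * m + 1)) (γ : F) : Fgam (2 * m + 1) γ u ≠ 0 := by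
  have := hB.Fgam_comb hφ γ 1 0
  simp only [one_smul, zero_smul, add_zero, map_one, map_zero, mul_one, mul_zero, ne_eq,
    Nat.add_eq_zero_iff, one_ne_zero, and_false, not_false_eq_true, zero_pow, sub_zero] at this
  rw [this]
  exact hB.polar

lemma ExternalBasis.ncard_inter_Cgam (hB : ExternalBasis φ u v) (hind : PairIndep u v)
    (hW : ∀ x, x ∈ W ↔ ∃ a b : F, a • u + b • v = x)
    (hφ : ∀ x, φ x = x ^ (2 * m + 1)) {ζ r : F} (hζ : IsPrimitiveRoot ζ (m + 1))
    (hneg : ∃ δ : F, δ ^ (m + 1) = -1) (hr : r ≠ 0) (hr2 : (r ^ (m + 1)) ^ 2 ≠ 1) :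
    ({P : PGPoint F | P.rep ∈ W} ∩
      Cgam (2 * m + 1) (r ^ (m + 1) + (r ^ (m + 1))⁻¹)).ncard = 2 * (m + 1) := by
  have hfix : φ (polarForm u v) = polarForm u v := by
    rw [← polarForm_baerConj, hB.conj_left, hB.conj_right, polarForm_comm]
  have hsq := pow_two_mul_eq_one hφ hB.polar hfix
  have hs : r ^ (m + 1) ≠ 0 := pow_ne_zero _ hr
  have hχ : polarForm u v ^ m ≠ 0 := pow_ne_zero _ hB.polar
  obtain ⟨ε, hε⟩ : ∃ ε : F, ε ^ (m + 1) = polarForm u v ^ m := by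
    rcases eq_or_eq_neg_of_sq_eq_sq _ 1 (hsq.trans (one_pow 2).symm) with h | h
    · exact ⟨1, by rw [h, one_pow]⟩
    · rw [h]
      exact hneg
  refine (ncard_line_inter hW hind ?_ ?_).trans (ncard_pow_eq_or m.succ_pos hζ
    (mul_ne_zero hχ hs) (mul_ne_zero hχ (inv_ne_zero hs)) (fun h => hr2 ?_)
    ⟨ε * r, by rw [mul_pow, hε]⟩ ⟨ε * r⁻¹, by rw [mul_pow, hε, inv_pow]⟩)
  · intro hu0 hC
    exact hB.Fgam_left_ne_zero hφ _ ((mk_mem_Cgam_iff hu0).1 hC)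
  · intro a h
    rw [mk_mem_Cgam_iff, hB.Fgam_eq_zero_iff hφ hs]
    rfl
  · rw [mul_right_inj' hχ] at h
    rw [sq]
    nth_rewrite 2 [h]
    exact mul_inv_cancel₀ hs

lemma ExternalBasis.pow_eq_one (hB : ExternalBasis φ u v)
    (hW : ∀ x, x ∈ W ↔ ∃ a b : F, a • u + b • v = x)
    (hφ : ∀ x, φ x = x ^ (2 * m + 1))
    (hcard : ∀ x : F, x ≠ 0 → x ^ (4 * m * (m + 1)) = 1) {s : F} (hs : s ≠ 0)
    {P : PGPoint F} (hPW : P.rep ∈ W) (hP : P ∈ Cgam (2 * m + 1) (s + s⁻¹)) :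
    s ^ (4 * m) = 1 := by
  have hfix : φ (polarForm u v) = polarForm u v := by
    rw [← polarForm_baerConj, hB.conj_left, hB.conj_right, polarForm_comm]
  have hsq := pow_two_mul_eq_one hφ hB.polar hfix
  have hχ : polarForm u v ^ m ≠ 0 := pow_ne_zero _ hB.polar
  obtain ⟨a, b, h, rfl⟩ := exists_eq_mk_of_rep_mem hW hPW
  rw [mk_mem_Cgam_iff] at hP
  have hb : b ≠ 0 := by
    rintro rfl
    rw [zero_smul, add_zero, Fgam_smul] at hP
    have ha : a ≠ 0 := by
      rintro rfl
      simp at h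
    exact mul_ne_zero (pow_ne_zero _ ha) (hB.Fgam_left_ne_zero hφ _) hP
  rw [show a • u + b • v = b • ((a / b) • u + (1 : F) • v) by
    rw [smul_add, smul_smul, mul_div_cancel₀ _ hb, smul_smul, mul_one], Fgam_smul,
    mul_eq_zero, or_iff_right (pow_ne_zero _ hb), hB.Fgam_eq_zero_iff hφ hs] at hP
  have ha : a / b ≠ 0 := by
    intro h0
    rw [h0, zero_pow m.succ_ne_zero] at hP
    rcases hP with hP | hP
    · exact mul_ne_zero hχ hs hP.symm
    · exact mul_ne_zero hχ (inv_ne_zero hs) hP.symm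
  have h1 := hcard (a / b) ha
  have h2 : (polarForm u v ^ m) ^ (4 * m) = 1 := by
    rw [show 4 * m = 2 * (2 * m) by ring, pow_mul _ 2, hsq, one_pow]
  rw [show 4 * m * (m + 1) = (m + 1) * (4 * m) by ring, pow_mul] at h1
  rcases hP with hP | hP
  · rwa [hP, mul_pow, h2, one_mul] at h1
  · rwa [hP, mul_pow, h2, one_mul, inv_pow, inv_eq_one] at h1

end Lines

lemma isPrimitiveRoot_of_forall_eq_pow {F : Type*} [Field F] [Fintype F] {N : ℕ}
    (hN : 1 < N) (hF : Fintype.card F = N + 1) {ξ : F}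
    (hξ : ∀ x : F, x ≠ 0 → ∃ i : ℕ, x = ξ ^ i) : IsPrimitiveRoot ξ N := by
  classical
  have hcard : Fintype.card Fˣ = N := by rw [Fintype.card_units, hF]; rfl
  have h0 : ξ ≠ 0 := by
    rintro rfl
    have : ∀ x : Fˣ, x = 1 := by
      intro x
      obtain ⟨i, hi⟩ := hξ x x.ne_zero
      rcases Nat.eq_zero_or_pos i with rfl | hi0
      · ext
        simpa using hi
      · rw [zero_pow hi0.ne'] at hi
        exact absurd hi x.ne_zero
    have : Fintype.card Fˣ ≤ 1 := Fintype.card_le_one_iff.2 fun a b => by rw [this a, this b]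
    omega
  have hord : orderOf (Units.mk0 ξ h0) = Nat.card Fˣ := by
    apply orderOf_eq_card_of_forall_mem_powers
    intro x
    obtain ⟨i, hi⟩ := hξ x x.ne_zero
    exact ⟨i, by ext; simp [hi]⟩
  rw [Nat.card_eq_fintype_card, hcard] at hord
  have := IsPrimitiveRoot.orderOf (Units.mk0 ξ h0)
  rw [hord] at this
  exact IsPrimitiveRoot.coe_units_iff.2 this

/-- Lemma 2.9: intersections of extended sublines of `Σ` with `S_j \ O` and
    `E_k \ O`. -/
theorem stmt9 {F : Type*} [Field F] [Fintype F] (p n q : ℕ) (hp : p.Prime)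
    (hodd : Odd p) (hn : 0 < n) (hq : q = p ^ n) (hF : Fintype.card F = q ^ 2)
    (ξ : F) (hξ : ∀ x : F, x ≠ 0 → ∃ m : ℕ, x = ξ ^ m)
    (ℓ : Set (PGPoint F)) (hℓ : IsLine ℓ)
    (hSig : (ℓ ∩ SigmaSet F q).ncard = q + 1) :
    (∀ j : ℕ, 1 ≤ j → j ≤ q → j ≠ (q + 1) / 2 →
      (∃ P ∈ ℓ, P ∈ Cgam q (ξ ^ (j * (q - 1) / 2) + (ξ ^ (j * (q - 1) / 2))⁻¹)
          \ Oset F q) →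
        (ℓ ∩ Oset F q).ncard = 2 ∧
        (ℓ ∩ (Cgam q (ξ ^ (j * (q - 1) / 2) + (ξ ^ (j * (q - 1) / 2))⁻¹)
          \ Oset F q)).ncard = q - 1) ∧
    (∀ k : ℕ, 1 ≤ k → k ≤ q - 2 → k ≠ (q - 1) / 2 →
      (∃ P ∈ ℓ, P ∈ Cgam q (ξ ^ (k * (q + 1) / 2) + (ξ ^ (k * (q + 1) / 2))⁻¹)
          \ Oset F q) →
        (ℓ ∩ Oset F q).ncard = 0 ∧
        (ℓ ∩ Cgam q (ξ ^ (k * (q + 1) / 2) + (ξ ^ (k * (q + 1) / 2))⁻¹)).ncard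
          = q + 1) := by
  have hp3 : 3 ≤ p := by
    have := hp.two_le
    obtain ⟨t, rfl⟩ := hodd
    omega
  have hq3 : 3 ≤ q := hq ▸ hp3.trans (Nat.le_self_pow hn.ne' p)
  obtain ⟨m, rfl⟩ : Odd q := hq ▸ hodd.pow
  have hm : 0 < m := by omega
  have : Fact p.Prime := ⟨hp⟩
  have hF' : Fintype.card F = p ^ (n * 2) := by rw [hF, hq, pow_mul]
  have : CharP F p := charP_of_card_eq_prime_pow hF'
  have hchar : ringChar F ≠ 2 := by
    rw [ringChar.eq F p]
    omega
  have h2 : (2 : F) ≠ 0 := Ring.two_ne_zero hchar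
  have hcard : Fintype.card F = 4 * m * (m + 1) + 1 := by rw [hF]; ring
  have hcard1 : ∀ x : F, x ≠ 0 → x ^ (4 * m * (m + 1)) = 1 := by
    intro x hx
    have := FiniteField.pow_card_sub_one_eq_one x hx
    rwa [hcard] at this
  set φ : F →+* F := iterateFrobenius F p n with hφdef
  have hφ : ∀ x, φ x = x ^ (2 * m + 1) := fun x => by rw [hq, hφdef, iterateFrobenius_def]
  have hinv : ∀ x, φ (φ x) = x := fun x => by
    rw [hφ, hφ, ← pow_mul, ← sq, ← hF, FiniteField.pow_card]
  have hsq : ∀ D : F, φ D = D → ∃ d, d ^ 2 = D := by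
    intro D hD
    by_cases hD0 : D = 0
    · exact ⟨0, by simp [hD0]⟩
    · have : IsSquare D := by
        rw [FiniteField.isSquare_iff hchar hD0, hcard,
          show (4 * m * (m + 1) + 1) / 2 = m * 2 * (m + 1) by
            rw [show 4 * m * (m + 1) = 2 * (m * 2 * (m + 1)) by ring]; omega,
          pow_mul, pow_mul, pow_two_mul_eq_one hφ hD0 hD, one_pow]
      obtain ⟨d, hd⟩ := this
      exact ⟨d, by rw [hd, sq]⟩
  have hN : 0 < 4 * m * (m + 1) := by positivity
  have hprim : IsPrimitiveRoot ξ (4 * m * (m + 1)) :=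
    isPrimitiveRoot_of_forall_eq_pow (by nlinarith) hcard hξ
  have hξ0 : ξ ≠ 0 := hprim.ne_zero hN.ne'
  have hζ : IsPrimitiveRoot (ξ ^ (4 * (m + 1))) m := hprim.pow hN (by ring)
  have hζ' : IsPrimitiveRoot (ξ ^ (4 * m)) (m + 1) := hprim.pow hN rfl
  have hneg : ∃ δ : F, δ ^ (m + 1) = -1 := by
    refine ⟨ξ ^ (2 * m), ?_⟩
    rw [← pow_mul]
    exact (hprim.pow hN (by ring : _ = 2 * m * (m + 1) * 2)).eq_neg_one_of_two_right
  obtain ⟨W, hWrank, rfl⟩ := hℓ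
  obtain ⟨w₁, hw₁, w₂, hw₂, hf₁, hf₂, hind₀⟩ :=
    exists_fixed_pair hφ hinv (W := W) (by rw [hSig]; omega)
  obtain ⟨u, hu, v, hv, hind, hB⟩ := exists_basis h2 hinv hsq hw₁ hw₂ hf₁ hf₂ hind₀
  have hW := hind.mem_iff hWrank hu hv
  have hcop : Nat.Coprime (m + 1) m := by simp
  constructor
  · intro j hj1 hjq hj ⟨P, hPW, hP⟩
    have he : j * (2 * m + 1 - 1) / 2 = j * m := by
      rw [show j * (2 * m + 1 - 1) = 2 * (j * m) by rw [Nat.add_sub_cancel]; ring]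
      omega
    have hndvd : ¬ m + 1 ∣ j := by
      rintro ⟨c, rfl⟩
      have hc : c < 2 := by
        by_contra! hc
        nlinarith
      interval_cases c <;> omega
    rw [he, pow_mul] at hP ⊢
    have hr0 : ξ ^ j ≠ 0 := pow_ne_zero j hξ0
    have hs4 : ((ξ ^ j) ^ m) ^ (4 * m) ≠ 1 := by
      rw [← pow_mul, ← pow_mul, Ne, hprim.pow_eq_one_iff_dvd]
      intro h
      apply hndvd
      rw [show j * (m * (4 * m)) = 4 * m * (j * m) by ring] at h
      exact hcop.dvd_of_dvd_mul_right (Nat.dvd_of_mul_dvd_mul_left (by omega) h)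
    have hs2 : ((ξ ^ j) ^ m) ^ 2 ≠ 1 := fun h => hs4 (by
      rw [show 4 * m = 2 * (2 * m) by ring, pow_mul _ 2, h, one_pow])
    rcases hB with hB | hB | hB
    · refine ⟨hB.ncard_inter_Oset hind hW hφ hinv, ?_⟩
      rw [hB.ncard_inter_Cgam hind hW hφ hinv hm hζ hr0 hs2, Nat.add_sub_cancel]
    · exact absurd hP (hB.notMem_Cgam hW hφ (pow_ne_zero _ hr0) hs2 hPW)
    · exact absurd (hB.pow_eq_one hW hφ hcard1 (pow_ne_zero _ hr0) hPW hP.1) hs4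
  · intro k hk1 hkq hk ⟨P, hPW, hP⟩
    have he : k * (2 * m + 1 + 1) / 2 = k * (m + 1) := by
      rw [show k * (2 * m + 1 + 1) = 2 * (k * (m + 1)) by ring]
      omega
    have hndvd : ¬ m ∣ k := by
      rintro ⟨c, rfl⟩
      have hc : c < 2 := by
        by_contra! hc
        have : m * 2 ≤ m * c := Nat.mul_le_mul_left m hc
        omega
      interval_cases c <;> omega
    rw [he, pow_mul] at hP ⊢
    have hr0 : ξ ^ k ≠ 0 := pow_ne_zero k hξ0
    have hs4 : ((ξ ^ k) ^ (m + 1)) ^ (4 * (m + 1)) ≠ 1 := by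
      rw [← pow_mul, ← pow_mul, Ne, hprim.pow_eq_one_iff_dvd]
      intro h
      apply hndvd
      rw [show k * ((m + 1) * (4 * (m + 1))) = 4 * (m + 1) * (k * (m + 1)) by ring,
        show 4 * m * (m + 1) = 4 * (m + 1) * m by ring] at h
      exact hcop.symm.dvd_of_dvd_mul_right (Nat.dvd_of_mul_dvd_mul_left (by omega) h)
    have hs2 : ((ξ ^ k) ^ (m + 1)) ^ 2 ≠ 1 := fun h => hs4 (by
      rw [show 4 * (m + 1) = 2 * (2 * (m + 1)) by ring, pow_mul _ 2, h, one_pow])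
    rcases hB with hB | hB | hB
    · exact absurd (hB.pow_eq_one hind hW hφ hinv hcard1 (pow_ne_zero _ hr0) hPW hP) hs4
    · exact absurd hP (hB.notMem_Cgam hW hφ (pow_ne_zero _ hr0) hs2 hPW)
    · constructor
      · rw [Set.ncard_eq_zero]
        ext Q
        simp only [Set.mem_inter_iff, Set.mem_empty_iff_false, iff_false, not_and]
        exact fun hQ => hB.notMem_Oset hW hφ hinv hQ
      · rw [hB.ncard_inter_Cgam hind hW hφ hζ' hneg hr0 hs2]
        ring
end
end
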